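/- Let F be a closed orientable surface of genus greater than 1, and let a and a' be disjoint non-separating simple closed curves in F whose union a ∪ a' is non-separating in F. Then there exists a simple closed curve b in F such that b intersects a transversely in exactly one point and b intersects a' transversely in exactly one point. -/

import Mathlib

open Set Metric Topology

noncomputable section

/-- The unit circle in `ℂ`, a model for the circle `S¹`. -/
def circleSet : Set ℂ := Metric.sphere 0 1

/-- The closed unit disk in `ℂ`, a model for the disk `D²`. -/
def diskSet : Set ℂ := Metric.closedBall 0 1

/-- The model solid torus `S¹ × D²`. -/
abbrev SolidTorusModel : Type := ↥circleSet × ↥diskSet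

/-- The core circle `S¹ × {0}` of the model solid torus. -/
def solidTorusCore : Set SolidTorusModel := {p | (p.2 : ℂ) = 0}

/-- The part `S¹ × int D²` of the model solid torus (an open regular
neighbourhood of the core). -/
def solidTorusInner : Set SolidTorusModel := {p | dist (p.2 : ℂ) 0 < 1}

/-- Data exhibiting `M'` as the result of Dehn surgery on a `k`-component link in `M`:
disjoint (closed) tubular neighbourhoods of the link components in `M`, disjoint solid
tori glued back in `M'`, and a homeomorphism between the link exterior in `M` and the
exterior of the glued-in solid tori in `M'`.  (The meridian of each glued solid torus is
thereby identified with an essential simple closed curve on the corresponding torus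
boundary component.) -/
structure DehnSurgeryData (M : Type*) [TopologicalSpace M]
    (M' : Type*) [TopologicalSpace M'] (k : ℕ) where
  /-- closed tubular neighbourhoods of the link components in `M` -/
  tube : Fin k → SolidTorusModel → M
  /-- the solid tori glued back, sitting in `M'` -/
  tube' : Fin k → SolidTorusModel → M'
  embedding_tube : ∀ i, IsEmbedding (tube i)
  embedding_tube' : ∀ i, IsEmbedding (tube' i)
  disjoint_tube : ∀ i j, i ≠ j → Disjoint (range (tube i)) (range (tube j))
  disjoint_tube' : ∀ i j, i ≠ j → Disjoint (range (tube' i)) (range (tube' j))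
  /-- the link exteriors are identified -/
  homeo : ↥((⋃ i, tube i '' solidTorusInner)ᶜ) ≃ₜ ↥((⋃ i, tube' i '' solidTorusInner)ᶜ)

/-- `M'` is obtained from `M` by Dehn surgery on some `k`-component link in `M`. -/
def ObtainedByDehnSurgery (M : Type*) [TopologicalSpace M]
    (M' : Type*) [TopologicalSpace M'] (k : ℕ) : Prop :=
  Nonempty (DehnSurgeryData M M' k)

/-- A planar surface: a disk with `g` holes. -/
def planarModel (g : ℕ) : Set ℂ :=
  Metric.closedBall 0 (g + 1) \ ⋃ i ∈ Finset.range g, Metric.ball (i : ℂ) (1/4)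

/-- The standard genus-`g` handlebody: (disk with `g` holes) × `I`. -/
def handlebodyModel (g : ℕ) : Set (ℂ × ℝ) := planarModel g ×ˢ Icc (0 : ℝ) 1

/-- The standard closed orientable surface of genus `g`, realised as the boundary of the
standard genus-`g` handlebody. -/
def surfaceModel (g : ℕ) : Set (ℂ × ℝ) := frontier (handlebodyModel g)

/-- A Heegaard splitting of genus `g` of `M`: two genus-`g` handlebodies `V`, `W` covering
`M` and meeting exactly along their common boundary surface `V ∩ W`. -/
structure HeegaardSplitting (M : Type*) [TopologicalSpace M] (g : ℕ) where
  V : Set M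
  W : Set M
  union_eq : V ∪ W = univ
  inter_eq_frontier_V : V ∩ W = frontier V
  inter_eq_frontier_W : V ∩ W = frontier W
  homeoV : ↥V ≃ₜ ↥(handlebodyModel g)
  homeoW : ↥W ≃ₜ ↥(handlebodyModel g)
  boundary_V : ∀ x : V, ((x : M) ∈ W ↔ (homeoV x : ℂ × ℝ) ∈ frontier (handlebodyModel g))
  boundary_W : ∀ x : W, ((x : M) ∈ V ↔ (homeoW x : ℂ × ℝ) ∈ frontier (handlebodyModel g))

/-- A space is a closed orientable 3-manifold iff it admits a Heegaard splitting
(Moise; this is the standard combinatorial characterisation). -/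
def IsClosedOrientable3Manifold (M : Type*) [TopologicalSpace M] : Prop :=
  ∃ g, Nonempty (HeegaardSplitting M g)

/-- The Heegaard genus of `M`. -/
def heegaardGenus (M : Type*) [TopologicalSpace M] : ℕ :=
  sInf {g | Nonempty (HeegaardSplitting M g)}

/-- The 3-sphere. -/
def Sphere3 : Type := ↥(Metric.sphere (0 : EuclideanSpace ℝ (Fin 4)) 1)

instance : TopologicalSpace Sphere3 :=
  inferInstanceAs (TopologicalSpace ↥(Metric.sphere (0 : EuclideanSpace ℝ (Fin 4)) 1))

/-- `C` is a simple closed curve contained in `S`. -/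
def IsSimpleClosedCurveIn {X : Type*} [TopologicalSpace X] (C S : Set X) : Prop :=
  C ⊆ S ∧ Nonempty (↥C ≃ₜ ↥circleSet)

/-- `C` bounds a disk inside `S`. -/
def BoundsDiskIn {X : Type*} [TopologicalSpace X] (C S : Set X) : Prop :=
  ∃ D, D ⊆ S ∧ C ⊆ D ∧
    ∃ h : ↥D ≃ₜ ↥diskSet, ∀ x : D, ((x : X) ∈ C ↔ ((h x : ℂ) ∈ circleSet))

/-- `C` is an essential simple closed curve in the surface `S`: it is a simple closed
curve and it does not bound a disk in `S`. -/
def IsEssentialSCCIn {X : Type*} [TopologicalSpace X] (C S : Set X) : Prop :=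
  IsSimpleClosedCurveIn C S ∧ ¬ BoundsDiskIn C S

/-- The curves `C` and `C'` (inside the surface `S`) intersect transversely in a single
point: they meet in exactly one point `p`, and near `p` there is a chart of `S` in which
they look like the two coordinate axes of `ℝ² = ℂ`. -/
def MeetTransversallyOnceIn {X : Type*} [TopologicalSpace X] (C C' S : Set X) : Prop :=
  ∃ p : X, C ∩ C' = {p} ∧
    ∃ U : Set X, U ⊆ S ∧ IsOpen (Subtype.val ⁻¹' U : Set ↥S) ∧
      ∃ hp : p ∈ U, ∃ φ : ↥U → ℂ, IsOpenEmbedding φ ∧ φ ⟨p, hp⟩ = 0 ∧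
        (∀ x : U, ((x : X) ∈ C ↔ (φ x).im = 0)) ∧
        (∀ x : U, ((x : X) ∈ C' ↔ (φ x).re = 0))

/-- `D` is a properly embedded disk in `V` with boundary `D ∩ B` on the surface `B`. -/
def IsProperDiskIn {X : Type*} [TopologicalSpace X] (D V B : Set X) : Prop :=
  D ⊆ V ∧ ∃ h : ↥D ≃ₜ ↥diskSet, ∀ x : D, ((x : X) ∈ B ↔ ((h x : ℂ) ∈ circleSet))

/-- `D` is an essential disk in the handlebody `V` with boundary surface `B`. -/
def IsEssentialDiskIn {X : Type*} [TopologicalSpace X] (D V B : Set X) : Prop :=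
  IsProperDiskIn D V B ∧ IsEssentialSCCIn (D ∩ B) B

/-- `C` is primitive in the handlebody `V` with boundary surface `B`: it is a simple
closed curve on `B` meeting the boundary of some essential disk of `V` transversely in a
single point. -/
def IsPrimitiveIn {X : Type*} [TopologicalSpace X] (C V B : Set X) : Prop :=
  IsSimpleClosedCurveIn C B ∧
    ∃ D, IsEssentialDiskIn D V B ∧ MeetTransversallyOnceIn C (D ∩ B) B

/-- The manifold boundary of `X`: the points having no neighbourhood homeomorphic to an
open subset of `ℝ³` (for a 3-manifold with boundary this is the usual boundary, by
invariance of domain). -/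
def manifoldBoundary (X : Type*) [TopologicalSpace X] : Set X :=
  {x | ¬ ∃ U : Set X, IsOpen U ∧ x ∈ U ∧
    ∃ φ : ↥U → EuclideanSpace ℝ (Fin 3), IsOpenEmbedding φ}

/-- The model annulus `S¹ × I`. -/
abbrev AnnulusModel : Type := ↥circleSet × ↥(Icc (0 : ℝ) 1)


namespace SC

section Part1
/-- `h` has a continuous logarithm on `K`. -/
def HasLog (K : Set ℂ) (h : ℂ → ℂ) : Prop :=
  ∃ g : ℂ → ℂ, ContinuousOn g K ∧ ∀ z ∈ K, Complex.exp (g z) = h z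

lemma HasLog.mono {K L : Set ℂ} {h : ℂ → ℂ} (H : HasLog K h) (hl : L ⊆ K) : HasLog L h := by
  obtain ⟨g, hg, hh⟩ := H
  exact ⟨g, hg.mono hl, fun z hz => hh z (hl hz)⟩

lemma HasLog.congr {K : Set ℂ} {h k : ℂ → ℂ} (H : HasLog K h) (hk : ∀ z ∈ K, h z = k z) :
    HasLog K k := by
  obtain ⟨g, hg, hh⟩ := H
  exact ⟨g, hg, fun z hz => (hh z hz).trans (hk z hz)⟩

lemma HasLog.mul {K : Set ℂ} {h k : ℂ → ℂ} (H : HasLog K h) (H' : HasLog K k) :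
    HasLog K (fun z => h z * k z) := by
  obtain ⟨g, hg, hh⟩ := H
  obtain ⟨g', hg', hh'⟩ := H'
  exact ⟨fun z => g z + g' z, hg.add hg', fun z hz => by
    rw [Complex.exp_add, hh z hz, hh' z hz]⟩

lemma HasLog.inv {K : Set ℂ} {h : ℂ → ℂ} (H : HasLog K h) :
    HasLog K (fun z => (h z)⁻¹) := by
  obtain ⟨g, hg, hh⟩ := H
  exact ⟨fun z => - g z, hg.neg, fun z hz => by
    rw [Complex.exp_neg, hh z hz]⟩

lemma hasLog_of_slit {K : Set ℂ} {h : ℂ → ℂ} (hc : ContinuousOn h K)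
    (hs : ∀ z ∈ K, h z ∈ Complex.slitPlane) : HasLog K h :=
  ⟨fun z => Complex.log (h z), hc.clog hs, fun z hz =>
    Complex.exp_log (Complex.slitPlane_ne_zero (hs z hz))⟩

/-- `(z - w) / (z - w')` has a continuous logarithm on `K`. -/
def LR (K : Set ℂ) (w w' : ℂ) : Prop := HasLog K (fun z => (z - w) / (z - w'))

lemma LR.symm {K : Set ℂ} {w w' : ℂ} (h : LR K w w') : LR K w' w :=
  h.inv.congr (fun z _ => by rw [inv_div])

lemma LR.trans {K : Set ℂ} {u v w : ℂ} (hv : v ∉ K) (h : LR K u v) (h' : LR K v w) :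
    LR K u w :=
  (HasLog.mul h h').congr (fun z hz => by
    have : z - v ≠ 0 := sub_ne_zero.2 (fun e => hv (e ▸ hz))
    rw [div_mul_div_cancel₀ this])

lemma LR_near {K : Set ℂ} (hK : IsClosed K) {w : ℂ} (hw : w ∉ K) :
    ∃ ε > 0, ∀ w' ∈ ball w ε, LR K w w' := by
  obtain ⟨ε, h0, h⟩ := Metric.isOpen_iff.1 hK.isOpen_compl w hw
  refine ⟨ε, h0, fun w' hw' => LR.symm ?_⟩
  have hne : ∀ z ∈ K, z - w ≠ 0 := fun z hz => sub_ne_zero.2 (fun e => hw (e ▸ hz))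
  apply hasLog_of_slit
  · exact ContinuousOn.div (by fun_prop) (by fun_prop) hne
  · intro z hz
    have h1 : (z - w') / (z - w) = 1 + (w - w') / (z - w) := by
      have := hne z hz
      field_simp
      ring
    rw [h1]
    apply Complex.mem_slitPlane_of_norm_lt_one
    have h2 : ε ≤ ‖z - w‖ := by
      by_contra hlt
      push Not at hlt
      exact h (mem_ball_iff_norm.2 hlt) hz
    have h3 : ‖w - w'‖ < ε := by
      rw [← dist_eq_norm]; rw [mem_ball'] at hw'; exact hw'
    rw [norm_div, div_lt_one (by linarith)]
    linarith

lemma LR_of_preconnected {K S : Set ℂ} (hK : IsClosed K) (hS : IsPreconnected S)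
    (hd : ∀ z ∈ S, z ∉ K) {w w' : ℂ} (hw : w ∈ S) (hw' : w' ∈ S) : LR K w w' := by
  refine hS.induction₂ (fun x y => LR K x y) ?_ ?_ ?_ hw hw'
  · intro x hx
    obtain ⟨ε, h0, h⟩ := LR_near hK (hd x hx)
    exact mem_nhdsWithin_of_mem_nhds (Filter.mem_of_superset (ball_mem_nhds x h0) h)
  · intro x y z _ hy _ h1 h2
    exact LR.trans (hd y hy) h1 h2
  · intro x y _ _ h
    exact h.symm

/-- `K` does not separate `w` from `w'`. -/
def NotSep (K : Set ℂ) (w w' : ℂ) : Prop :=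
  ∃ S : Set ℂ, IsPreconnected S ∧ (∀ z ∈ S, z ∉ K) ∧ w ∈ S ∧ w' ∈ S

lemma NotSep.symm {K : Set ℂ} {w w' : ℂ} (h : NotSep K w w') : NotSep K w' w := by
  obtain ⟨S, h1, h2, h3, h4⟩ := h
  exact ⟨S, h1, h2, h4, h3⟩

lemma NotSep.LR {K : Set ℂ} (hK : IsClosed K) {w w' : ℂ} (h : NotSep K w w') : LR K w w' := by
  obtain ⟨S, h1, h2, h3, h4⟩ := h
  exact LR_of_preconnected hK h1 h2 h3 h4

lemma no_log_circle {w : ℂ} {R : ℝ} (hR : 0 < R) {g : ℂ → ℂ} (hg : Continuous g)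
    (h : ∀ z ∈ sphere w R, Complex.exp (g z) = z - w) : False := by
  let u : ℝ → ℂ := fun θ => (g (w + R * Complex.exp (θ * Complex.I)) - θ * Complex.I
    - Real.log R) / (2 * Real.pi * Complex.I)
  have hpi : (2 * Real.pi * Complex.I : ℂ) ≠ 0 := Complex.two_pi_I_ne_zero
  have huc : Continuous u := by
    simp only [u]
    fun_prop
  have hIntg : ∀ θ, ∃ n : ℤ, u θ = n := by
    intro θ
    have h1 : Complex.exp (g (w + R * Complex.exp (θ * Complex.I))) =
        R * Complex.exp (θ * Complex.I) := by
      rw [h]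
      · ring
      · rw [mem_sphere_iff_norm]
        simp [Complex.norm_exp_ofReal_mul_I, abs_of_pos hR]
    have h2 : Complex.exp (g (w + R * Complex.exp (θ * Complex.I)) - θ * Complex.I
        - Real.log R) = 1 := by
      rw [Complex.exp_sub, Complex.exp_sub, h1, ← Complex.ofReal_exp, Real.exp_log hR]
      have : (R : ℂ) ≠ 0 := by exact_mod_cast hR.ne'
      field_simp [Complex.exp_ne_zero]
    obtain ⟨n, hn⟩ := Complex.exp_eq_one_iff.1 h2
    refine ⟨n, ?_⟩
    simp only [u]
    rw [hn]
    field_simp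
  have hre : Continuous (fun θ => (u θ).re) := Complex.continuous_re.comp huc
  choose n hn using hIntg
  have hnr : ∀ θ, (u θ).re = n θ := fun θ => by rw [hn]; simp
  have hnc : Continuous n := by
    have : Continuous (fun θ => ((n θ : ℤ) : ℝ)) := by simpa [hnr] using hre
    exact Int.isClosedEmbedding_coe_real.isEmbedding.continuous_iff.2 this
  have hconst : n 0 = n (2 * Real.pi) :=
    PreconnectedSpace.constant inferInstance hnc
  have e1 : u 0 = u (2 * Real.pi) := by rw [hn, hn, hconst]
  simp only [u] at e1
  rw [div_left_inj' hpi] at e1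
  have : (((2 * Real.pi : ℝ) : ℂ) * Complex.I) = 2 * Real.pi * Complex.I := by push_cast; ring
  rw [this, Complex.exp_two_pi_mul_I] at e1
  simp only [Complex.ofReal_zero, zero_mul, Complex.exp_zero, mul_one, sub_zero] at e1
  exact hpi (by linear_combination e1)

lemma exists_log_univ {h : ℂ → ℂ} (hc : Continuous h) (h0 : ∀ z, h z ≠ 0) :
    ∃ g : ℂ → ℂ, Continuous g ∧ ∀ z, Complex.exp (g z) = h z := by
  have hs : IsSimplyConnected (univ : Set ℂ) := by
    have : SimplyConnectedSpace (univ : Set ℂ) :=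
      ContinuousMap.HomotopyEquiv.simplyConnectedSpace (Y := ℂ)
        (Homeomorph.Set.univ ℂ).toHomotopyEquiv
    exact this
  obtain ⟨g, hg, hh⟩ := Complex.exists_continuousOn_eqOn_exp_comp hs isOpen_univ
    (g := h) hc.continuousOn (by rintro ⟨z, -, hz⟩; exact h0 z hz)
  exact ⟨g, continuousOn_univ.1 hg, fun z => hh (mem_univ z)⟩

lemma no_ext {w : ℂ} {R : ℝ} (hR : 0 < R) {h : ℂ → ℂ} (hc : Continuous h) (h0 : ∀ z, h z ≠ 0)
    (hs : ∀ z ∈ sphere w R, h z = z - w) : False := by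
  obtain ⟨g, hg, hh⟩ := exists_log_univ hc h0
  exact no_log_circle hR hg (fun z hz => (hh z).trans (hs z hz))

lemma isPreconnected_compl_closedBall (c : ℂ) (R : ℝ) : IsPreconnected (closedBall c R)ᶜ :=
  by
  rcases lt_or_ge R 0 with hR | hR
  · rw [closedBall_eq_empty.2 hR, compl_empty]
    exact isPreconnected_univ
  have : (closedBall c R)ᶜ =
      (fun p : ℝ × ℝ => c + p.1 * Complex.exp (p.2 * Complex.I)) '' (Ioi R ×ˢ univ) := by
    ext z
    rw [mem_compl_iff, mem_closedBall_iff_norm, not_le]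
    constructor
    · intro hz
      refine ⟨(‖z - c‖, (z - c).arg), ⟨hz, mem_univ _⟩, ?_⟩
      simp [Complex.norm_mul_exp_arg_mul_I]
    · rintro ⟨⟨r, θ⟩, ⟨hr, -⟩, rfl⟩
      simp only [mem_Ioi] at hr
      simp [Complex.norm_exp_ofReal_mul_I, abs_of_pos (hR.trans_lt hr), hr]
  rw [this]
  exact (isPreconnected_Ioi.prod isPreconnected_univ).image _ (by fun_prop)

lemma eilenberg_aux {K V : Set ℂ} (hK : IsCompact K) {w w' : ℂ} (hV : IsOpen V)
    (hfr : frontier V ⊆ K) (hb : Bornology.IsBounded V) (hw : w ∈ V) (hw' : w' ∉ closure V)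
    (h : LR K w w') : False := by
  obtain ⟨g, hg, hh⟩ := h
  obtain ⟨G, hG⟩ := ContinuousMap.exists_restrict_eq (Y := ℂ) hK.isClosed
    ⟨K.domRestrict g, continuousOn_iff_continuous_domRestrict.1 hg⟩
  have hGg : ∀ z ∈ K, G z = g z := fun z hz => by
    exact DFunLike.congr_fun hG ⟨z, hz⟩
  obtain ⟨R, hR0, hR⟩ : ∃ R > 0, closure V ⊆ ball w R := by
    obtain ⟨R, hR⟩ := hb.closure.subset_ball w
    exact ⟨max R 1, by positivity, hR.trans (ball_subset_ball (le_max_left _ _))⟩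
  classical
  let H : ℂ → ℂ := V.piecewise (fun z => Complex.exp (G z) * (z - w')) (fun z => z - w)
  have hHc : Continuous H := by
    apply Continuous.piecewise
    · intro z hz
      have hzK := hfr hz
      have hne : z - w' ≠ 0 := by
        intro e
        rw [sub_eq_zero] at e
        exact hw' (e ▸ hz.1)
      rw [hGg z hzK, hh z hzK]
      simp only
      field_simp
    · fun_prop
    · fun_prop
  have hH0 : ∀ z, H z ≠ 0 := by
    intro z
    by_cases hz : z ∈ V
    · simp only [H, piecewise_eq_of_mem _ _ _ hz]
      refine mul_ne_zero (Complex.exp_ne_zero _) (sub_ne_zero.2 ?_)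
      rintro rfl
      exact hw' (subset_closure hz)
    · simp only [H, piecewise_eq_of_notMem _ _ _ hz]
      refine sub_ne_zero.2 ?_
      rintro rfl
      exact hz hw
  refine no_ext (w := w) hR0 hHc hH0 (fun z hz => ?_)
  have hz : z ∉ V := fun hzV => by
    have := hR (subset_closure hzV)
    rw [mem_ball] at this
    rw [mem_sphere] at hz
    linarith
  simp only [H, piecewise_eq_of_notMem _ _ _ hz]

lemma eilenberg {K : Set ℂ} (hK : IsCompact K) {w w' : ℂ} (hw : w ∉ K) (hw' : w' ∉ K)
    (h : LR K w w') : NotSep K w w' := by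
  by_contra hn
  have hop : IsOpen Kᶜ := hK.isClosed.isOpen_compl
  -- components
  have key : ∀ x y : ℂ, x ∉ K → y ∉ K → ¬ NotSep K x y → LR K x y →
      Bornology.IsBounded (connectedComponentIn Kᶜ x) → False := by
    intro x y hx hy hxy hl hb
    have hVo : IsOpen (connectedComponentIn Kᶜ x) := hop.connectedComponentIn
    have hfr : frontier (connectedComponentIn Kᶜ x) ⊆ K := by
      intro z hz
      by_contra hzK
      have hz1 : z ∈ closure (connectedComponentIn Kᶜ x) := hz.1
      have hz2 : z ∉ connectedComponentIn Kᶜ x := fun h' => by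
        have := hz.2
        rw [hVo.interior_eq] at this
        exact this h'
      have : IsPreconnected (insert z (connectedComponentIn Kᶜ x)) :=
        isPreconnected_connectedComponentIn.subset_closure (subset_insert _ _)
          (insert_subset hz1 subset_closure)
      have hsub := this.subset_connectedComponentIn (x := x) (F := Kᶜ)
        (mem_insert_of_mem _ (mem_connectedComponentIn hx))
        (insert_subset hzK (connectedComponentIn_subset _ _))
      exact hz2 (hsub (mem_insert _ _))
    have hyV : y ∉ closure (connectedComponentIn Kᶜ x) := by
      intro hyc
      by_cases hyV : y ∈ connectedComponentIn Kᶜ x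
      · exact hxy ⟨_, isPreconnected_connectedComponentIn,
          fun z hz => connectedComponentIn_subset _ _ hz, mem_connectedComponentIn hx, hyV⟩
      · exact hy (hfr ⟨hyc, by rwa [hVo.interior_eq]⟩)
    exact eilenberg_aux hK hVo hfr hb (mem_connectedComponentIn hx) hyV hl
  by_cases hb : Bornology.IsBounded (connectedComponentIn Kᶜ w)
  · exact key w w' hw hw' hn h hb
  by_cases hb' : Bornology.IsBounded (connectedComponentIn Kᶜ w')
  · exact key w' w hw' hw (fun h => hn h.symm) h.symm hb'
  -- both unbounded
  obtain ⟨R, hR⟩ := hK.isBounded.subset_closedBall 0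
  have hout : ∀ x, ¬ Bornology.IsBounded (connectedComponentIn Kᶜ x) →
      ∃ y ∈ connectedComponentIn Kᶜ x, y ∈ (closedBall (0 : ℂ) R)ᶜ := by
    intro x hx
    by_contra hcon
    push Not at hcon
    exact hx (isBounded_closedBall.subset (fun y hy => not_notMem.1 (hcon y hy)))
  obtain ⟨y, hy1, hy2⟩ := hout w hb
  obtain ⟨y', hy1', hy2'⟩ := hout w' hb'
  apply hn
  have hpre := isPreconnected_compl_closedBall (0 : ℂ) R
  have hu := (isPreconnected_connectedComponentIn (x := w) (F := Kᶜ)).union y hy1 hy2 hpre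
  have hu2 := hu.union y' (Or.inr hy2') hy1' (isPreconnected_connectedComponentIn (x := w') (F := Kᶜ))
  refine ⟨_, hu2, ?_, Or.inl (Or.inl (mem_connectedComponentIn hw)),
    Or.inr (mem_connectedComponentIn hw')⟩
  rintro z ((hz | hz) | hz)
  · exact connectedComponentIn_subset _ _ hz
  · exact fun hzK => hz (hR hzK)
  · exact connectedComponentIn_subset _ _ hz

/-- Janiszewski's theorem. -/
theorem janiszewski {A B : Set ℂ} (hA : IsCompact A) (hB : IsCompact B)
    (hAB : IsPreconnected (A ∩ B)) {w w' : ℂ} (hw : w ∉ A ∪ B) (hw' : w' ∉ A ∪ B)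
    (h1 : NotSep A w w') (h2 : NotSep B w w') : NotSep (A ∪ B) w w' := by
  apply eilenberg (hA.union hB) hw hw'
  obtain ⟨a, ha, ha'⟩ := h1.LR hA.isClosed
  obtain ⟨b, hb, hb'⟩ := h2.LR hB.isClosed
  -- difference is a constant multiple of `2 π i`
  obtain ⟨n, hn⟩ : ∃ n : ℤ, ∀ z ∈ A ∩ B, a z = b z + n * (2 * Real.pi * Complex.I) := by
    have hIntg : ∀ z ∈ A ∩ B, ∃ n : ℤ, a z = b z + n * (2 * Real.pi * Complex.I) := by
      intro z hz
      exact Complex.exp_eq_exp_iff_exists_int.1 ((ha' z hz.1).trans (hb' z hz.2).symm)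
    choose! n hn using hIntg
    rcases (A ∩ B).eq_empty_or_nonempty with he | ⟨z0, hz0⟩
    · exact ⟨0, fun z hz => by simp [he] at hz⟩
    refine ⟨n z0, fun z hz => ?_⟩
    have hc : ContinuousOn (fun z => ((n z : ℤ) : ℝ)) (A ∩ B) := by
      have : ContinuousOn (fun z => ((a z - b z) / (2 * Real.pi * Complex.I)).re) (A ∩ B) :=
        Complex.continuous_re.comp_continuousOn
          (((ha.mono inter_subset_left).sub (hb.mono inter_subset_right)).div_const _)
      refine this.congr (fun z hz => ?_)
      have hpi : (2 * Real.pi * Complex.I : ℂ) ≠ 0 := Complex.two_pi_I_ne_zero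
      have : (a z - b z) / (2 * Real.pi * Complex.I) = (n z : ℂ) := by
        rw [hn z hz]
        field_simp
        ring
      simp [this]
    have hc' : ContinuousOn n (A ∩ B) := by
      rwa [Int.isClosedEmbedding_coe_real.isEmbedding.continuousOn_iff]
    rw [← hAB.constant hc' hz hz0]
    exact hn z hz
  classical
  let b' : ℂ → ℂ := fun z => b z + n * (2 * Real.pi * Complex.I)
  have hb2 : ∀ z, Complex.exp (b' z) = Complex.exp (b z) := fun z => by
    simp only [b', Complex.exp_add, Complex.exp_int_mul_two_pi_mul_I, mul_one]
  refine ⟨fun z => if z ∈ A then a z else b' z, ?_, ?_⟩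
  · apply ContinuousOn.union_of_isClosed
    · exact ha.congr (fun z hz => by simp [hz])
    · have : ContinuousOn b' B := hb.add continuousOn_const
      refine this.congr (fun z hz => ?_)
      by_cases hzA : z ∈ A
      · simp only [hzA, if_true]
        exact hn z ⟨hzA, hz⟩
      · simp [hzA]
    · exact hA.isClosed
    · exact hB.isClosed
  · intro z hz
    by_cases hzA : z ∈ A
    · simp only [hzA, if_true]
      exact ha' z hzA
    · simp only [hzA, if_false]
      rw [hb2]
      exact hb' z (hz.resolve_left hzA)

/-- A planar arc does not separate the plane. -/
theorem arc_notSep {γ : ℝ → ℂ} (hc : ContinuousOn γ (Icc 0 1)) (hi : InjOn γ (Icc 0 1))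
    {w w' : ℂ} (hw : w ∉ γ '' Icc 0 1) (hw' : w' ∉ γ '' Icc 0 1) :
    NotSep (γ '' Icc 0 1) w w' := by
  have hK : IsCompact (γ '' Icc 0 1) := isCompact_Icc.image_of_continuousOn hc
  apply eilenberg hK hw hw'
  -- lift along the interval
  let h : ℝ → ℂ := fun t => (γ (projIcc 0 1 zero_le_one t) - w) / (γ (projIcc 0 1 zero_le_one t) - w')
  have hγ' : Continuous (fun t : ℝ => γ (projIcc 0 1 zero_le_one t)) :=
    (continuousOn_iff_continuous_domRestrict.1 hc).comp continuous_projIcc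
  have hm : ∀ t : ℝ, γ (projIcc 0 1 zero_le_one t) ∈ γ '' Icc 0 1 := fun t =>
    ⟨_, (projIcc 0 1 zero_le_one t).2, rfl⟩
  have hne : ∀ t : ℝ, γ (projIcc 0 1 zero_le_one t) - w ≠ 0 := fun t =>
    sub_ne_zero.2 (fun e => hw (e ▸ hm t))
  have hne' : ∀ t : ℝ, γ (projIcc 0 1 zero_le_one t) - w' ≠ 0 := fun t =>
    sub_ne_zero.2 (fun e => hw' (e ▸ hm t))
  have hhc : Continuous h := by
    simp only [h]
    exact Continuous.div (hγ'.sub continuous_const) (hγ'.sub continuous_const) hne'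
  have hs : IsSimplyConnected (univ : Set ℝ) := by
    have : SimplyConnectedSpace (univ : Set ℝ) :=
      ContinuousMap.HomotopyEquiv.simplyConnectedSpace (Y := ℝ)
        (Homeomorph.Set.univ ℝ).toHomotopyEquiv
    exact this
  obtain ⟨g, hg, hh⟩ := Complex.exists_continuousOn_eqOn_exp_comp hs isOpen_univ
    (g := h) hhc.continuousOn (by rintro ⟨z, -, hz⟩; exact div_ne_zero (hne z) (hne' z) hz)
  rw [continuousOn_univ] at hg
  -- inverse of γ
  let ι := Function.invFunOn γ (Icc 0 1)
  have hιl : ∀ t ∈ Icc (0:ℝ) 1, ι (γ t) = t := fun t ht =>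
    hi.leftInvOn_invFunOn ht
  have hιc : ContinuousOn ι (γ '' Icc 0 1) := by
    rw [continuousOn_iff_isClosed]
    intro t ht
    refine ⟨γ '' (t ∩ Icc 0 1), ?_, ?_⟩
    · exact ((isCompact_Icc.inter_left ht).image_of_continuousOn
        (hc.mono inter_subset_right)).isClosed
    · ext z
      constructor
      · rintro ⟨hz, s, hs, rfl⟩
        refine ⟨⟨s, ⟨?_, hs⟩, rfl⟩, s, hs, rfl⟩
        rw [mem_preimage, hιl s hs] at hz
        exact hz
      · rintro ⟨⟨s, ⟨hs1, hs2⟩, rfl⟩, -⟩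
        refine ⟨?_, s, hs2, rfl⟩
        rw [mem_preimage, hιl s hs2]
        exact hs1
  refine ⟨fun z => g (ι z), hg.comp_continuousOn hιc, ?_⟩
  rintro _ ⟨t, ht, rfl⟩
  simp only [hιl t ht]
  have := hh (mem_univ t)
  simp only [Function.comp, h, projIcc_of_mem zero_le_one ht] at this
  exact this
end Part1

section Part2
lemma sqrt_on_compact {V K : Set ℂ} (hV1 : V ⊆ ball 0 1) (h0 : (0:ℂ) ∉ V)
    (hE : IsPreconnected (closedBall (0:ℂ) 1 \ V)) (hK : IsCompact K) (hKV : K ⊆ V) :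
    ∃ τ : ℂ → ℂ, ContinuousOn τ K ∧ ∀ z ∈ K, τ z ^ 2 = z := by
  have h1 : LR K 0 1 := by
    refine LR_of_preconnected hK.isClosed hE (fun z hz hzK => hz.2 (hKV hzK)) ⟨by simp, h0⟩
      ⟨by simp, fun h => ?_⟩
    have := hV1 h
    simp at this
  obtain ⟨g, hg, hge⟩ := h1
  obtain ⟨l, hl, hle⟩ : HasLog K (fun z => 1 - z) := by
    refine hasLog_of_slit (by fun_prop) fun z hz => ?_
    have := hV1 (hKV hz)
    rw [mem_ball_zero_iff] at this
    left
    have h2 := Complex.re_le_norm z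
    simp; linarith
  refine ⟨fun z => Complex.I * Complex.exp (g z / 2) * Complex.exp (l z / 2), ?_, ?_⟩
  · have : ContinuousOn (fun z => Complex.exp (g z / 2)) K :=
      Complex.continuous_exp.comp_continuousOn (hg.div_const 2)
    have : ContinuousOn (fun z => Complex.exp (l z / 2)) K :=
      Complex.continuous_exp.comp_continuousOn (hl.div_const 2)
    fun_prop
  · intro z hz
    have e1 := hge z hz
    have e2 := hle z hz
    have e3 : z - 1 ≠ 0 := by
      intro h
      have := hV1 (hKV hz)
      rw [sub_eq_zero.1 h] at this
      simp at this
    simp only [mul_pow, ← Complex.exp_nat_mul]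
    push_cast
    rw [mul_div_cancel₀ _ (by norm_num), mul_div_cancel₀ _ (by norm_num), e1, e2]
    simp
    field_simp
    ring

lemma exists_sqrt {V : Set ℂ} (hVo : IsOpen V) (hVc : IsConnected V) (hV1 : V ⊆ ball 0 1)
    (h0 : (0:ℂ) ∉ V) (hE : IsPreconnected (closedBall (0:ℂ) 1 \ V)) :
    ∃ s : ℂ → ℂ, ContinuousOn s V ∧ (∀ z ∈ V, s z ^ 2 = z) ∧
      IsPreconnected (closedBall (0:ℂ) 1 \ s '' V) := by
  set q : ℂ → ℂ := fun z => z ^ 2 with hq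
  have hqc : Continuous q := by fun_prop
  set Y : Set ℂ := q ⁻¹' V with hY
  have hYo : IsOpen Y := hVo.preimage hqc
  have hYn : ∀ y ∈ Y, -y ∈ Y := fun y hy => by
    simpa [Y, q] using hy
  have hne : ∀ y ∈ Y, y ≠ 0 := by
    rintro y hy rfl
    exact h0 (by simpa [Y, q] using hy)
  have key : ∀ y, ¬ JoinedIn Y y (-y) := by
    rintro y ⟨p, hp⟩
    obtain ⟨τ, hτ, hτ2⟩ := sqrt_on_compact (K := range (fun t => q (p t))) hV1 h0 hE
      (isCompact_range (by fun_prop)) (by rintro _ ⟨t, rfl⟩; exact hp t)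
    have hτc : Continuous fun t => τ (q (p t)) :=
      hτ.comp_continuous (by fun_prop) (fun t => mem_range_self t)
    have := IsPreconnected.eq_or_eq_neg_of_sq_eq (S := (univ : Set unitInterval))
      (f := fun t => p t) (g := fun t => τ (q (p t))) isPreconnected_univ
      (by fun_prop) hτc.continuousOn
      (fun t _ => by
        have := hτ2 (q (p t)) (mem_range_self t)
        simp only [Pi.pow_apply, this]; rfl)
      (fun {t} _ h => hne _ (hp t) (by
        have := hτ2 (q (p t)) (mem_range_self t)
        simp only [h] at this
        have h3 : p t ^ 2 = 0 := by simpa [q] using this.symm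
        exact pow_eq_zero_iff (two_ne_zero) |>.1 h3))
    have hy : y ∈ Y := by simpa using hp 0
    have e : q (p 0) = q (p 1) := by simp [q]
    have : y = -y := by
      rcases this with h | h
      · have a := h (mem_univ 0)
        have b := h (mem_univ 1)
        simp only [e] at a b
        rw [← b] at a
        simpa using a
      · have a := h (mem_univ 0)
        have b := h (mem_univ 1)
        simp only [e, Pi.neg_apply] at a b
        rw [← b] at a
        simpa using a
    exact hne y hy (by simpa [self_eq_neg] using this)
  obtain ⟨v0, hv0⟩ := hVc.nonempty
  obtain ⟨s0, hs0⟩ : ∃ s0 : ℂ, s0 ^ 2 = v0 := IsAlgClosed.exists_pow_nat_eq v0 (by norm_num)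
  have hs0Y : s0 ∈ Y := by simpa [Y, q, hs0] using hv0
  set Y0 := pathComponentIn Y s0 with hY0
  have hY0o : IsOpen Y0 := hYo.pathComponentIn s0
  have hY0Y : Y0 ⊆ Y := pathComponentIn_subset
  have hdj : ∀ y ∈ Y0, -y ∉ Y0 := fun y hy hy' =>
    key y ((JoinedIn.symm hy).trans hy')
  have hinj : InjOn q Y0 := by
    intro x hx y hy h
    rcases sq_eq_sq_iff_eq_or_eq_neg.1 h with h | h
    · exact h
    · exact absurd (h ▸ hx : -y ∈ Y0) (hdj y hy)
  have hsurj : ∀ z ∈ V, ∃ y ∈ Y0, q y = z := by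
    intro z hz
    obtain ⟨p, hp⟩ := ((hVo.isConnected_iff_isPathConnected).1 hVc).joinedIn v0 hv0 z hz
    obtain ⟨τ, hτ, hτ2⟩ := sqrt_on_compact (K := range p) hV1 h0 hE
      (isCompact_range (by fun_prop)) (by rintro _ ⟨t, rfl⟩; exact hp t)
    have hτc : Continuous fun t => τ (p t) :=
      hτ.comp_continuous (by fun_prop) (fun t => mem_range_self t)
    have h1 : τ v0 ^ 2 = s0 ^ 2 := by
      rw [hs0]; exact hτ2 v0 ⟨0, by simp⟩
    have h2 : τ z ^ 2 = z := hτ2 z ⟨1, by simp⟩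
    obtain ⟨ε, hε, hε1⟩ : ∃ ε : ℂ, ε ^ 2 = 1 ∧ ε * τ v0 = s0 := by
      rcases sq_eq_sq_iff_eq_or_eq_neg.1 h1 with h | h
      · exact ⟨1, by simp, by simp [h]⟩
      · exact ⟨-1, by simp, by simp [h]⟩
    refine ⟨ε * τ z, ?_, by simp [q, mul_pow, hε, h2]⟩
    refine ⟨⟨⟨fun t => ε * τ (p t), continuous_const.mul hτc⟩, by simpa using hε1, by simp⟩, fun t => ?_⟩
    have := hτ2 (p t) ⟨t, rfl⟩
    have h4 := hp t
    simp [Y, q, mul_pow, hε, this, h4]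
  have hYcov : ∀ y ∈ Y, y ∈ Y0 ∨ -y ∈ Y0 := by
    intro y hy
    obtain ⟨x, hx, hxy⟩ := hsurj (q y) hy
    rcases sq_eq_sq_iff_eq_or_eq_neg.1 hxy with h | h
    · left; rwa [← h]
    · right; rwa [← h]
  choose! s hsY hsq using hsurj
  have hsl : ∀ y ∈ Y0, s (q y) = y := fun y hy => hinj (hsY _ (hY0Y hy)) hy (hsq _ (hY0Y hy))
  have him : s '' V = Y0 := by
    ext y; constructor
    · rintro ⟨z, hz, rfl⟩; exact hsY z hz
    · intro hy; exact ⟨q y, hY0Y hy, hsl y hy⟩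
  have hscont : ContinuousOn s V := by
    intro z hz
    apply ContinuousAt.continuousWithinAt
    have hy := hsY z hz
    have hd : HasStrictDerivAt q (2 * s z) (s z) := by
      have := (hasStrictDerivAt_pow 2 (s z))
      simpa using this
    have hm := hd.map_nhds_eq (by simpa using hne _ (hY0Y hy))
    rw [hsq z hz] at hm
    rw [ContinuousAt, ← hm, Filter.tendsto_map'_iff]
    refine (Filter.tendsto_id).congr' ?_
    filter_upwards [hY0o.mem_nhds hy] with y hy
    exact (hsl y hy).symm
  refine ⟨s, hscont, hsq, ?_⟩
  rw [him]
  have hYb : ∀ y ∈ Y, ‖y‖ < 1 := by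
    intro y hy
    have := hV1 hy
    rw [mem_ball_zero_iff] at this
    simp only [q, norm_pow] at this
    nlinarith [norm_nonneg y]
  have hE'c : IsCompact (closedBall (0:ℂ) 1 \ Y0) := (isCompact_closedBall _ _).diff hY0o
  have hEc : IsCompact (closedBall (0:ℂ) 1 \ V) := (isCompact_closedBall _ _).diff hVo
  have hsph : sphere (0:ℂ) 1 ⊆ closedBall (0:ℂ) 1 \ Y0 := by
    intro z hz
    refine ⟨sphere_subset_closedBall hz, fun h => ?_⟩
    have := hYb z (hY0Y h)
    simp at hz; linarith
  have main : ∀ u v : Set ℂ, IsClosed u → IsClosed v → closedBall (0:ℂ) 1 \ Y0 ⊆ u ∪ v →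
      Disjoint u v → sphere (0:ℂ) 1 ⊆ u → closedBall (0:ℂ) 1 \ Y0 ⊆ u := by
    intro u v hu hv huv hd hs
    set E' := closedBall (0:ℂ) 1 \ Y0 with hE'
    set A := E' ∩ u
    set B := E' ∩ v
    have hA : IsCompact A := hE'c.inter_right hu
    have hB : IsCompact B := hE'c.inter_right hv
    have hAB : ∀ x ∈ A, x ∉ B := fun x hx hx' => disjoint_left.1 hd hx.2 hx'.2
    have hcov : ∀ x ∈ E', x ∈ A ∨ x ∈ B := fun x hx => (huv hx).imp (⟨hx, ·⟩) (⟨hx, ·⟩)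
    have hA2 : IsCompact (A ∩ Neg.neg ⁻¹' A) :=
      hA.inter_right (hA.isClosed.preimage continuous_neg)
    have hEB : ∀ b ∈ B, q b ∉ closedBall (0:ℂ) 1 \ V := by
      have := (isPreconnected_iff_subset_of_fully_disjoint_closed hEc.isClosed).1 hE
        (closedBall (0:ℂ) 1 \ V ∩ q '' (A ∩ Neg.neg ⁻¹' A)) (closedBall (0:ℂ) 1 \ V ∩ q '' B)
        (hEc.isClosed.inter (hA2.image hqc).isClosed) (hEc.isClosed.inter (hB.image hqc).isClosed)
        ?_ ?_
      · rcases this with h | h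
        · intro b hb hbE
          obtain ⟨-, a, ha, hab⟩ := h hbE
          rcases sq_eq_sq_iff_eq_or_eq_neg.1 hab with h | h
          · exact hAB a ha.1 (h ▸ hb)
          · exact hAB (-a) ha.2 (by rw [h, neg_neg]; exact hb)
        · exfalso
          have h1 : (1:ℂ) ∈ closedBall (0:ℂ) 1 \ V := ⟨by simp, fun h => by
            have := hV1 h; simp at this⟩
          obtain ⟨-, b, hb, hb1⟩ := h h1
          have : b ∈ sphere (0:ℂ) 1 := by
            have : ‖b‖ ^ 2 = 1 := by rw [← norm_pow]; simp only [q] at hb1; simp [hb1]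
            simp
            nlinarith [norm_nonneg b]
          exact hAB b ⟨hsph this, hs this⟩ hb
      · intro e he
        obtain ⟨x, hx⟩ : ∃ x : ℂ, x ^ 2 = e := IsAlgClosed.exists_pow_nat_eq e (by norm_num)
        have hxn : ‖x‖ ≤ 1 := by
          have := he.1
          rw [← hx, mem_closedBall_zero_iff, norm_pow] at this
          nlinarith [norm_nonneg x]
        have hxY : x ∉ Y := fun h => he.2 (by simpa [Y, q, hx] using h)
        have h1 : x ∈ E' := ⟨by simpa using hxn, fun h => hxY (hY0Y h)⟩
        have h2 : -x ∈ E' := ⟨by simpa using hxn, fun h => hxY (by simpa using hYn _ (hY0Y h))⟩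
        rcases hcov x h1 with a | a
        · rcases hcov _ h2 with b | b
          · left; exact ⟨he, x, ⟨a, b⟩, hx⟩
          · right; exact ⟨he, -x, b, by simp [q, hx]⟩
        · right; exact ⟨he, x, a, hx⟩
      · rw [disjoint_left]
        rintro e ⟨-, a, ha, rfl⟩ ⟨-, b, hb, hab⟩
        rcases sq_eq_sq_iff_eq_or_eq_neg.1 hab with h | h
        · exact hAB a ha.1 (h ▸ hb)
        · exact hAB (-a) ha.2 (by rw [← h]; exact hb)
    have hBeq : B = (Neg.neg ⁻¹' Y0) ∩ Aᶜ := by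
      ext b; constructor
      · intro hb
        refine ⟨?_, fun h => hAB b h hb⟩
        have hbY : b ∈ Y := by
          by_contra h
          refine hEB b hb ⟨?_, h⟩
          have := hb.1.1
          simp only [mem_closedBall_zero_iff, q, norm_pow] at this ⊢
          nlinarith [norm_nonneg b]
        exact (hYcov b hbY).resolve_left hb.1.2
      · rintro ⟨hb, hbA⟩
        refine (hcov b ⟨?_, fun h => hdj b h hb⟩).resolve_left hbA
        have := hYb _ (hY0Y hb)
        simp at this ⊢; exact this.le
    have hBo : IsOpen B := by
      rw [hBeq]; exact (hY0o.preimage continuous_neg).inter hA.isClosed.isOpen_compl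
    have hBe : B = ∅ := by
      by_contra h
      have := IsClopen.eq_univ ⟨hB.isClosed, hBo⟩ (nonempty_iff_ne_empty.2 h)
      have h5 : (5:ℂ) ∈ B := this ▸ mem_univ _
      have := h5.1.1
      simp at this
    intro x hx
    rcases hcov x hx with h | h
    · exact h.2
    · rw [hBe] at h; exact h.elim
  rw [isPreconnected_iff_subset_of_fully_disjoint_closed hE'c.isClosed]
  intro u v hu hv huv hd
  have hsp := isPreconnected_sphere (E := ℂ) (by simp [Complex.rank_real_complex]) 0 1
  rcases (isPreconnected_iff_subset_of_fully_disjoint_closed isClosed_sphere).1 hsp u v hu hv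
    (hsph.trans huv) hd with h | h
  · left; exact main u v hu hv huv hd h
  · right; exact main v u hv hu (by rwa [union_comm]) hd.symm h
end Part2

section Part3
def mob (c z : ℂ) : ℂ := (z - c) / (1 - (starRingEnd ℂ) c * z)

lemma mob_den {c z : ℂ} (hc : ‖c‖ < 1) (hz : ‖z‖ ≤ 1) : 1 - (starRingEnd ℂ) c * z ≠ 0 := by
  intro h
  have h1 : (starRingEnd ℂ) c * z = 1 := (sub_eq_zero.1 h).symm
  have h2 : ‖c‖ * ‖z‖ = 1 := by
    have := congrArg norm h1
    simpa using this
  nlinarith [norm_nonneg c, norm_nonneg z]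

lemma mob_id (c z : ℂ) : ‖1 - (starRingEnd ℂ) c * z‖ ^ 2 - ‖z - c‖ ^ 2
    = (1 - ‖c‖ ^ 2) * (1 - ‖z‖ ^ 2) := by
  simp only [← Complex.normSq_eq_norm_sq, Complex.normSq_apply]
  simp
  ring

lemma mob_le {c z : ℂ} (hc : ‖c‖ < 1) (hz : ‖z‖ ≤ 1) : ‖mob c z‖ ≤ 1 := by
  have h := mob_id c z
  have hd := mob_den hc hz
  rw [mob, norm_div, div_le_one (norm_pos_iff.2 hd)]
  have : 0 ≤ (1 - ‖c‖ ^ 2) * (1 - ‖z‖ ^ 2) :=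
    mul_nonneg (by nlinarith [norm_nonneg c]) (by nlinarith [norm_nonneg z])
  exact abs_le_of_sq_le_sq' (by linarith) (norm_nonneg _) |>.2

lemma mob_lt {c z : ℂ} (hc : ‖c‖ < 1) (hz : ‖z‖ < 1) : ‖mob c z‖ < 1 := by
  have h := mob_id c z
  have hd := mob_den hc hz.le
  rw [mob, norm_div, div_lt_one (norm_pos_iff.2 hd)]
  have : 0 < (1 - ‖c‖ ^ 2) * (1 - ‖z‖ ^ 2) :=
    mul_pos (by nlinarith [norm_nonneg c]) (by nlinarith [norm_nonneg z])
  exact lt_of_pow_lt_pow_left₀ 2 (norm_nonneg _) (by linarith)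

lemma mob_inv {c z : ℂ} (hc : ‖c‖ < 1) (hz : ‖z‖ ≤ 1) : mob (-c) (mob c z) = z := by
  have hd := mob_den hc hz
  have h2 : 1 - (starRingEnd ℂ) c * c ≠ 0 := mob_den hc hc.le
  simp only [mob, map_neg]
  generalize (starRingEnd ℂ) c = d at *
  have h3 : 1 - -d * ((z - c) / (1 - d * z)) = (1 - d * c) / (1 - d * z) := by
    rw [eq_div_iff hd]
    have : (z - c) / (1 - d * z) * (1 - d * z) = z - c := div_mul_cancel₀ _ hd
    linear_combination d * this
  have h4 : (z - c) / (1 - d * z) - -c = z * (1 - d * c) / (1 - d * z) := by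
    rw [eq_div_iff hd]
    have : (z - c) / (1 - d * z) * (1 - d * z) = z - c := div_mul_cancel₀ _ hd
    linear_combination this
  rw [h3, h4, div_div_div_cancel_right₀ hd, mul_div_assoc, div_self h2, mul_one]

lemma mob_diff {c z : ℂ} (hc : ‖c‖ < 1) (hz : ‖z‖ ≤ 1) :
    HasDerivAt (mob c) ((1 - (starRingEnd ℂ) c * c) / (1 - (starRingEnd ℂ) c * z) ^ 2) z := by
  have hd := mob_den hc hz
  have h1 : HasDerivAt (fun z : ℂ => z - c) 1 z := (hasDerivAt_id z).sub_const c
  have h2 : HasDerivAt (fun z : ℂ => 1 - (starRingEnd ℂ) c * z) (-((starRingEnd ℂ) c * 1)) z :=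
    ((hasDerivAt_id z).const_mul _).const_sub 1
  refine (h1.div h2 hd).congr_deriv ?_
  field_simp
  ring

lemma mob_contOn {c : ℂ} (hc : ‖c‖ < 1) : ContinuousOn (mob c) (closedBall 0 1) := fun z hz =>
  (mob_diff hc (by simpa using hz)).continuousAt.continuousWithinAt

lemma mob_preconn {c : ℂ} (hc : ‖c‖ < 1) {V : Set ℂ} (hV : V ⊆ ball 0 1)
    (hE : IsPreconnected (closedBall (0:ℂ) 1 \ V)) :
    IsPreconnected (closedBall (0:ℂ) 1 \ mob c '' V) := by
  have : closedBall (0:ℂ) 1 \ mob c '' V = mob c '' (closedBall (0:ℂ) 1 \ V) := by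
    ext w
    constructor
    · rintro ⟨hw, hwV⟩
      have hw' : ‖w‖ ≤ 1 := by simpa using hw
      have hcn : ‖-c‖ < 1 := by simpa using hc
      have e : mob c (mob (-c) w) = w := by simpa using mob_inv hcn hw'
      exact ⟨mob (-c) w, ⟨by simpa using mob_le hcn hw', fun h => hwV ⟨_, h, e⟩⟩, e⟩
    · rintro ⟨z, ⟨hz, hzV⟩, rfl⟩
      have hz' : ‖z‖ ≤ 1 := by simpa using hz
      refine ⟨by simpa using mob_le hc hz', ?_⟩
      rintro ⟨z', hz'V, h⟩
      have h1 := mob_inv hc hz'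
      have h2 := mob_inv hc (by simpa using (ball_subset_closedBall (hV hz'V)))
      rw [h, h1] at h2
      exact hzV (h2 ▸ hz'V)
  rw [this]
  exact hE.image _ ((mob_contOn hc).mono sdiff_subset)

structure Good (Ω : Set ℂ) (x0 : ℂ) (f : ℂ → ℂ) : Prop where
  diff : DifferentiableOn ℂ f Ω
  dne : ∀ z ∈ Ω, deriv f z ≠ 0
  inj : InjOn f Ω
  maps : MapsTo f Ω (ball 0 1)
  zero : f x0 = 0
  conn : IsPreconnected (closedBall (0:ℂ) 1 \ f '' Ω)

lemma isOpen_image_of_injOn {Ω : Set ℂ} (hΩ : IsOpen Ω) (hc : IsPreconnected Ω) {f : ℂ → ℂ}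
    (hf : DifferentiableOn ℂ f Ω) (hi : InjOn f Ω) : ∀ W ⊆ Ω, IsOpen W → IsOpen (f '' W) := by
  rcases (hf.analyticOnNhd hΩ).is_constant_or_isOpen hc with ⟨w, hw⟩ | h
  · intro W hW hWo
    rcases W.eq_empty_or_nonempty with rfl | ⟨x, hx⟩
    · simp
    · exfalso
      have hs : Ω.Subsingleton := fun a ha b hb => hi ha hb (by rw [hw a ha, hw b hb])
      have h1 : W = {x} := (subsingleton_iff_singleton hx).1 (hs.anti hW)
      rw [h1] at hWo
      exact not_isOpen_singleton x hWo
  · exact h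

lemma improve {Ω : Set ℂ} (hΩ : IsOpen Ω) (hcn : IsConnected Ω) {x0 : ℂ} (hx0 : x0 ∈ Ω)
    {f : ℂ → ℂ} (hf : Good Ω x0 f) {c : ℂ} (hc : ‖c‖ < 1) (hcf : c ∉ f '' Ω) :
    ∃ F, Good Ω x0 F ∧ ‖deriv F x0‖ * (2 * √‖c‖) = ‖deriv f x0‖ * (1 + ‖c‖) := by
  have hfb : ∀ z ∈ Ω, ‖f z‖ < 1 := fun z hz => by simpa using hf.maps hz
  set f1 : ℂ → ℂ := fun z => mob c (f z) with hf1
  have hd1 : ∀ z ∈ Ω, HasDerivAt f1 ((1 - (starRingEnd ℂ) c * c) /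
      (1 - (starRingEnd ℂ) c * f z) ^ 2 * deriv f z) z := fun z hz =>
    (mob_diff hc (hfb z hz).le).comp z (hf.diff.differentiableAt (hΩ.mem_nhds hz)).hasDerivAt
  have hi1 : InjOn f1 Ω := by
    intro x hx y hy h
    have h1 := mob_inv hc (hfb x hx).le
    have h2 := mob_inv hc (hfb y hy).le
    simp only [f1] at h
    rw [h, h2] at h1
    exact hf.inj hx hy h1.symm
  have hdo1 : DifferentiableOn ℂ f1 Ω := fun z hz =>
    (hd1 z hz).differentiableAt.differentiableWithinAt
  have hV1 : f1 '' Ω ⊆ ball 0 1 := by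
    rintro _ ⟨z, hz, rfl⟩
    simpa using mob_lt hc (hfb z hz)
  have him : f1 '' Ω = mob c '' (f '' Ω) := by rw [image_image]
  have hV0 : (0:ℂ) ∉ f1 '' Ω := by
    rintro ⟨z, hz, h⟩
    simp only [f1, mob, div_eq_zero_iff, mob_den hc (hfb z hz).le, or_false, sub_eq_zero] at h
    exact hcf ⟨z, hz, h⟩
  have hVE : IsPreconnected (closedBall (0:ℂ) 1 \ f1 '' Ω) := by
    rw [him]; exact mob_preconn hc (image_subset_iff.2 hf.maps) hf.conn
  have hVo := isOpen_image_of_injOn hΩ hcn.isPreconnected hdo1 hi1 Ω subset_rfl hΩ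
  obtain ⟨s, hsc, hs2, hsE⟩ := exists_sqrt hVo (hcn.image _ hdo1.continuousOn) hV1 hV0 hVE
  have hsn : ∀ v ∈ f1 '' Ω, s v ≠ 0 := by
    intro v hv h
    have := hs2 v hv
    rw [h] at this
    simp at this
    exact hV0 (this ▸ hv)
  have hsd : ∀ v ∈ f1 '' Ω, HasDerivAt s (2 * s v)⁻¹ v := by
    intro v hv
    refine HasDerivAt.of_local_left_inverse (f := fun z => z ^ 2)
      (hsc.continuousAt (hVo.mem_nhds hv)) ?_ (by simpa using hsn v hv) ?_
    · simpa using hasDerivAt_pow 2 (s v)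
    · filter_upwards [hVo.mem_nhds hv] with w hw using hs2 w hw
  have hsb : ∀ v ∈ f1 '' Ω, ‖s v‖ < 1 := by
    intro v hv
    have h1 := hs2 v hv
    have h2 := hV1 hv
    rw [← h1, mem_ball_zero_iff, norm_pow] at h2
    nlinarith [norm_nonneg (s v)]
  set σ := s (f1 x0) with hσ
  have hσ1 : ‖σ‖ < 1 := hsb _ ⟨x0, hx0, rfl⟩
  have hσ2 : σ ^ 2 = -c := by
    rw [hσ, hs2 _ ⟨x0, hx0, rfl⟩]
    simp [f1, hf.zero, mob]
  have hσn : ‖σ‖ ^ 2 = ‖c‖ := by rw [← norm_pow, hσ2, norm_neg]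
  set F : ℂ → ℂ := fun z => mob σ (s (f1 z)) with hF
  have hdF : ∀ z ∈ Ω, HasDerivAt F ((1 - (starRingEnd ℂ) σ * σ) /
      (1 - (starRingEnd ℂ) σ * s (f1 z)) ^ 2 * ((2 * s (f1 z))⁻¹ *
      ((1 - (starRingEnd ℂ) c * c) / (1 - (starRingEnd ℂ) c * f z) ^ 2 * deriv f z))) z := by
    intro z hz
    have h1 := (hsd (f1 z) ⟨z, hz, rfl⟩).comp z (hd1 z hz)
    exact (mob_diff hσ1 (hsb (f1 z) ⟨z, hz, rfl⟩).le).comp z h1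
  refine ⟨F, ⟨fun z hz => (hdF z hz).differentiableAt.differentiableWithinAt, ?_, ?_, ?_, ?_, ?_⟩, ?_⟩
  · intro z hz
    rw [(hdF z hz).deriv]
    have h1 := mob_den hσ1 hσ1.le
    have h2 := mob_den hσ1 (hsb (f1 z) ⟨z, hz, rfl⟩).le
    have h3 := hsn (f1 z) ⟨z, hz, rfl⟩
    have h4 := mob_den hc hc.le
    have h5 := mob_den hc (hfb z hz).le
    have h6 := hf.dne z hz
    exact mul_ne_zero (div_ne_zero h1 (pow_ne_zero 2 h2)) (mul_ne_zero
      (inv_ne_zero (mul_ne_zero two_ne_zero h3))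
      (mul_ne_zero (div_ne_zero h4 (pow_ne_zero 2 h5)) h6))
  · intro x hx y hy h
    have h1 := mob_inv hσ1 (hsb (f1 x) ⟨x, hx, rfl⟩).le
    have h2 := mob_inv hσ1 (hsb (f1 y) ⟨y, hy, rfl⟩).le
    simp only [F] at h
    rw [h, h2] at h1
    refine hi1 hx hy ?_
    rw [← hs2 _ ⟨x, hx, rfl⟩, ← hs2 _ ⟨y, hy, rfl⟩, h1]
  · intro z hz
    simpa using mob_lt hσ1 (hsb (f1 z) ⟨z, hz, rfl⟩)
  · simp [F, mob, hσ]
  · have : F '' Ω = mob σ '' (s '' (f1 '' Ω)) := by simp only [image_image, F]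
    rw [this]
    refine mob_preconn hσ1 ?_ hsE
    rintro _ ⟨v, hv, rfl⟩
    simpa using hsb v hv
  · rw [(hdF x0 hx0).deriv]
    have e1 : ∀ w : ℂ, ‖1 - (starRingEnd ℂ) w * w‖ = |1 - ‖w‖ ^ 2| := by
      intro w
      rw [mul_comm, Complex.mul_conj, Complex.normSq_eq_norm_sq, ← Complex.ofReal_one,
        ← Complex.ofReal_sub, Complex.norm_real, Real.norm_eq_abs]
    have h0 : 0 < ‖σ‖ := norm_pos_iff.2 (hsn _ ⟨x0, hx0, rfl⟩)
    have e2 : √‖c‖ = ‖σ‖ := by rw [← hσn, Real.sqrt_sq h0.le]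
    rw [e2]
    simp only [norm_mul, norm_div, norm_inv, norm_pow, ← hσ, e1, hf.zero, mul_zero, sub_zero,
      norm_one, hσn]
    rw [abs_of_pos (by linarith), abs_of_pos (by nlinarith [norm_nonneg c])]
    have : 1 - ‖c‖ ≠ 0 := by linarith
    simp
    field_simp
    ring

lemma exists_seq {Ω : Set ℂ} (hΩ : IsOpen Ω) (hcn : IsConnected Ω) {x0 : ℂ} (hx0 : x0 ∈ Ω)
    (hΩ1 : Ω ⊆ ball 0 1) (hE : IsPreconnected (closedBall (0:ℂ) 1 \ Ω)) :
    ∃ f : ℕ → ℂ → ℂ, (∀ n, Good Ω x0 (f n)) ∧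
      ∀ r < 1, ∀ᶠ n in Filter.atTop, ball 0 r ⊆ f n '' Ω := by
  have hx1 : ‖x0‖ < 1 := by simpa using hΩ1 hx0
  have hΩb : ∀ z ∈ Ω, ‖z‖ < 1 := fun z hz => by simpa using hΩ1 hz
  have g0 : Good Ω x0 (mob x0) := by
    refine ⟨fun z hz => (mob_diff hx1 (hΩb z hz).le).differentiableAt.differentiableWithinAt,
      ?_, ?_, ?_, by simp [mob], mob_preconn hx1 hΩ1 hE⟩
    · intro z hz
      rw [(mob_diff hx1 (hΩb z hz).le).deriv]
      exact div_ne_zero (mob_den hx1 hx1.le) (pow_ne_zero 2 (mob_den hx1 (hΩb z hz).le))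
    · intro x hx y hy h
      have h1 := mob_inv hx1 (hΩb x hx).le
      have h2 := mob_inv hx1 (hΩb y hy).le
      rw [h, h2] at h1
      exact h1.symm
    · intro z hz
      simpa using mob_lt hx1 (hΩb z hz)
  set S : Set ℝ := {t | ∃ f, Good Ω x0 f ∧ t = ‖deriv f x0‖} with hS
  have hSn : S.Nonempty := ⟨_, _, g0, rfl⟩
  have hSb : BddAbove S := by
    obtain ⟨ρ, hρ, hb⟩ := Metric.isOpen_iff.1 hΩ x0 hx0
    refine ⟨1 / ρ, ?_⟩
    rintro _ ⟨f, hf, rfl⟩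
    refine Complex.norm_deriv_le_div_of_mapsTo_ball (hf.diff.mono hb) ?_ hρ
    intro z hz
    have := hf.maps (hb hz)
    rw [hf.zero]
    first | exact this | exact ball_subset_closedBall this
  have hpos : 0 < sSup S := by
    refine lt_of_lt_of_le ?_ (le_csSup hSb ⟨_, g0, rfl⟩)
    rw [(mob_diff hx1 hx1.le).deriv]
    have := mob_den hx1 hx1.le
    exact norm_pos_iff.2 (div_ne_zero this (pow_ne_zero 2 this))
  obtain ⟨u, -, hu, huS⟩ := exists_seq_tendsto_sSup hSn hSb
  choose f hf hfu using huS
  refine ⟨f, hf, fun r hr => ?_⟩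
  set r' := max r (1/2) with hr'
  have hr1 : r' < 1 := max_lt hr (by norm_num)
  have hr0 : 0 < r' := lt_of_lt_of_le (by norm_num) (le_max_right _ _)
  have hsq : √r' < 1 := by rw [Real.sqrt_lt' one_pos]; simpa using hr1
  have hsq0 : 0 < √r' := Real.sqrt_pos.2 hr0
  have hsqq : √r' ^ 2 = r' := Real.sq_sqrt hr0.le
  have hlt : sSup S * (2 * √r') / (1 + r') < sSup S := by
    rw [div_lt_iff₀ (by linarith)]
    nlinarith [mul_pos hpos (mul_pos (sub_pos.2 hsq) (sub_pos.2 hsq))]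
  filter_upwards [hu.eventually (lt_mem_nhds hlt)] with n hn
  intro c hc
  by_contra hcf
  have hcr : ‖c‖ < r' := lt_of_lt_of_le (by simpa using hc) (le_max_left _ _)
  obtain ⟨F, hF, hFe⟩ := improve hΩ hcn hx0 (hf n) (hcr.trans hr1) hcf
  have hle : ‖deriv F x0‖ ≤ sSup S := le_csSup hSb ⟨F, hF, rfl⟩
  rw [← hfu] at hFe
  have hc0 : 0 < ‖c‖ := norm_pos_iff.2 (by
    rintro rfl; exact hcf ⟨x0, hx0, (hf n).zero⟩)
  set t := √‖c‖ with ht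
  have ht0 : 0 < t := Real.sqrt_pos.2 hc0
  have htr : t ≤ √r' := Real.sqrt_le_sqrt hcr.le
  have ht2 : t ^ 2 = ‖c‖ := Real.sq_sqrt hc0.le
  rw [← ht2] at hFe
  rw [div_lt_iff₀ (by linarith)] at hn
  set q := √r'
  rw [← hsqq] at hn
  have hk : u n * (1 + t ^ 2) ≤ sSup S * (2 * t) := by nlinarith
  have h1 : u n * (1 + t ^ 2) * q ≤ sSup S * (2 * t) * q :=
    mul_le_mul_of_nonneg_right hk hsq0.le
  have h2 : sSup S * (2 * q) * t < u n * (1 + q ^ 2) * t := mul_lt_mul_of_pos_right hn ht0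
  have hun : 0 ≤ u n := by rw [hfu]; exact norm_nonneg _
  have h3 : 0 ≤ (q - t) * (1 - q * t) := mul_nonneg (by linarith) (by nlinarith)
  nlinarith [mul_nonneg hun h3]
end Part3

section Part4
lemma montel (L : Ultrafilter ℕ) {Ω : Set ℂ} {F : ℕ → ℂ → ℂ}
    (H : ∀ x ∈ Ω, ∃ ρ > 0, ball x ρ ⊆ Ω ∧ ∀ᶠ n in (L : Filter ℕ),
      DifferentiableOn ℂ (F n) (ball x ρ) ∧ ∀ z ∈ ball x ρ, ‖F n z‖ ≤ 1) :
    ∃ f : ℂ → ℂ, TendstoLocallyUniformlyOn F f L Ω ∧ DifferentiableOn ℂ f Ω ∧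
      ∀ z ∈ Ω, ‖f z‖ ≤ 1 := by
  have h1 : ∀ z ∈ Ω, ∃ w : ℂ, Filter.Tendsto (fun n => F n z) L (𝓝 w) ∧ ‖w‖ ≤ 1 := by
    intro z hz
    obtain ⟨ρ, hρ, -, h⟩ := H z hz
    have : ((L.map (fun n => F n z) : Ultrafilter ℂ) : Filter ℂ) ≤
        Filter.principal (closedBall 0 1) := by
      rw [Filter.le_principal_iff, Ultrafilter.mem_coe, Ultrafilter.mem_map]
      filter_upwards [h] with n hn
      simpa using hn.2 z (mem_ball_self hρ)
    obtain ⟨w, hw, hw'⟩ := (isCompact_closedBall (0:ℂ) 1).ultrafilter_le_nhds _ this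
    exact ⟨w, hw', by simpa using hw⟩
  choose! f hf hf1 using h1
  have hlu : TendstoLocallyUniformlyOn F f L Ω := by
    rw [Metric.tendstoLocallyUniformlyOn_iff]
    intro ε hε x hx
    obtain ⟨ρ, hρ, hb, h⟩ := H x hx
    have hL : ∀ᶠ n in (L : Filter ℕ), ∀ y ∈ ball x ρ, dist (F n y) (F n x) ≤ 2 / ρ * dist y x := by
      filter_upwards [h] with n hn y hy
      refine Complex.dist_le_div_mul_dist_of_mapsTo_ball hn.1 (fun z hz => ?_) hy
      have a := hn.2 z hz
      have b := hn.2 x (mem_ball_self hρ)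
      rw [mem_closedBall, dist_eq_norm]
      linarith [norm_sub_le (F n z) (F n x)]
    have hLf : ∀ y ∈ ball x ρ, dist (f y) (f x) ≤ 2 / ρ * dist y x := by
      intro y hy
      refine le_of_tendsto ((hf y (hb hy)).dist (hf x hx)) ?_
      filter_upwards [hL] with n hn using hn y hy
    set δ := min ρ (ρ * ε / 8) with hδ
    have hδ0 : 0 < δ := lt_min hρ (by positivity)
    refine ⟨ball x δ, mem_nhdsWithin_of_mem_nhds (ball_mem_nhds _ hδ0), ?_⟩
    filter_upwards [hL, (Metric.tendsto_nhds.1 (hf x hx)) (ε/4) (by positivity)] with n hn hn2 y hy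
    have hy1 : y ∈ ball x ρ := ball_subset_ball (min_le_left _ _) hy
    have hy2 : dist y x < ρ * ε / 8 := lt_of_lt_of_le hy (min_le_right _ _)
    have e : 2 / ρ * dist y x ≤ ε / 4 := by
      calc 2 / ρ * dist y x ≤ 2 / ρ * (ρ * ε / 8) := by gcongr
        _ = ε / 4 := by field_simp; norm_num
    have a := hLf y hy1
    have b := hn y hy1
    have t1 := dist_triangle (f y) (f x) (F n y)
    have t2 := dist_triangle (f x) (F n x) (F n y)
    rw [dist_comm] at b hn2
    linarith
  refine ⟨f, hlu, ?_, hf1⟩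
  intro x hx
  obtain ⟨ρ, hρ, hb, h⟩ := H x hx
  have := (hlu.mono hb).differentiableOn (h.mono fun n hn => hn.1) isOpen_ball
  exact (this.differentiableAt (ball_mem_nhds _ hρ)).differentiableWithinAt

theorem riemann {Ω : Set ℂ} (hΩ : IsOpen Ω) (hcn : IsConnected Ω)
    (hΩ1 : Ω ⊆ ball 0 1) (hE : IsPreconnected (closedBall (0:ℂ) 1 \ Ω)) :
    ∃ f g : ℂ → ℂ, DifferentiableOn ℂ f Ω ∧ DifferentiableOn ℂ g (ball 0 1) ∧
      MapsTo f Ω (ball 0 1) ∧ MapsTo g (ball 0 1) Ω ∧ (∀ z ∈ Ω, g (f z) = z) ∧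
      ∀ w ∈ ball (0:ℂ) 1, f (g w) = w := by
  obtain ⟨x0, hx0⟩ := hcn.nonempty
  obtain ⟨F, hF, hFr⟩ := exists_seq hΩ hcn hx0 hΩ1 hE
  set L : Ultrafilter ℕ := Filter.hyperfilter ℕ with hL
  have hLt : (L : Filter ℕ) ≤ Filter.atTop := by
    rw [← Nat.cofinite_eq_atTop]; exact Filter.hyperfilter_le_cofinite
  have hΩb : ∀ z ∈ Ω, ‖z‖ < 1 := fun z hz => by simpa using hΩ1 hz
  set G : ℕ → ℂ → ℂ := fun n => Function.invFunOn (F n) Ω with hG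
  have hGl : ∀ n, ∀ z ∈ Ω, G n (F n z) = z := fun n z hz =>
    (hF n).inj.leftInvOn_invFunOn hz
  have hGr : ∀ n, ∀ w ∈ F n '' Ω, G n w ∈ Ω ∧ F n (G n w) = w := fun n w hw =>
    ⟨Function.invFunOn_mem hw, Function.invFunOn_eq hw⟩
  have hGd : ∀ n, DifferentiableOn ℂ (G n) (F n '' Ω) := by
    rintro n _ ⟨z, hz, rfl⟩
    have ho := isOpen_image_of_injOn hΩ hcn.isPreconnected (hF n).diff (hF n).inj
    have hoΩ := ho Ω subset_rfl hΩ
    have hza := hGl n z hz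
    have hcont : ContinuousAt (G n) (F n z) := by
      rw [ContinuousAt, hza, Filter.tendsto_def]
      intro s hs
      have h1 : interior s ∩ Ω ∈ 𝓝 z :=
        Filter.inter_mem (interior_mem_nhds.2 hs) (hΩ.mem_nhds hz)
      refine Filter.mem_of_superset ((ho _ inter_subset_right
        (isOpen_interior.inter hΩ)).mem_nhds ⟨z, mem_of_mem_nhds h1, rfl⟩) ?_
      rintro _ ⟨y, hy, rfl⟩
      rw [mem_preimage, hGl n y hy.2]
      exact interior_subset hy.1
    have hd : HasDerivAt (F n) (deriv (F n) z) (G n (F n z)) := by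
      rw [hza]; exact ((hF n).diff.differentiableAt (hΩ.mem_nhds hz)).hasDerivAt
    have := HasDerivAt.of_local_left_inverse hcont hd ((hF n).dne z hz) (by
      filter_upwards [hoΩ.mem_nhds ⟨z, hz, rfl⟩] with w hw using (hGr n w hw).2)
    exact this.differentiableAt.differentiableWithinAt
  obtain ⟨f, hfu, hfd, hf1⟩ := montel L (Ω := Ω) (F := F) (by
    intro x hx
    obtain ⟨ρ, hρ, hb⟩ := Metric.isOpen_iff.1 hΩ x hx
    refine ⟨ρ, hρ, hb, Filter.Eventually.of_forall fun n => ⟨(hF n).diff.mono hb, fun z hz => ?_⟩⟩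
    have := (hF n).maps (hb hz)
    simp at this; exact this.le)
  have hev : ∀ r < 1, ∀ᶠ n in (L : Filter ℕ), ball 0 r ⊆ F n '' Ω := fun r hr => hLt (hFr r hr)
  obtain ⟨g, hgu, hgd, hg1⟩ := montel L (Ω := ball 0 1) (F := G) (by
    intro x hx
    obtain ⟨ρ, hρ, hb⟩ : ∃ ρ > 0, ∃ r < 1, ball x ρ ⊆ ball 0 r := by
      rw [mem_ball_zero_iff] at hx
      refine ⟨(1 - ‖x‖) / 2, by linarith, (1 + ‖x‖) / 2, by linarith, ?_⟩
      apply ball_subset_ball'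
      simp; linarith
    obtain ⟨r, hr, hb⟩ := hb
    refine ⟨ρ, hρ, hb.trans (ball_subset_ball hr.le), ?_⟩
    filter_upwards [hev r hr] with n hn
    exact ⟨(hGd n).mono (hb.trans hn), fun z hz => (hΩb _ (hGr n z (hn (hb hz))).1).le⟩)
  have hfx0 : f x0 = 0 := by
    refine tendsto_nhds_unique (hfu.tendsto_at hx0) ?_
    simp only [(hF _).zero]
    exact tendsto_const_nhds
  have hfm : MapsTo f Ω (ball 0 1) := by
    intro z hz
    rw [mem_ball_zero_iff]
    refine lt_of_le_of_ne (hf1 z hz) fun h => ?_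
    have := Complex.eqOn_of_isPreconnected_of_isMaxOn_norm hcn.isPreconnected hΩ hfd hz
      (fun y hy => by simpa [h] using hf1 y hy) hx0
    rw [hfx0] at this
    simp only [Function.const] at this
    rw [← this] at h
    simp at h
  have hgf : ∀ z ∈ Ω, g (f z) = z := by
    intro z hz
    have hc : ContinuousAt g (f z) :=
      (hgd.differentiableAt (isOpen_ball.mem_nhds (hfm hz))).continuousAt
    have h1 := tendsto_comp_of_locally_uniform_limit_within (s := ball 0 1) (F := G)
      hc.continuousWithinAt (g := fun n => F n z) (p := (L : Filter ℕ)) (by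
        refine tendsto_nhdsWithin_iff.2 ⟨hfu.tendsto_at hz, Filter.Eventually.of_forall fun n =>
          (hF n).maps hz⟩) (fun u hu => hgu u hu _ (hfm hz))
    simp only [hGl _ z hz] at h1
    exact tendsto_nhds_unique h1 tendsto_const_nhds
  have hgnc : ∀ w, ¬ EqOn g (fun _ => w) (ball 0 1) := by
    intro w h
    have hsub : Ω ⊆ {w} := fun z hz => by
      have := h (hfm hz)
      rw [hgf z hz] at this
      exact this
    have h1 : Ω = {w} := (hcn.nonempty.subset_singleton_iff).1 hsub
    rw [h1] at hΩ
    exact not_isOpen_singleton w hΩ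
  have hgm : MapsTo g (ball 0 1) Ω := by
    intro z0 hz0
    by_contra hw
    set w := g z0 with hw0
    have hga : AnalyticOnNhd ℂ g (ball 0 1) := hgd.analyticOnNhd isOpen_ball
    have h1 : ∀ᶠ z in 𝓝[≠] z0, g z ≠ w := by
      refine ((hga z0 hz0).eventually_eq_or_eventually_ne analyticAt_const).resolve_left fun h => ?_
      exact hgnc w (hga.eqOn_of_preconnected_of_eventuallyEq
        (fun _ _ => analyticAt_const) (convex_ball _ _).isPreconnected hz0 h)
    rw [eventually_nhdsWithin_iff, Metric.eventually_nhds_iff] at h1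
    obtain ⟨ε, hε, hne⟩ := h1
    rw [mem_ball_zero_iff] at hz0
    set ρ := min (ε / 2) ((1 - ‖z0‖) / 2) with hρ
    have hρ0 : 0 < ρ := lt_min (by linarith) (by linarith)
    have hρ1 : ρ < ε := lt_of_le_of_lt (min_le_left _ _) (by linarith)
    have hρ2 : ρ ≤ (1 - ‖z0‖) / 2 := min_le_right _ _
    set r := (2 + ‖z0‖) / 3 with hr
    have hr1 : r < 1 := by rw [hr]; linarith
    have hcb : closedBall z0 ρ ⊆ ball 0 r := by
      apply closedBall_subset_ball'
      simp; rw [hr]; linarith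
    have hcb1 : closedBall z0 ρ ⊆ ball 0 1 := hcb.trans (ball_subset_ball hr1.le)
    obtain ⟨δ, hδ, hδm⟩ : ∃ δ > 0, ∀ z ∈ sphere z0 ρ, 2 * δ ≤ ‖g z - w‖ := by
      obtain ⟨m, hm, hmin⟩ := (isCompact_sphere z0 ρ).exists_isMinOn
        (NormedSpace.sphere_nonempty.2 hρ0.le) (f := fun z => ‖g z - w‖)
        ((((hgd.continuousOn).mono (sphere_subset_closedBall.trans hcb1)).sub
          continuousOn_const).norm)
      refine ⟨‖g m - w‖ / 2, ?_, fun z hz => ?_⟩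
      · have : g m ≠ w := by
          rw [mem_sphere] at hm
          refine hne (by rw [hm]; exact hρ1) ?_
          rintro rfl
          simp at hm; linarith
        have := norm_pos_iff.2 (sub_ne_zero.2 this)
        linarith
      · have := hmin hz
        simp only [mem_setOf_eq] at this
        linarith
    have hun : TendstoUniformlyOn G g L (sphere z0 ρ) :=
      (tendstoLocallyUniformlyOn_iff_tendstoUniformlyOn_of_compact (isCompact_sphere z0 ρ)).1
        (hgu.mono (sphere_subset_closedBall.trans hcb1))
    have hfin : ∀ᶠ n in (L : Filter ℕ), δ ≤ ‖G n z0 - w‖ := by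
      filter_upwards [hev r hr1, Metric.tendstoUniformlyOn_iff.1 hun δ hδ] with n hn hn2
      have hne' : ∀ z ∈ closedBall z0 ρ, G n z - w ≠ 0 := fun z hz h => by
        have := (hGr n z (hn (hcb hz))).1
        rw [sub_eq_zero.1 h] at this
        exact hw this
      have hd : DifferentiableOn ℂ (fun z => (G n z - w)⁻¹) (closedBall z0 ρ) :=
        ((((hGd n).mono (hcb.trans hn))).sub_const w).inv hne'
      have hdc : DiffContOnCl ℂ (fun z => (G n z - w)⁻¹) (ball z0 ρ) :=
        DifferentiableOn.diffContOnCl (by rwa [closure_ball _ hρ0.ne'])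
      have hz : ‖(G n z0 - w)⁻¹‖ ≤ δ⁻¹ := by
        refine Complex.norm_le_of_forall_mem_frontier_norm_le isBounded_ball hdc (fun z hz => ?_)
          (subset_closure (mem_ball_self hρ0))
        rw [frontier_ball _ hρ0.ne'] at hz
        have a := hδm z hz
        have b := hn2 z hz
        rw [dist_eq_norm] at b
        rw [norm_inv]
        apply inv_anti₀ hδ
        have := norm_sub_norm_le (g z - w) (g z - G n z)
        rw [sub_sub_sub_cancel_left] at this
        linarith
      rw [norm_inv] at hz
      exact (inv_le_inv₀ (norm_pos_iff.2 (hne' z0 (mem_closedBall_self hρ0.le))) hδ).1 hz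
    have ht : Filter.Tendsto (fun n => ‖G n z0 - w‖) L (𝓝 ‖g z0 - w‖) :=
      ((hgu.tendsto_at (by simpa using hz0)).sub_const w).norm
    have := ge_of_tendsto ht hfin
    simp [hw0] at this
    linarith
  refine ⟨f, g, hfd, hgd, hfm, hgm, hgf, ?_⟩
  intro w hw
  have hc : ContinuousAt f (g w) :=
    (hfd.differentiableAt (hΩ.mem_nhds (hgm hw))).continuousAt
  obtain ⟨r, hwr, hr⟩ := exists_between (mem_ball_zero_iff.1 hw)
  have h1 := tendsto_comp_of_locally_uniform_limit_within (s := Ω) (F := F)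
      hc.continuousWithinAt (g := fun n => G n w) (p := (L : Filter ℕ)) (by
        refine tendsto_nhdsWithin_iff.2 ⟨hgu.tendsto_at hw, ?_⟩
        filter_upwards [hev r hr] with n hn using (hGr n w (hn (by simpa using hwr))).1)
      (fun u hu => hfu u hu _ (hgm hw))
  refine tendsto_nhds_unique (h1.congr' ?_) tendsto_const_nhds
  filter_upwards [hev r hr] with n hn using (hGr n w (hn (by simpa using hwr))).2
end Part4

section Part5
open MeasureTheory

lemma area_lt_top {ψ : ℂ → ℂ} {B : Set ℂ} (hB : IsOpen B) (hd : DifferentiableOn ℂ ψ B)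
    (hi : InjOn ψ B) (hm : MapsTo ψ B (ball 0 1)) :
    ∫⁻ z in B, ENNReal.ofReal (‖deriv ψ z‖ ^ 2) < ⊤ := by
  have h1 := lintegral_image_eq_lintegral_abs_det_fderiv_mul (volume : Measure ℂ)
    hB.measurableSet (f := ψ)
    (f' := fun z => ((ContinuousLinearMap.toSpanSingleton ℂ (deriv ψ z)).restrictScalars ℝ))
    (fun z hz => by
      have := (hd.differentiableAt (hB.mem_nhds hz)).hasDerivAt.hasFDerivAt
      exact (this.restrictScalars ℝ).hasFDerivWithinAt) hi (fun _ => 1)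
  have h2 : ∀ z, |((ContinuousLinearMap.toSpanSingleton ℂ (deriv ψ z)).restrictScalars ℝ).det|
      = ‖deriv ψ z‖ ^ 2 := by
    intro z
    simp [ContinuousLinearMap.det, LinearMap.det_restrictScalars, Algebra.norm_complex_apply,
      Complex.normSq_eq_norm_sq]
  simp only [h2, mul_one, setLIntegral_one] at h1
  rw [← h1]
  exact lt_of_le_of_lt (measure_mono hm.image_subset) measure_ball_lt_top

lemma arc_lower {ψ : ℂ → ℂ} {B : Set ℂ} (hB : IsOpen B) (hd : DifferentiableOn ℂ ψ B)
    {r α β η : ℝ} (hη : 0 < η) (hαβ : α ≤ β) (hπ : β - α ≤ Real.pi)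
    (hin : ∀ θ ∈ Icc α β, (r : ℂ) * Complex.exp (θ * Complex.I) ∈ B)
    (hge : η ≤ ‖ψ (r * Complex.exp (β * Complex.I)) - ψ (r * Complex.exp (α * Complex.I))‖) :
    η ^ 2 / Real.pi ≤ ∫ θ in α..β, r ^ 2 * ‖deriv ψ (r * Complex.exp (θ * Complex.I))‖ ^ 2 := by
  set c : ℝ → ℂ := fun θ => (r : ℂ) * Complex.exp (θ * Complex.I) with hc
  have hcc : Continuous c := by fun_prop
  have hdc : ContinuousOn (deriv ψ) B := (hd.deriv hB).continuousOn
  have hdcc : ContinuousOn (fun θ => deriv ψ (c θ)) (Icc α β) := hdc.comp hcc.continuousOn hin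
  have hderc : ∀ θ : ℝ, HasDerivAt c (c θ * Complex.I) θ := by
    intro θ
    have h1 : HasDerivAt (fun θ : ℝ => (θ : ℂ) * Complex.I) (1 * Complex.I) θ :=
      (Complex.ofRealCLM.hasDerivAt).mul_const _
    have h2 := (h1.cexp).const_mul (r : ℂ)
    refine h2.congr_deriv ?_
    simp [c]; ring
  have hder : ∀ θ ∈ Icc α β, HasDerivAt (fun θ => ψ (c θ)) (deriv ψ (c θ) * (c θ * Complex.I)) θ := by
    intro θ hθ
    exact (hd.differentiableAt (hB.mem_nhds (hin θ hθ))).hasDerivAt.comp θ (hderc θ)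
  have hcn : ∀ θ, ‖c θ‖ = |r| := by
    intro θ
    simp [c, Complex.norm_exp]
  have hF : ContinuousOn (fun θ => deriv ψ (c θ) * (c θ * Complex.I)) (Icc α β) := by fun_prop
  have hN : ContinuousOn (fun θ => ‖deriv ψ (c θ)‖) (Icc α β) := hdcc.norm
  have huI : uIcc α β = Icc α β := uIcc_of_le hαβ
  have e1 : ∫ θ in α..β, deriv ψ (c θ) * (c θ * Complex.I) = ψ (c β) - ψ (c α) := by
    refine intervalIntegral.integral_eq_sub_of_hasDerivAt (f := fun θ => ψ (c θ)) (fun θ hθ => ?_) ?_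
    · rw [huI] at hθ; exact hder θ hθ
    · refine ContinuousOn.intervalIntegrable ?_
      rwa [huI]
  have hI2 : IntervalIntegrable (fun θ => r ^ 2 * ‖deriv ψ (c θ)‖ ^ 2) volume α β := by
    refine ContinuousOn.intervalIntegrable ?_
    rw [huI]; fun_prop
  set l := η / Real.pi with hl
  have hpi := Real.pi_pos
  have hl0 : 0 < l := by positivity
  have e2 : η ≤ ∫ θ in α..β, (l / 2 + (r ^ 2 * ‖deriv ψ (c θ)‖ ^ 2) / (2 * l)) := by
    refine hge.trans ?_
    rw [show ψ (r * Complex.exp (β * Complex.I)) - ψ (r * Complex.exp (α * Complex.I)) =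
      ψ (c β) - ψ (c α) from rfl, ← e1]
    refine intervalIntegral.norm_integral_le_of_norm_le hαβ ?_ ?_
    · refine Filter.Eventually.of_forall fun θ _ => ?_
      rw [norm_mul, norm_mul, hcn, Complex.norm_I, mul_one]
      set N := ‖deriv ψ (c θ)‖
      have : 0 ≤ (l - N * |r|) ^ 2 / (2 * l) := by positivity
      have h3 : l / 2 + r ^ 2 * N ^ 2 / (2 * l) - N * |r| = (l - N * |r|) ^ 2 / (2 * l) := by
        have := sq_abs r
        field_simp
        rw [← this]; ring
      linarith
    · exact intervalIntegrable_const.add (hI2.div_const _)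
  rw [intervalIntegral.integral_add intervalIntegrable_const (hI2.div_const _),
    intervalIntegral.integral_const, intervalIntegral.integral_div] at e2
  set J := ∫ θ in α..β, r ^ 2 * ‖deriv ψ (c θ)‖ ^ 2 with hJ
  have e3 : (β - α) • (l / 2) ≤ η / 2 := by
    rw [smul_eq_mul]
    calc (β - α) * (l / 2) ≤ Real.pi * (l / 2) := by gcongr
      _ = η / 2 := by rw [hl]; field_simp
  have e4 : η / 2 ≤ J / (2 * l) := by linarith
  rw [le_div_iff₀ (by positivity)] at e4
  calc η ^ 2 / Real.pi = η / 2 * (2 * l) := by rw [hl]; field_simp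
    _ ≤ J := e4

lemma length_area_aux {ψ : ℂ → ℂ} (hd : DifferentiableOn ℂ ψ (ball 1 1))
    (hi : InjOn ψ (ball 1 1)) (hm : MapsTo ψ (ball 1 1) (ball 0 1)) {η δ : ℝ} (hη : 0 < η)
    (hδ : 0 < δ) :
    ∃ r, 0 < r ∧ r < δ ∧ ∀ z ∈ ball (1:ℂ) 1 ∩ sphere 0 r, ∀ z' ∈ ball (1:ℂ) 1 ∩ sphere 0 r,
      dist (ψ z) (ψ z') ≤ η := by
  by_contra hcon
  push Not at hcon
  have hpi := Real.pi_pos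
  have hin : ∀ r : ℝ, 0 < r → ∀ θ : ℝ, (r : ℂ) * Complex.exp (θ * Complex.I) ∈ ball (1:ℂ) 1 ↔
      r / 2 < Real.cos θ := by
    intro r hr θ
    rw [mem_ball, dist_eq_norm, ← sq_lt_one_iff₀ (norm_nonneg _), ← Complex.normSq_eq_norm_sq,
      Complex.exp_mul_I, Complex.normSq_apply, ← Complex.ofReal_cos, ← Complex.ofReal_sin]
    simp only [Complex.sub_re, Complex.mul_re, Complex.ofReal_re, Complex.add_re, Complex.I_re,
      mul_zero, Complex.ofReal_im, Complex.I_im, mul_one, sub_self, add_zero, Complex.add_im,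
      Complex.mul_im, zero_mul, zero_add, sub_zero, Complex.one_re, Complex.sub_im, Complex.one_im]
    have hsc : (r * Real.cos θ - 1) * (r * Real.cos θ - 1) + (r * Real.sin θ) * (r * Real.sin θ) =
        r * (r - 2 * Real.cos θ) + 1 := by
      linear_combination r ^ 2 * Real.sin_sq_add_cos_sq θ
    rw [hsc]
    constructor
    · intro h
      have : r * (r - 2 * Real.cos θ) < 0 := by nlinarith
      have := neg_of_mul_neg_right this hr.le
      linarith
    · intro h
      have : r * (r - 2 * Real.cos θ) < 0 := mul_neg_of_pos_of_neg hr (by linarith)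
      nlinarith
  set f : ℂ → ENNReal := (ball (1:ℂ) 1).indicator (fun z => ENNReal.ofReal (‖deriv ψ z‖ ^ 2))
    with hf
  have hfm : Measurable f := by
    refine Measurable.indicator ?_ measurableSet_ball
    exact ((measurable_deriv ψ).norm.pow_const 2).ennreal_ofReal
  have harea : ∫⁻ z, f z < ⊤ := by
    rw [hf, lintegral_indicator measurableSet_ball]
    exact area_lt_top isOpen_ball hd hi hm
  rw [← Complex.lintegral_comp_polarCoord_symm] at harea
  have hsymm : ∀ p : ℝ × ℝ, Complex.polarCoord.symm p =
      (p.1 : ℂ) * Complex.exp (p.2 * Complex.I) := by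
    intro p
    rw [Complex.polarCoord_symm_apply, Complex.exp_mul_I, Complex.ofReal_cos, Complex.ofReal_sin]
  simp only [hsymm, polarCoord_target] at harea
  have hmeas : Measurable (fun p : ℝ × ℝ => ENNReal.ofReal p.1 •
      f ((p.1 : ℂ) * Complex.exp (p.2 * Complex.I))) := by
    have h1 : Measurable (fun p : ℝ × ℝ => ENNReal.ofReal p.1) := by fun_prop
    have h2 : Measurable (fun p : ℝ × ℝ => (p.1 : ℂ) * Complex.exp (p.2 * Complex.I)) := by fun_prop
    exact h1.smul (hfm.comp h2)
  rw [Measure.volume_eq_prod, setLIntegral_prod _ hmeas.aemeasurable] at harea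
  have key : ∀ r ∈ Ioo 0 δ, ENNReal.ofReal (η ^ 2 / Real.pi * r⁻¹) ≤
      ∫⁻ θ in Ioo (-Real.pi) Real.pi, ENNReal.ofReal r • f ((r : ℂ) * Complex.exp (θ * Complex.I)) := by
    rintro r ⟨hr, hrδ⟩
    have arcs : ∃ α β : ℝ, α ≤ β ∧ -(Real.pi/2) < α ∧ β < Real.pi/2 ∧ r / 2 < Real.cos α ∧
        r / 2 < Real.cos β ∧
        η ≤ ‖ψ (r * Complex.exp (β * Complex.I)) - ψ (r * Complex.exp (α * Complex.I))‖ := by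
      obtain ⟨z, ⟨hz, hzr⟩, z', ⟨hz', hzr'⟩, hzz⟩ := hcon r hr hrδ
      have e : ∀ w ∈ sphere (0:ℂ) r, w = r * Complex.exp (w.arg * Complex.I) := by
        intro w hw
        rw [mem_sphere_zero_iff_norm] at hw
        have := Complex.norm_mul_exp_arg_mul_I w
        rw [hw] at this; exact this.symm
      have c1 : r / 2 < Real.cos z.arg := (hin r hr _).1 (e z hzr ▸ hz)
      have c2 : r / 2 < Real.cos z'.arg := (hin r hr _).1 (e z' hzr' ▸ hz')
      have b : ∀ w : ℂ, r / 2 < Real.cos w.arg → |w.arg| < Real.pi / 2 := by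
        intro w hw
        by_contra h
        push Not at h
        have := Real.cos_nonpos_of_pi_div_two_le_of_le h
          (by linarith [Complex.abs_arg_le_pi w])
        rw [Real.cos_abs] at this
        linarith
      have b1 := abs_lt.1 (b z c1)
      have b2 := abs_lt.1 (b z' c2)
      rw [e z hzr, e z' hzr', dist_eq_norm] at hzz
      rcases le_total z.arg z'.arg with h | h
      · exact ⟨_, _, h, b1.1, b2.2, c1, c2, by rw [norm_sub_rev]; exact hzz.le⟩
      · exact ⟨_, _, h, b2.1, b1.2, c2, c1, hzz.le⟩
    obtain ⟨α, β, hαβ, hα, hβ, c1, c2, hge⟩ := arcs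
    have hall : ∀ θ ∈ Icc α β, r / 2 < Real.cos θ := by
      intro θ hθ
      have := strictConcaveOn_cos_Icc.concaveOn.min_le_of_mem_Icc
        (x := α) (y := β) (z := θ) ⟨by linarith, by linarith⟩ ⟨by linarith, by linarith⟩ hθ
      exact lt_of_lt_of_le (lt_min c1 c2) this
    have hinB : ∀ θ ∈ Icc α β, (r : ℂ) * Complex.exp (θ * Complex.I) ∈ ball (1:ℂ) 1 :=
      fun θ hθ => (hin r hr θ).2 (hall θ hθ)
    have low := arc_lower isOpen_ball hd hη hαβ (by linarith) hinB hge
    have hcont : ContinuousOn (fun θ : ℝ => deriv ψ (r * Complex.exp (θ * Complex.I)))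
        (Icc α β) :=
      ((hd.deriv isOpen_ball).continuousOn).comp (by fun_prop) hinB
    have hsub : Ioc α β ⊆ Ioo (-Real.pi) Real.pi := fun θ hθ =>
      ⟨by linarith [hθ.1], by linarith [hθ.2]⟩
    refine le_trans ?_ (lintegral_mono_set hsub)
    have e5 : ∫⁻ θ in Ioc α β, ENNReal.ofReal r • f ((r : ℂ) * Complex.exp (θ * Complex.I)) =
        ENNReal.ofReal (∫ θ in α..β, r * ‖deriv ψ (r * Complex.exp (θ * Complex.I))‖ ^ 2) := by
      rw [intervalIntegral.integral_of_le hαβ, ofReal_integral_eq_lintegral_ofReal]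
      · refine setLIntegral_congr_fun measurableSet_Ioc fun θ hθ => ?_
        have := hinB θ (Ioc_subset_Icc_self hθ)
        simp only [hf, indicator_of_mem this, smul_eq_mul]
        rw [ENNReal.ofReal_mul hr.le]
      · have : ContinuousOn (fun θ : ℝ => r * ‖deriv ψ (r * Complex.exp (θ * Complex.I))‖ ^ 2)
          (Icc α β) := by fun_prop
        exact (this.integrableOn_compact isCompact_Icc).mono_set Ioc_subset_Icc_self
      · exact Filter.Eventually.of_forall fun θ => by positivity
    rw [e5]
    apply ENNReal.ofReal_le_ofReal
    rw [← div_eq_mul_inv, div_le_iff₀ hr, ← intervalIntegral.integral_mul_const]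
    refine low.trans (le_of_eq ?_)
    congr 1
    ext θ
    ring
  have hfin : ∫⁻ r in Ioo 0 δ, ENNReal.ofReal (η ^ 2 / Real.pi * r⁻¹) < ⊤ := by
    refine lt_of_le_of_lt ?_ harea
    refine le_trans (setLIntegral_mono' measurableSet_Ioo key) ?_
    exact lintegral_mono_set Ioo_subset_Ioi_self
  have hIntg : IntegrableOn (fun r : ℝ => η ^ 2 / Real.pi * r⁻¹) (Ioo 0 δ) := by
    refine ⟨(by fun_prop : Measurable _).aestronglyMeasurable, ?_⟩
    rw [hasFiniteIntegral_iff_ofReal]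
    · exact hfin
    · filter_upwards [ae_restrict_mem measurableSet_Ioo] with r hr
      have := hr.1
      simp only [Pi.zero_apply]; positivity
  have hint2 : IntervalIntegrable (fun r : ℝ => r⁻¹) volume 0 δ := by
    rw [intervalIntegrable_iff_integrableOn_Ioo_of_le hδ.le (by simp) (by simp)]
    have h3 := hIntg.const_mul (Real.pi / η ^ 2)
    refine h3.congr (Filter.Eventually.of_forall fun r => ?_)
    simp only
    field_simp
  rw [intervalIntegrable_inv_iff] at hint2
  rcases hint2 with h | h
  · linarith
  · exact h (by simp)

lemma length_area {g : ℂ → ℂ} (hd : DifferentiableOn ℂ g (ball 0 1))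
    (hi : InjOn g (ball 0 1)) (hm : MapsTo g (ball 0 1) (ball 0 1)) {ζ : ℂ} (hζ : ‖ζ‖ = 1)
    {η δ : ℝ} (hη : 0 < η) (hδ : 0 < δ) :
    ∃ r, 0 < r ∧ r < δ ∧ ∀ z ∈ ball (0:ℂ) 1 ∩ sphere ζ r, ∀ z' ∈ ball (0:ℂ) 1 ∩ sphere ζ r,
      dist (g z) (g z') ≤ η := by
  have hζ0 : ζ ≠ 0 := by rintro rfl; simp at hζ
  set T : ℂ → ℂ := fun w => ζ * (1 - w) with hT
  have hTm : MapsTo T (ball 1 1) (ball 0 1) := by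
    intro w hw
    rw [mem_ball, dist_comm, dist_eq_norm] at hw
    simpa [T, hζ] using hw
  obtain ⟨r, hr, hrδ, H⟩ := length_area_aux (ψ := fun w => g (T w))
    (hd.comp (by fun_prop) hTm) (hi.comp (fun x _ y _ h => by
      simpa [T, hζ0] using h) hTm) (hm.comp hTm) hη hδ
  refine ⟨r, hr, hrδ, ?_⟩
  have e : ∀ z : ℂ, T (1 - z / ζ) = z := by
    intro z; simp only [T]; field_simp; ring
  have e2 : ∀ z ∈ ball (0:ℂ) 1 ∩ sphere ζ r, 1 - z / ζ ∈ ball (1:ℂ) 1 ∩ sphere 0 r := by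
    rintro z ⟨hz, hzr⟩
    constructor
    · rw [mem_ball, dist_eq_norm]
      simpa [hζ] using hz
    · rw [mem_sphere, dist_eq_norm] at hzr
      rw [mem_sphere_zero_iff_norm, ← hzr]
      have : z - ζ = - (ζ * (1 - z / ζ)) := by field_simp; ring
      rw [this, norm_neg, norm_mul, hζ, one_mul]
  intro z hz z' hz'
  have := H _ (e2 z hz) _ (e2 z' hz')
  simpa only [e] using this
end Part5

section Part6
def PropS (E : Set ℂ) : Prop := ∀ ε > 0, ∃ F : Set (Set ℂ), F.Finite ∧
  (∀ P ∈ F, IsCompact P ∧ IsPreconnected P ∧ ∀ x ∈ P, ∀ y ∈ P, dist x y ≤ ε) ∧ ⋃₀ F = E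

lemma exists_gap {F : Set (Set ℂ)} (hF : F.Finite) (hc : ∀ P ∈ F, IsCompact P) :
    ∃ δ > 0, ∀ P ∈ F, ∀ Q ∈ F, ∀ x ∈ P, ∀ y ∈ Q, dist x y < δ → (P ∩ Q).Nonempty := by
  have h1 : ∀ P ∈ F, ∀ Q ∈ F, ∀ᶠ δ in 𝓝[>] (0:ℝ),
      ∀ x ∈ P, ∀ y ∈ Q, dist x y < δ → (P ∩ Q).Nonempty := by
    intro P hP Q hQ
    by_cases hd : (P ∩ Q).Nonempty
    · exact Filter.Eventually.of_forall fun _ _ _ _ _ _ => hd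
    · have hd' : Disjoint P Q := disjoint_iff_inter_eq_empty.2 (not_nonempty_iff_eq_empty.1 hd)
      obtain ⟨δ, hδ, hdj⟩ := hd'.exists_thickenings (hc P hP) (hc Q hQ).isClosed
      have : ∀ᶠ t in 𝓝[>] (0:ℝ), t < δ := mem_nhdsWithin_of_mem_nhds (Iio_mem_nhds hδ)
      filter_upwards [this] with t ht x hx y hy hxy
      exfalso
      refine disjoint_left.1 hdj (self_subset_thickening hδ P hx) ?_
      rw [mem_thickening_iff]
      exact ⟨y, hy, hxy.trans ht⟩
  have h2 : ∀ᶠ δ in 𝓝[>] (0:ℝ), ∀ P ∈ F, ∀ Q ∈ F, ∀ x ∈ P, ∀ y ∈ Q, dist x y < δ →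
      (P ∩ Q).Nonempty := by
    rw [Filter.eventually_all_finite hF]
    intro P hP
    rw [Filter.eventually_all_finite hF]
    exact h1 P hP
  obtain ⟨δ, h, hδ⟩ := (h2.and self_mem_nhdsWithin).exists
  exact ⟨δ, hδ, h⟩

lemma small_osc {V : Set ℂ} (hVo : IsOpen V) (hVc : IsConnected V) (hV1 : V ⊆ ball 0 1)
    (hS : PropS (closedBall (0:ℂ) 1 \ V)) {f g : ℂ → ℂ} (hf : ContinuousOn f V)
    (hg : DifferentiableOn ℂ g (ball 0 1)) (hfm : MapsTo f V (ball 0 1))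
    (hgm : MapsTo g (ball 0 1) V)
    (hgf : ∀ z ∈ V, g (f z) = z)
    (hfg : ∀ w ∈ ball (0:ℂ) 1, f (g w) = w) {ζ : ℂ} (hζ : ‖ζ‖ = 1) {ε : ℝ} (hε : 0 < ε) :
    ∃ r > 0, ∀ z ∈ ball (0:ℂ) 1 ∩ ball ζ r, ∀ z' ∈ ball (0:ℂ) 1 ∩ ball ζ r,
      dist (g z) (g z') ≤ ε := by
  have hgi : InjOn g (ball 0 1) := fun x hx y hy h => by
    rw [← hfg x hx, ← hfg y hy, h]
  set E := closedBall (0:ℂ) 1 \ V with hE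
  have hEc : IsCompact E := (isCompact_closedBall _ _).diff hVo
  have h00 : (0:ℂ) ∈ ball (0:ℂ) 1 := by simp
  obtain ⟨d, hd, hdf⟩ : ∃ d > 0, ∀ z ∈ ball (0:ℂ) 1, dist (g z) (g 0) < d → ‖z‖ < 1/2 := by
    have hc : ContinuousAt f (g 0) := hf.continuousAt (hVo.mem_nhds (hgm h00))
    obtain ⟨d, hd, h⟩ := Metric.continuousAt_iff.1 hc (1/2) (by norm_num)
    refine ⟨d, hd, fun z hz hzd => ?_⟩
    have := h hzd
    rwa [hfg z hz, hfg 0 h00, dist_zero_right] at this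
  set e := min (ε / 4) (d / 4) with he
  have he0 : 0 < e := lt_min (by linarith) (by linarith)
  have he1 : e ≤ ε / 4 := min_le_left _ _
  have he2 : e ≤ d / 4 := min_le_right _ _
  obtain ⟨F, hFf, hFp, hFE⟩ := hS e he0
  obtain ⟨δ, hδ, hgap⟩ := exists_gap hFf (fun P hP => (hFp P hP).1)
  set η := min (δ / 2) e with hη
  have hη0 : 0 < η := lt_min (by linarith) he0
  obtain ⟨r, hr, hr2, hosc⟩ := length_area hg hgi (hgm.mono_right hV1) hζ hη0
    (show (0:ℝ) < 1/2 by norm_num)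
  set c := ball (0:ℂ) 1 ∩ sphere ζ r with hc
  set A0 := closure (g '' c) with hA0
  have hA0d : ∀ x ∈ A0, ∀ y ∈ A0, dist x y ≤ η := by
    intro x hx y hy
    have h1 : closure ((g '' c) ×ˢ (g '' c)) ⊆ {p : ℂ × ℂ | dist p.1 p.2 ≤ η} := by
      refine closure_minimal ?_ (isClosed_le (by fun_prop) continuous_const)
      rintro ⟨_, _⟩ ⟨⟨a, ha, rfl⟩, ⟨b, hb, rfl⟩⟩
      exact hosc a ha b hb
    have h2 : (x, y) ∈ closure ((g '' c) ×ˢ (g '' c)) := by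
      rw [closure_prod_eq]; exact ⟨hx, hy⟩
    exact h1 h2
  have hA0cl : A0 ⊆ closedBall 0 1 := by
    refine closure_minimal ?_ isClosed_closedBall
    rintro _ ⟨z, hz, rfl⟩
    exact ball_subset_closedBall (hV1 (hgm hz.1))
  have hA0c : IsCompact A0 := (isCompact_closedBall _ _).of_isClosed_subset isClosed_closure hA0cl
  set F' := {P ∈ F | (P ∩ A0).Nonempty} with hF'
  have hF'f : F'.Finite := hFf.subset (sep_subset _ _)
  set Lp := ⋃₀ F' with hLp
  have hLc : IsCompact Lp := hF'f.isCompact_sUnion (fun P hP => (hFp P hP.1).1)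
  have hLE : Lp ⊆ E := by
    rw [← hFE]; exact sUnion_subset_sUnion (sep_subset _ _)
  have hLpre : IsPreconnected Lp := by
    rcases F'.eq_empty_or_nonempty with h | ⟨P0, hP0⟩
    · rw [hLp, h, sUnion_empty]; exact isPreconnected_empty
    · obtain ⟨x0, hx0P, hx0A⟩ := hP0.2
      refine isPreconnected_of_forall x0 ?_
      rintro y ⟨Q, hQ, hyQ⟩
      obtain ⟨x1, hx1Q, hx1A⟩ := hQ.2
      have hne : (P0 ∩ Q).Nonempty := hgap P0 hP0.1 Q hQ.1 x0 hx0P x1 hx1Q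
        (lt_of_le_of_lt (hA0d x0 hx0A x1 hx1A) (lt_of_le_of_lt (min_le_left _ _) (by linarith)))
      refine ⟨P0 ∪ Q, union_subset (subset_sUnion_of_mem hP0) (subset_sUnion_of_mem hQ),
        Or.inl hx0P, Or.inr hyQ, IsPreconnected.union' hne (hFp P0 hP0.1).2.1 (hFp Q hQ.1).2.1⟩
  set A := A0 ∪ Lp with hA
  have hAc : IsCompact A := hA0c.union hLc
  have hAE : A ∩ E = Lp := by
    ext x; constructor
    · rintro ⟨hx | hx, hxE⟩
      · rw [← hFE] at hxE
        obtain ⟨P, hP, hxP⟩ := hxE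
        exact ⟨P, ⟨hP, x, hxP, hx⟩, hxP⟩
      · exact hx
    · intro hx; exact ⟨Or.inr hx, hLE hx⟩
  have hzc : ζ * (1 - r) ∈ c := by
    constructor
    · rw [mem_ball_zero_iff, norm_mul, hζ, one_mul, ← Complex.ofReal_one, ← Complex.ofReal_sub,
        Complex.norm_real, Real.norm_eq_abs, abs_lt]
      constructor <;> linarith
    · rw [mem_sphere, dist_eq_norm, show ζ * (1 - r) - ζ = -(ζ * r) by ring, norm_neg, norm_mul, hζ,
        one_mul, Complex.norm_real, Real.norm_eq_abs, abs_of_pos hr]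
  set a0 := g (ζ * (1 - r)) with ha0
  have ha0A : a0 ∈ A0 := subset_closure ⟨_, hzc, rfl⟩
  set ρ := η + e with hρ
  have hηe : η ≤ e := min_le_right _ _
  have hAρ : A ⊆ closedBall a0 ρ := by
    rintro x (hx | ⟨P, hP, hxP⟩)
    · rw [mem_closedBall]; linarith [hA0d x hx a0 ha0A]
    · obtain ⟨y, hyP, hyA⟩ := hP.2
      have h1 := (hFp P hP.1).2.2 x hxP y hyP
      have h2 := hA0d y hyA a0 ha0A
      rw [mem_closedBall]; linarith [dist_triangle x y a0]
  have hout : ∀ z ∈ c, 1/2 < ‖z‖ := by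
    rintro z ⟨-, hz⟩
    rw [mem_sphere, dist_eq_norm] at hz
    have := norm_sub_norm_le ζ z
    rw [norm_sub_rev, hz, hζ] at this
    linarith
  have hg0 : g 0 ∉ closedBall a0 ρ := by
    intro h
    rw [mem_closedBall, dist_comm] at h
    have := hdf _ hzc.1 (lt_of_le_of_lt h (by linarith))
    linarith [hout _ hzc]
  have hmain : ∀ z ∈ ball (0:ℂ) 1 ∩ ball ζ r, g z ∈ closedBall a0 ρ := by
    rintro z ⟨hz, hzr⟩
    by_contra hcon
    have hzE : g z ∉ E := fun h => h.2 (hgm hz)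
    have h0E : g 0 ∉ E := fun h => h.2 (hgm h00)
    obtain ⟨S, hSp, hSd, hSz, hS0⟩ := janiszewski (w := g z) (w' := g 0) hAc hEc (hAE ▸ hLpre)
      (by rintro (h | h); exacts [hcon (hAρ h), hzE h])
      (by rintro (h | h); exacts [hg0 (hAρ h), h0E h])
      ⟨(closedBall a0 ρ)ᶜ, isPreconnected_compl_closedBall _ _, fun x hx hxA => hx (hAρ hxA),
        hcon, hg0⟩
      ⟨V, hVc.isPreconnected, fun x hx hxE => hxE.2 hx, hgm hz, hgm h00⟩
    have hSV : S ⊆ V := by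
      refine hSp.subset_left_of_subset_union hVo (isClosed_closedBall (x := (0:ℂ)) (ε := 1)).isOpen_compl
        ?_ ?_ ⟨g z, hSz, hgm hz⟩
      · rw [disjoint_left]; intro x hx hx'
        exact hx' (ball_subset_closedBall (hV1 hx))
      · intro x hx
        by_contra h
        simp only [mem_union, mem_compl_iff, not_or, not_not] at h
        exact hSd x hx (Or.inr ⟨h.2, h.1⟩)
    have hcd : ContinuousOn (fun w => dist (f w) ζ) S := by
      have := hf.mono hSV
      fun_prop
    have hivt := hSp.intermediate_value hSz hS0 hcd
    have hrm : r ∈ Icc (dist (f (g z)) ζ) (dist (f (g 0)) ζ) := by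
      rw [hfg z hz, hfg 0 h00]
      refine ⟨(mem_ball.1 hzr).le, ?_⟩
      rw [dist_zero_left, hζ]; linarith
    obtain ⟨w, hwS, hw⟩ := hivt hrm
    refine hSd w hwS (Or.inl (Or.inl (subset_closure ⟨f w, ⟨hfm (hSV hwS), hw⟩, ?_⟩)))
    exact hgf w (hSV hwS)
  refine ⟨r, hr, fun z hz z' hz' => ?_⟩
  have h1 := mem_closedBall.1 (hmain z hz)
  have h2 := mem_closedBall'.1 (hmain z' hz')
  linarith [dist_triangle (g z) a0 (g z')]

theorem caratheodory {V : Set ℂ} (hVo : IsOpen V) (hVc : IsConnected V) (hV1 : V ⊆ ball 0 1)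
    (hE : IsPreconnected (closedBall (0:ℂ) 1 \ V))
    (hS : PropS (closedBall (0:ℂ) 1 \ V)) : ∃ G f : ℂ → ℂ,
      ContinuousOn G (closedBall 0 1) ∧ DifferentiableOn ℂ G (ball 0 1) ∧
      MapsTo G (ball 0 1) V ∧ MapsTo G (sphere 0 1) (closedBall (0:ℂ) 1 \ V) ∧
      ContinuousOn f V ∧ MapsTo f V (ball 0 1) ∧ (∀ z ∈ V, G (f z) = z) ∧
      ∀ w ∈ ball (0:ℂ) 1, f (G w) = w := by
  obtain ⟨f, g, hf, hg, hfm, hgm, hgf, hfg⟩ := riemann hVo hVc hV1 hE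
  have hlim : ∀ ζ ∈ closedBall (0:ℂ) 1, ∃ y, Filter.Tendsto g (𝓝[ball 0 1] ζ) (𝓝 y) := by
    intro ζ hζ
    rcases (mem_closedBall_zero_iff.1 hζ).lt_or_eq with h | h
    · exact ⟨g ζ, hg.continuousOn ζ (mem_ball_zero_iff.2 h)⟩
    · have hne : (𝓝[ball (0:ℂ) 1] ζ).NeBot := by
        rw [← mem_closure_iff_nhdsWithin_neBot, closure_ball _ one_ne_zero]; exact hζ
      apply CompleteSpace.complete (f := Filter.map g (𝓝[ball (0:ℂ) 1] ζ))
      rw [Metric.cauchy_iff]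
      refine ⟨Filter.map_neBot, fun ε hε => ?_⟩
      obtain ⟨r, hr, hosc⟩ := small_osc hVo hVc hV1 hS hf.continuousOn hg hfm hgm hgf hfg h
        (half_pos hε)
      refine ⟨g '' (ball 0 1 ∩ ball ζ r), Filter.image_mem_map ?_, ?_⟩
      · exact Filter.inter_mem self_mem_nhdsWithin
          (mem_nhdsWithin_of_mem_nhds (ball_mem_nhds _ hr))
      · rintro _ ⟨z, hz, rfl⟩ _ ⟨z', hz', rfl⟩
        linarith [hosc z hz z' hz']
  have hcl : closedBall (0:ℂ) 1 ⊆ closure (ball 0 1) := by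
    rw [closure_ball _ one_ne_zero]
  set G := extendFrom (ball (0:ℂ) 1) g with hG
  have hGc : ContinuousOn G (closedBall 0 1) := continuousOn_extendFrom hcl hlim
  have hGg : ∀ z ∈ ball (0:ℂ) 1, G z = g z := fun z hz =>
    extendFrom_eq (subset_closure hz) (hg.continuousOn z hz)
  refine ⟨G, f, hGc, hg.congr hGg, fun z hz => ?_, ?_, hf.continuousOn, hfm, fun z hz => ?_,
    fun w hw => ?_⟩
  · rw [hGg z hz]; exact hgm hz
  · intro ζ hζ
    have hζ' : ζ ∈ closedBall (0:ℂ) 1 := sphere_subset_closedBall hζ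
    have hne : (𝓝[ball (0:ℂ) 1] ζ).NeBot := by
      rw [← mem_closure_iff_nhdsWithin_neBot]; exact hcl hζ'
    obtain ⟨y, hy⟩ := hlim ζ hζ'
    have hGy : G ζ = y := extendFrom_eq (hcl hζ') hy
    rw [hGy]
    constructor
    · refine isClosed_closedBall.mem_of_tendsto hy ?_
      filter_upwards [self_mem_nhdsWithin] with z hz
      exact ball_subset_closedBall (hV1 (hgm hz))
    · intro hyV
      have h1 : Filter.Tendsto (fun z => f (g z)) (𝓝[ball (0:ℂ) 1] ζ) (𝓝 (f y)) :=
        (hf.continuousOn.continuousAt (hVo.mem_nhds hyV)).tendsto.comp hy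
      have h2 : Filter.Tendsto (fun z => f (g z)) (𝓝[ball (0:ℂ) 1] ζ) (𝓝 ζ) := by
        have : Filter.Tendsto (fun z : ℂ => z) (𝓝[ball (0:ℂ) 1] ζ) (𝓝 ζ) :=
          Filter.tendsto_id.mono_left nhdsWithin_le_nhds
        refine this.congr' ?_
        filter_upwards [self_mem_nhdsWithin] with z hz
        exact (hfg z hz).symm
      have h3 := tendsto_nhds_unique h1 h2
      have h4 := hfm hyV
      rw [h3, mem_ball_zero_iff, mem_sphere_zero_iff_norm.1 hζ] at h4
      exact lt_irrefl _ h4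
  · rw [hGg _ (hfm hz)]; exact hgf z hz
  · rw [hGg w hw]; exact hfg w hw
end Part6

section Part7
lemma tube {X Y : Type*} [TopologicalSpace X] [TopologicalSpace Y] [T2Space Y] {K : Set X}
    (hK : IsCompact K) {G : X → Y} (hG : ContinuousOn G K) {w : Y} {P : X → Prop}
    (hP : ∀ z ∈ K, G z = w → ∀ᶠ z' in 𝓝[K] z, P z') :
    ∀ᶠ w' in 𝓝 w, ∀ z ∈ K, G z = w' → P z := by
  have h1 : ∀ z ∈ K, ∃ O, IsOpen O ∧ z ∈ O ∧ (G z = w → ∀ z' ∈ O ∩ K, P z') := by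
    intro z hz
    by_cases h : G z = w
    · obtain ⟨O, hO, hzO, hsub⟩ := mem_nhdsWithin.1 (hP z hz h)
      exact ⟨O, hO, hzO, fun _ z' hz' => hsub hz'⟩
    · exact ⟨univ, isOpen_univ, mem_univ _, fun h' => absurd h' h⟩
  choose! O hO hzO hOP using h1
  set U := ⋃ z ∈ {z ∈ K | G z = w}, O z with hU
  have hUo : IsOpen U := isOpen_biUnion fun z hz => hO z hz.1
  have hc : IsCompact (G '' (K \ U)) := (hK.diff hUo).image_of_continuousOn (hG.mono sdiff_subset)
  have hw : w ∉ G '' (K \ U) := by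
    rintro ⟨z, ⟨hz, hzU⟩, hzw⟩
    exact hzU (mem_biUnion (show z ∈ {z ∈ K | G z = w} from ⟨hz, hzw⟩) (hzO z hz))
  filter_upwards [hc.isClosed.isOpen_compl.mem_nhds hw] with w' hw' z hz hzw
  by_cases hzU : z ∈ U
  · obtain ⟨z0, hz0, hzz⟩ := mem_iUnion₂.1 hzU
    exact hOP z0 hz0.1 hz0.2 z ⟨hzz, hz⟩
  · exact absurd ⟨z, ⟨hz, hzU⟩, hzw⟩ hw'

lemma tendsto_of_unique {ι X Y : Type*} [TopologicalSpace X] [TopologicalSpace Y] [T2Space Y]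
    {K : Set X} (hK : IsCompact K) {G : X → Y} (hG : ContinuousOn G K) {x : X} {q : Y}
    (hu : ∀ x' ∈ K, G x' = q → x' = x) {l : Filter ι} {h : ι → X} (hh : ∀ᶠ i in l, h i ∈ K)
    (ht : Filter.Tendsto (fun i => G (h i)) l (𝓝 q)) : Filter.Tendsto h l (𝓝 x) := by
  intro N hN
  have := tube hK hG (w := q) (P := fun z => z ∈ N) (by
    intro z hz hzq
    rw [hu z hz hzq]
    exact mem_nhdsWithin_of_mem_nhds hN)
  have h2 := ht.eventually this
  have h3 : ∀ᶠ i in l, h i ∈ N := by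
    filter_upwards [hh, h2] with i hi hi'
    exact hi' (h i) hi rfl
  exact h3

lemma PropS.union {A B : Set ℂ} (hA : PropS A) (hB : PropS B) : PropS (A ∪ B) := by
  intro ε hε
  obtain ⟨F, hF, hF', rfl⟩ := hA ε hε
  obtain ⟨F', hFf, hFF, rfl⟩ := hB ε hε
  refine ⟨F ∪ F', hF.union hFf, ?_, sUnion_union _ _⟩
  rintro P (hP | hP)
  exacts [hF' P hP, hFF P hP]

lemma PropS_image {f : ℝ → ℂ} (hf : ContinuousOn f (Icc 0 1)) : PropS (f '' Icc 0 1) := by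
  intro ε hε
  have hu := isCompact_Icc.uniformContinuousOn_of_continuous hf
  obtain ⟨δ, hδ, h⟩ := Metric.uniformContinuousOn_iff.1 hu ε hε
  obtain ⟨n, hn⟩ := exists_nat_one_div_lt hδ
  have hn0 : (0:ℝ) < n + 1 := by positivity
  refine ⟨(fun k : ℕ => f '' Icc ((k:ℝ) / (n + 1)) ((k + 1) / (n + 1))) '' (Finset.range (n + 1)),
    (Finset.finite_toSet _).image _, ?_, ?_⟩
  · rintro _ ⟨k, hk, rfl⟩
    have hk' : (k:ℝ) + 1 ≤ n + 1 := by
      have := Finset.mem_range.1 (Finset.mem_coe.1 hk)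
      exact_mod_cast this
    have hsub : Icc ((k:ℝ) / (n + 1)) ((k + 1) / (n + 1)) ⊆ Icc 0 1 := by
      refine Icc_subset_Icc (by positivity) ?_
      rw [div_le_one hn0]; exact hk'
    refine ⟨isCompact_Icc.image_of_continuousOn (hf.mono hsub),
      isPreconnected_Icc.image _ (hf.mono hsub), ?_⟩
    rintro _ ⟨x, hx, rfl⟩ _ ⟨y, hy, rfl⟩
    refine (h x (hsub hx) y (hsub hy) ?_).le
    refine lt_of_le_of_lt ?_ hn
    rw [Real.dist_eq, abs_le]
    have : ((k:ℝ) + 1) / (n + 1) = k / (n + 1) + 1 / (n + 1) := by ring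
    constructor <;> linarith [hx.1, hx.2, hy.1, hy.2]
  · ext z
    simp only [sUnion_image, mem_iUnion, mem_image, Finset.coe_range, mem_Iio]
    constructor
    · rintro ⟨k, hk, x, hx, rfl⟩
      have hk' : (k:ℝ) + 1 ≤ n + 1 := by exact_mod_cast hk
      refine ⟨x, ⟨le_trans (by positivity) hx.1, hx.2.trans ?_⟩, rfl⟩
      rw [div_le_one hn0]; exact hk'
    · rintro ⟨x, hx, rfl⟩
      rcases hx.2.lt_or_eq with h1 | h1
      · refine ⟨⌊x * (n + 1)⌋₊, ?_, x, ⟨?_, ?_⟩, rfl⟩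
        · have : 0 ≤ x * (n+1) := mul_nonneg hx.1 hn0.le
          rw [Nat.floor_lt this]
          push_cast
          nlinarith
        · rw [div_le_iff₀ hn0]
          exact Nat.floor_le (mul_nonneg hx.1 hn0.le)
        · rw [le_div_iff₀ hn0]
          exact (Nat.lt_floor_add_one _).le
      · subst h1
        refine ⟨n, Nat.lt_succ_self n, 1, ⟨?_, ?_⟩, rfl⟩
        · rw [div_le_one hn0]; linarith
        · rw [div_self hn0.ne']

lemma sphere_eq_image : (fun t : ℝ => Complex.exp ((2 * Real.pi * t : ℝ) * Complex.I)) '' Icc 0 1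
    = sphere (0:ℂ) 1 := by
  ext z
  simp only [mem_image, mem_sphere_zero_iff_norm]
  constructor
  · rintro ⟨t, -, rfl⟩
    exact Complex.norm_exp_ofReal_mul_I _
  · intro hz
    have hp := Real.pi_pos
    obtain ⟨θ, hθ, hz'⟩ : ∃ θ ∈ Ico (0:ℝ) (2 * Real.pi), Complex.exp (θ * Complex.I) = z := by
      refine ⟨toIcoMod Real.two_pi_pos 0 z.arg, by simpa using toIcoMod_mem_Ico Real.two_pi_pos 0 z.arg, ?_⟩
      have h1 : Complex.exp (z.arg * Complex.I) = z := by
        have := Complex.norm_mul_exp_arg_mul_I z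
        rwa [hz, Complex.ofReal_one, one_mul] at this
      rw [toIcoMod]
      conv_rhs => rw [← h1]
      rw [Complex.exp_eq_exp_iff_exists_int]
      refine ⟨-toIcoDiv Real.two_pi_pos 0 z.arg, ?_⟩
      push_cast
      simp only [zsmul_eq_mul]
      push_cast
      ring
    refine ⟨θ / (2 * Real.pi), ⟨div_nonneg hθ.1 (by positivity), ?_⟩, ?_⟩
    · rw [div_le_one (by positivity)]; exact hθ.2.le
    · rw [mul_div_cancel₀ _ (by positivity)]; exact hz'

lemma PropS_sphere : PropS (sphere (0:ℂ) 1) := by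
  rw [← sphere_eq_image]
  exact PropS_image (by fun_prop)

/-- an arc contains no circle -/
lemma circle_not_subset_arc {γ : ℝ → ℂ} (hc : ContinuousOn γ (Icc 0 1)) (hi : InjOn γ (Icc 0 1))
    (c : ℂ) {r : ℝ} (hr : 0 < r) : ¬ (sphere c r ⊆ γ '' Icc 0 1) := by
  intro hs
  have h1 : ∀ z ∈ γ '' Icc 0 1, ∃ t ∈ Icc (0:ℝ) 1, γ t = z := fun z hz => hz
  choose! τ hτ hγτ using h1
  have hτc : ContinuousOn τ (sphere c r) := by
    intro z hz
    refine tendsto_of_unique (isCompact_Icc (a := (0:ℝ)) (b := 1)) hc (q := z)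
      (fun x' hx' h => hi hx' (hτ z (hs hz)) (h.trans (hγτ z (hs hz)).symm)) ?_ ?_
    · filter_upwards [self_mem_nhdsWithin] with z' hz'
      exact hτ z' (hs hz')
    · have : Filter.Tendsto (fun z : ℂ => z) (𝓝[sphere c r] z) (𝓝 z) :=
        Filter.tendsto_id.mono_left nhdsWithin_le_nhds
      refine this.congr' ?_
      filter_upwards [self_mem_nhdsWithin] with z' hz'
      exact (hγτ z' (hs hz')).symm
  have hσ : ∀ z ∈ sphere c r, 2 * c - z ∈ sphere c r := by
    intro z hz
    rw [mem_sphere, dist_eq_norm] at hz ⊢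
    rw [← hz, ← norm_neg]; congr 1; ring
  have hpre : IsPreconnected (sphere c r) := isPreconnected_sphere (by
    rw [Complex.rank_real_complex]; norm_num) c r
  have hkc : ContinuousOn (fun z => τ z - τ (2 * c - z)) (sphere c r) :=
    hτc.sub (hτc.comp (by fun_prop) hσ)
  have hz0 : c + r ∈ sphere c r := by
    simp [hr.le]
  have hzero : ∃ z ∈ sphere c r, τ z - τ (2 * c - z) = 0 := by
    have e1 : 2 * c - (2 * c - (c + r)) = c + r := by ring
    rcases le_total (τ (c + r) - τ (2 * c - (c + r))) 0 with h | h
    · have := hpre.intermediate_value hz0 (hσ _ hz0) hkc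
      exact this ⟨h, by simp only [e1]; linarith⟩
    · have := hpre.intermediate_value (hσ _ hz0) hz0 hkc
      exact this ⟨by simp only [e1]; linarith, h⟩
  obtain ⟨z, hz, hzz⟩ := hzero
  have h2 : z = 2 * c - z := by
    have e1 := hγτ z (hs hz)
    rw [sub_eq_zero.1 hzz, hγτ _ (hs (hσ z hz))] at e1
    exact e1.symm
  have h3 : z = c := by linear_combination h2 / 2
  rw [h3, mem_sphere, dist_self] at hz
  exact hr.ne hz

structure IsSlit (γ : ℝ → ℂ) : Prop where
  c : ContinuousOn γ (Icc 0 1)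
  i : InjOn γ (Icc 0 1)
  d : ∀ t ∈ Ico (0:ℝ) 1, ‖γ t‖ < 1
  e : ‖γ 1‖ = 1

def slitE (γ : ℝ → ℂ) : Set ℂ := sphere 0 1 ∪ γ '' Icc 0 1
def slitV (γ : ℝ → ℂ) : Set ℂ := ball 0 1 \ γ '' Icc 0 1

variable {γ : ℝ → ℂ}

lemma IsSlit.le (h : IsSlit γ) {t : ℝ} (ht : t ∈ Icc (0:ℝ) 1) : ‖γ t‖ ≤ 1 := by
  rcases ht.2.lt_or_eq with h1 | h1
  · exact (h.d t ⟨ht.1, h1⟩).le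
  · rw [h1, h.e]

lemma IsSlit.E_eq (h : IsSlit γ) : closedBall (0:ℂ) 1 \ slitV γ = slitE γ := by
  ext z
  simp only [slitV, slitE, Set.mem_sdiff, mem_union, mem_closedBall_zero_iff, mem_ball_zero_iff,
    mem_sphere_zero_iff_norm, not_and, not_not]
  constructor
  · rintro ⟨h1, h2⟩
    rcases h1.lt_or_eq with h3 | h3
    exacts [Or.inr (h2 h3), Or.inl h3]
  · rintro (h1 | ⟨t, ht, rfl⟩)
    · exact ⟨h1.le, fun h => absurd h1 h.ne⟩
    · exact ⟨h.le ht, fun _ => ⟨t, ht, rfl⟩⟩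

lemma IsSlit.compact_arc (h : IsSlit γ) : IsCompact (γ '' Icc 0 1) :=
  isCompact_Icc.image_of_continuousOn h.c

lemma IsSlit.V_open (h : IsSlit γ) : IsOpen (slitV γ) :=
  isOpen_ball.sdiff h.compact_arc.isClosed

lemma IsSlit.E_compact (h : IsSlit γ) : IsCompact (slitE γ) :=
  (isCompact_sphere _ _).union h.compact_arc

lemma isPreconnected_circle (r : ℝ) : IsPreconnected (sphere (0:ℂ) r) :=
  isPreconnected_sphere (by rw [Complex.rank_real_complex]; norm_num) 0 r

lemma IsSlit.E_pre (h : IsSlit γ) : IsPreconnected (slitE γ) := by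
  refine IsPreconnected.union (γ 1) (by simp [h.e]) ⟨1, by simp, rfl⟩ (isPreconnected_circle 1)
    (isPreconnected_Icc.image _ h.c)

lemma IsSlit.E_propS (h : IsSlit γ) : PropS (slitE γ) := PropS_sphere.union (PropS_image h.c)

lemma IsSlit.V_dense (h : IsSlit γ) : closedBall (0:ℂ) 1 ⊆ closure (slitV γ) := by
  rw [← closure_ball _ one_ne_zero]
  refine closure_minimal ?_ isClosed_closure
  intro z hz
  rw [Metric.mem_closure_iff]
  intro ε hε
  obtain ⟨r, hr, hrb⟩ := Metric.isOpen_iff.1 isOpen_ball z hz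
  have hm : 0 < min r ε / 2 := by have := lt_min hr hε; linarith
  obtain ⟨w, hw, hwγ⟩ := not_subset.1 (circle_not_subset_arc h.c h.i z hm)
  rw [mem_sphere] at hw
  refine ⟨w, ⟨hrb ?_, hwγ⟩, ?_⟩
  · rw [mem_ball, hw]; have := min_le_left r ε; linarith
  · rw [dist_comm, hw]; have := min_le_right r ε; linarith

lemma subset_V_of_pre (h : IsSlit γ) {S : Set ℂ} (hS : IsPreconnected S)
    (hd : ∀ z ∈ S, z ∉ slitE γ) {w : ℂ} (hw : w ∈ S) (hwV : w ∈ slitV γ) : S ⊆ slitV γ := by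
  refine hS.subset_left_of_subset_union h.V_open (isClosed_closedBall (x := (0:ℂ)) (ε := 1)).isOpen_compl
    ?_ ?_ ⟨w, hw, hwV⟩
  · rw [disjoint_left]; intro x hx hx'
    exact hx' (ball_subset_closedBall hx.1)
  · intro x hx
    by_contra hcon
    simp only [mem_union, mem_compl_iff, not_or, not_not] at hcon
    refine hd x hx ?_
    rw [← h.E_eq]; exact ⟨hcon.2, hcon.1⟩

lemma IsSlit.V_connected (h : IsSlit γ) : IsConnected (slitV γ) := by
  constructor
  · have : (0:ℂ) ∈ closure (slitV γ) := h.V_dense (by simp)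
    exact closure_nonempty_iff.1 ⟨_, this⟩
  · refine isPreconnected_of_forall_pair ?_
    intro w hw w' hw'
    have hIntg : sphere (0:ℂ) 1 ∩ γ '' Icc 0 1 = {γ 1} := by
      ext z; constructor
      · rintro ⟨hz, t, ht, rfl⟩
        rcases ht.2.lt_or_eq with h1 | h1
        · rw [mem_sphere_zero_iff_norm] at hz
          exact absurd hz (h.d t ⟨ht.1, h1⟩).ne
        · rw [h1]; rfl
      · rintro rfl; exact ⟨by simp [h.e], 1, by simp, rfl⟩
    have hVE : ∀ z ∈ slitV γ, z ∉ slitE γ := by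
      intro z hz; rw [← h.E_eq]; exact fun h' => h'.2 hz
    obtain ⟨S, hS, hSd, hwS, hwS'⟩ := janiszewski (isCompact_sphere (0:ℂ) 1) h.compact_arc
      (by rw [hIntg]; exact isPreconnected_singleton) (hVE w hw) (hVE w' hw')
      ⟨ball 0 1, (convex_ball (0:ℂ) 1).isPreconnected, fun z hz hz' =>
        (mem_ball.1 hz).ne (mem_sphere.1 hz'), hw.1, hw'.1⟩ (arc_notSep h.c h.i hw.2 hw'.2)
    exact ⟨S, subset_V_of_pre h hS hSd hwS hw, hwS, hwS', hS⟩
end Part7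

section Part8
structure SlitMap (γ : ℝ → ℂ) (G f : ℂ → ℂ) : Prop where
  s : IsSlit γ
  Gc : ContinuousOn G (closedBall 0 1)
  Gd : DifferentiableOn ℂ G (ball 0 1)
  GV : MapsTo G (ball 0 1) (slitV γ)
  GE : MapsTo G (sphere 0 1) (slitE γ)
  fc : ContinuousOn f (slitV γ)
  fm : MapsTo f (slitV γ) (ball 0 1)
  Gf : ∀ z ∈ slitV γ, G (f z) = z
  fG : ∀ w ∈ ball (0:ℂ) 1, f (G w) = w

lemma exists_slitMap {γ : ℝ → ℂ} (h : IsSlit γ) : ∃ G f, SlitMap γ G f := by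
  obtain ⟨G, f, h1, h2, h3, h4, h5, h6, h7, h8⟩ := caratheodory h.V_open h.V_connected
    (fun z hz => hz.1) (by rw [h.E_eq]; exact h.E_pre) (by rw [h.E_eq]; exact h.E_propS)
  exact ⟨G, f, h, h1, h2, h3, by rwa [h.E_eq] at h4, h5, h6, h7, h8⟩

def cis (θ : ℝ) : ℂ := Complex.exp (θ * Complex.I)

lemma norm_cis (θ : ℝ) : ‖cis θ‖ = 1 := Complex.norm_exp_ofReal_mul_I θ

lemma continuous_cis : Continuous cis := by unfold cis; fun_prop

lemma cis_add (a b : ℝ) : cis (a + b) = cis a * cis b := by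
  simp only [cis, Complex.ofReal_add, add_mul, Complex.exp_add]

lemma cis_two_pi (a : ℝ) : cis (a + 2 * Real.pi) = cis a := by
  rw [cis_add]; simp [cis]

lemma cis_int (a : ℝ) (n : ℤ) : cis (a + n * (2 * Real.pi)) = cis a := by
  simp only [cis]
  rw [Complex.exp_eq_exp_iff_exists_int]
  exact ⟨n, by push_cast; ring⟩

lemma cis_re (a : ℝ) : (cis a).re = Real.cos a := Complex.exp_ofReal_mul_I_re a

lemma cis_eq_iff {a b : ℝ} : cis a = cis b ↔ ∃ n : ℤ, a = b + n * (2 * Real.pi) := by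
  constructor
  · intro h
    obtain ⟨n, hn⟩ := Complex.exp_eq_exp_iff_exists_int.1 h
    refine ⟨n, ?_⟩
    have := congrArg Complex.im hn
    simpa using this
  · rintro ⟨n, rfl⟩; exact cis_int b n

lemma exists_cis_Ico (θ₀ : ℝ) {z : ℂ} (hz : ‖z‖ = 1) :
    ∃ θ ∈ Ico θ₀ (θ₀ + 2 * Real.pi), cis θ = z := by
  refine ⟨toIcoMod Real.two_pi_pos θ₀ z.arg, toIcoMod_mem_Ico Real.two_pi_pos θ₀ z.arg, ?_⟩
  have h1 : cis z.arg = z := by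
    have := Complex.norm_mul_exp_arg_mul_I z
    rwa [hz, Complex.ofReal_one, one_mul] at this
  rw [toIcoMod]
  conv_rhs => rw [← h1]
  rw [cis_eq_iff]
  refine ⟨-toIcoDiv Real.two_pi_pos θ₀ z.arg, ?_⟩
  simp only [zsmul_eq_mul]
  push_cast
  ring

namespace SlitMap
variable {γ : ℝ → ℂ} {G f : ℂ → ℂ}

lemma VE (h : SlitMap γ G f) {z : ℂ} (hz : z ∈ slitV γ) : z ∉ slitE γ := by
  rw [← h.s.E_eq]; exact fun h' => h'.2 hz

lemma Gi (h : SlitMap γ G f) {z z' : ℂ} (hz : z ∈ ball (0:ℂ) 1) (hz' : z' ∈ ball (0:ℂ) 1)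
    (he : G z = G z') : z = z' := by
  rw [← h.fG z hz, ← h.fG z' hz', he]

lemma sphere_of_E (h : SlitMap γ G f) {z : ℂ} (hz : z ∈ closedBall (0:ℂ) 1)
    (hE : G z ∈ slitE γ) : ‖z‖ = 1 := by
  rcases (mem_closedBall_zero_iff.1 hz).lt_or_eq with h1 | h1
  · exact absurd hE (h.VE (h.GV (mem_ball_zero_iff.2 h1)))
  · exact h1

lemma surj (h : SlitMap γ G f) {q : ℂ} (hq : q ∈ closedBall (0:ℂ) 1) :
    ∃ u ∈ closedBall (0:ℂ) 1, G u = q := by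
  have hc : IsCompact (G '' closedBall 0 1) := (isCompact_closedBall _ _).image_of_continuousOn h.Gc
  have h1 : closure (slitV γ) ⊆ G '' closedBall 0 1 := by
    refine closure_minimal ?_ hc.isClosed
    intro z hz
    exact ⟨f z, ball_subset_closedBall (h.fm hz), h.Gf z hz⟩
  exact h1 (h.s.V_dense hq)

lemma nonconst (h : SlitMap γ G f) {q : ℂ} (hq : q ∈ slitE γ) {α β : ℝ} (hαβ : α < β) :
    ∃ θ ∈ Ioo α β, G (cis θ) ≠ q := by
  by_contra hcon
  push Not at hcon
  obtain ⟨n, hn⟩ := exists_nat_one_div_lt (div_pos (sub_pos.2 hαβ) Real.two_pi_pos)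
  set p : ℝ := 2 * Real.pi / (n + 1) with hp
  have hn0 : (0:ℝ) < n + 1 := by positivity
  have hp0 : 0 < p := div_pos Real.two_pi_pos hn0
  have hpl : p < β - α := by
    rw [lt_div_iff₀ Real.two_pi_pos] at hn
    rw [hp]
    have : 2 * Real.pi / (n + 1) = 1 / (n + 1) * (2 * Real.pi) := by ring
    linarith
  set P : ℂ → ℂ := fun z => ∏ k ∈ Finset.range (n + 1), (G (cis (k * p) * z) - q) with hP
  have hm1 : ∀ k : ℕ, MapsTo (fun z => cis (k * p) * z) (closedBall 0 1) (closedBall (0:ℂ) 1) := by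
    intro k z hz
    rw [mem_closedBall_zero_iff] at hz ⊢
    simpa [norm_cis] using hz
  have hm2 : ∀ k : ℕ, MapsTo (fun z => cis (k * p) * z) (ball 0 1) (ball (0:ℂ) 1) := by
    intro k z hz
    rw [mem_ball_zero_iff] at hz ⊢
    simpa [norm_cis] using hz
  have hPc : ContinuousOn P (closedBall 0 1) := by
    refine continuousOn_finsetProd _ fun k _ => ?_
    exact (h.Gc.comp (by fun_prop) (hm1 k)).sub continuousOn_const
  have hPd : DifferentiableOn ℂ P (ball 0 1) := by
    refine DifferentiableOn.fun_finsetProd fun k _ => ?_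
    exact (h.Gd.comp (by fun_prop) (hm2 k)).sub (differentiableOn_const _)
  have hz : ∀ z ∈ frontier (ball (0:ℂ) 1), ‖P z‖ ≤ 0 := by
    intro z hz
    rw [frontier_ball _ one_ne_zero, mem_sphere_zero_iff_norm] at hz
    obtain ⟨θ, -, rfl⟩ := exists_cis_Ico 0 hz
    set m : ℤ := toIocDiv hp0 α θ with hm
    have h1 := toIocMod_mem_Ioc hp0 α θ
    rw [toIocMod, zsmul_eq_mul] at h1
    set k := ((-m) % ((n:ℤ) + 1)).toNat with hk
    have hkm : ((k:ℕ):ℤ) = (-m) % ((n:ℤ) + 1) := Int.toNat_of_nonneg (Int.emod_nonneg _ (by positivity))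
    have hkl : k < n + 1 := by
      have := Int.emod_lt_of_pos (-m) (show (0:ℤ) < (n:ℤ) + 1 by positivity)
      rw [← hkm] at this
      exact_mod_cast this
    have hdiv : (-m : ℤ) = (k:ℤ) + ((n:ℤ) + 1) * ((-m) / ((n:ℤ) + 1)) := by
      rw [hkm]; exact (Int.emod_add_mul_ediv _ _).symm
    have hG : G (cis (k * p) * cis θ) = q := by
      rw [← cis_add, ← cis_int _ ((-m) / ((n:ℤ) + 1))]
      have e : (k:ℝ) * p + θ + ((-m) / ((n:ℤ) + 1) : ℤ) * (2 * Real.pi) = θ - m * p := by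
        have e1 : (-(m:ℝ)) = k + (n + 1) * ((-m / ((n:ℤ) + 1) : ℤ) : ℝ) := by exact_mod_cast hdiv
        have e2 : 2 * Real.pi = (n + 1) * p := by rw [hp]; field_simp
        rw [e2]
        linear_combination (-p) * e1
      rw [e]
      exact hcon _ ⟨h1.1, by linarith [h1.2]⟩
    have : P (cis θ) = 0 := Finset.prod_eq_zero (Finset.mem_range.2 hkl) (by rw [hG, sub_self])
    rw [this, norm_zero]
  have h0 := Complex.norm_le_of_forall_mem_frontier_norm_le (isBounded_ball (x := (0:ℂ)) (r := 1))
    (DiffContOnCl.mk_ball hPd hPc) hz (z := 0) (subset_closure (by simp))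
  have h1 : P 0 = 0 := norm_le_zero_iff.1 h0
  simp only [hP, mul_zero, Finset.prod_const] at h1
  have h2 : G 0 = q := sub_eq_zero.1 (pow_eq_zero_iff (by simp) |>.1 h1)
  exact h.VE (h.GV (x := 0) (by simp)) (h2 ▸ hq)

lemma GcisE (h : SlitMap γ G f) (θ : ℝ) : G (cis θ) ∈ slitE γ :=
  h.GE (mem_sphere_zero_iff_norm.2 (norm_cis θ))

lemma sep (h : SlitMap γ G f) {α β θ θ' : ℝ} {q : ℂ} (hα : G (cis α) = q) (hβ : G (cis β) = q)
    (hαβ : α < β) (hβα : β < α + 2 * Real.pi) (hθ : θ ∈ Ioo α β)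
    (hθ' : θ' ∈ Ioo β (α + 2 * Real.pi)) {S : Set ℂ} (hS : IsPreconnected S)
    (hSE : S ⊆ slitE γ \ {q}) (h1 : G (cis θ) ∈ S) (h2 : G (cis θ') ∈ S) : False := by
  have hpi := Real.pi_pos
  set m := (α + β) / 2 with hm
  set d := (β - α) / 2 with hd
  have hd0 : 0 < d := by rw [hd]; linarith
  have hdp : d < Real.pi := by rw [hd]; linarith
  set ℓ : ℂ → ℝ := fun z => (z * cis (-m)).re - Real.cos d with hℓ
  have hℓc : Continuous ℓ := by
    have : Continuous fun z : ℂ => (z * cis (-m)).re := Complex.continuous_re.comp (by fun_prop)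
    exact this.sub continuous_const
  have hℓe : ∀ t, ℓ (cis t) = Real.cos (t - m) - Real.cos d := by
    intro t
    simp only [hℓ]
    rw [← cis_add, cis_re]; rfl
  have hℓθ : 0 < ℓ (cis θ) := by
    rw [hℓe, sub_pos, ← Real.cos_abs (θ - m)]
    refine Real.cos_lt_cos_of_nonneg_of_le_pi (abs_nonneg _) hdp.le ?_
    rw [abs_lt, hm, hd]; constructor <;> linarith [hθ.1, hθ.2]
  have hℓθ' : ℓ (cis θ') < 0 := by
    rw [hℓe, sub_neg, show Real.cos (θ' - m) = Real.cos |θ' - m - Real.pi - (0:ℝ) - Real.pi| by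
      rw [Real.cos_abs, show θ' - m - Real.pi - (0:ℝ) - Real.pi = θ' - m - 2 * Real.pi by ring,
        Real.cos_sub_two_pi]]
    rcases le_total (θ' - m) Real.pi with hle | hle
    · rw [Real.cos_abs, show θ' - m - Real.pi - (0:ℝ) - Real.pi = θ' - m - 2 * Real.pi by ring,
        Real.cos_sub_two_pi]
      refine Real.cos_lt_cos_of_nonneg_of_le_pi hd0.le hle ?_
      rw [hm, hd]; linarith [hθ'.1]
    · refine Real.cos_lt_cos_of_nonneg_of_le_pi hd0.le ?_ ?_
      · rw [abs_le]; constructor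
        · linarith
        · rw [hm]; linarith [hθ'.2]
      · rw [lt_abs]; right; rw [hm, hd]; linarith [hθ'.2]
  set A0 := closedBall (0:ℂ) 1 ∩ {z | ℓ z = 0} with hA0
  have hA0c : IsCompact A0 := (isCompact_closedBall _ _).inter_right
    (isClosed_eq hℓc continuous_const)
  have hA0s : ∀ z ∈ A0, ‖z‖ = 1 → G z = q := by
    rintro z ⟨-, hz⟩ hz1
    obtain ⟨t, -, rfl⟩ := exists_cis_Ico 0 hz1
    rw [mem_ofPred_eq, hℓe, sub_eq_zero, Real.cos_eq_cos_iff] at hz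
    obtain ⟨k, hk | hk⟩ := hz
    · rw [← hβ, ← cis_int β (-k)]
      congr 2
      push_cast
      rw [hm, hd] at hk; linarith
    · rw [← hα, ← cis_int α k]
      congr 2
      rw [hm, hd] at hk; linarith
  set A := G '' A0 with hA
  have hAc : IsCompact A := hA0c.image_of_continuousOn (h.Gc.mono inter_subset_left)
  have hAE : A ∩ slitE γ ⊆ {q} := by
    rintro _ ⟨⟨z, hz, rfl⟩, hE⟩
    exact hA0s z hz (h.sphere_of_E hz.1 hE)
  have hinA : ∀ z ∈ ball (0:ℂ) 1, G z ∈ A → ℓ z = 0 := by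
    rintro z hz ⟨z', hz', he⟩
    have : z' ∈ ball (0:ℂ) 1 := by
      rcases (mem_closedBall_zero_iff.1 hz'.1).lt_or_eq with h3 | h3
      · exact mem_ball_zero_iff.2 h3
      · exact absurd (he ▸ h.GE (mem_sphere_zero_iff_norm.2 h3)) (h.VE (h.GV hz))
    rw [← h.Gi this hz he]; exact hz'.2
  have hev : ∀ᶠ s : ℝ in 𝓝 (1:ℝ), 0 < ℓ ((s:ℂ) * cis θ) ∧ ℓ ((s:ℂ) * cis θ') < 0 := by
    have c1 : Continuous fun s : ℝ => ℓ (s * cis θ) := by fun_prop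
    have c2 : Continuous fun s : ℝ => ℓ (s * cis θ') := by fun_prop
    refine ((continuous_const.tendsto _).eventually_lt (c1.tendsto 1) ?_).and
      ((c2.tendsto 1).eventually_lt (continuous_const.tendsto _) ?_)
    · simpa using hℓθ
    · simpa using hℓθ'
  obtain ⟨ε, hε, hball⟩ := Metric.eventually_nhds_iff.1 hev
  set r := max (1 - ε / 2) (1 / 2) with hr
  have hr1 : r < 1 := max_lt (by linarith) (by norm_num)
  have hr0 : 0 < r := lt_of_lt_of_le (by norm_num) (le_max_right _ _)
  have hrI : ∀ s ∈ Icc r 1, 0 < ℓ ((s:ℂ) * cis θ) ∧ ℓ ((s:ℂ) * cis θ') < 0 := by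
    intro s hs
    apply hball
    rw [Real.dist_eq, abs_lt]
    have := le_max_left (1 - ε / 2) (1 / 2)
    constructor <;> linarith [hs.1, hs.2]
  have hnorm : ∀ s ∈ Icc r 1, ∀ t, ‖(s:ℂ) * cis t‖ = s := by
    intro s hs t
    rw [norm_mul, norm_cis, mul_one, Complex.norm_real, Real.norm_eq_abs,
      abs_of_nonneg (hr0.le.trans hs.1)]
  have hJ : ∀ t, (∀ s ∈ Icc r 1, ℓ (s * cis t) ≠ 0) → G (cis t) ∈ S →
      IsPreconnected ((fun s : ℝ => G (s * cis t)) '' Icc r 1) ∧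
      (∀ x ∈ (fun s : ℝ => G (s * cis t)) '' Icc r 1, x ∉ A) := by
    intro t ht hGS
    constructor
    · refine isPreconnected_Icc.image _ (h.Gc.comp (by fun_prop) ?_)
      intro s hs
      rw [mem_closedBall_zero_iff, hnorm s hs]; exact hs.2
    · rintro _ ⟨s, hs, rfl⟩ hxA
      rcases hs.2.lt_or_eq with h3 | h3
      · exact ht s hs (hinA _ (by rw [mem_ball_zero_iff, hnorm s hs]; exact h3) hxA)
      · subst h3
        simp only [Complex.ofReal_one, one_mul] at hxA
        exact (hSE hGS).2 (hAE ⟨hxA, (hSE hGS).1⟩)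
  have hrr : r ∈ Icc r 1 := ⟨le_rfl, hr1.le⟩
  have h11 : (1:ℝ) ∈ Icc r 1 := ⟨hr1.le, le_rfl⟩
  obtain ⟨a1, a2⟩ := hJ θ (fun s hs => (hrI s hs).1.ne') h1
  obtain ⟨b1, b2⟩ := hJ θ' (fun s hs => (hrI s hs).2.ne) h2
  have hb : ∀ t, (r:ℂ) * cis t ∈ ball (0:ℂ) 1 := fun t => by
    rw [mem_ball_zero_iff, hnorm r hrr]; exact hr1
  have hwV : G (r * cis θ) ∈ slitV γ := h.GV (hb θ)
  have hwV' : G (r * cis θ') ∈ slitV γ := h.GV (hb θ')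
  have m1 : G (cis θ) ∈ (fun s : ℝ => G (s * cis θ)) '' Icc r 1 := ⟨1, h11, by simp⟩
  have m2 : G (cis θ') ∈ (fun s : ℝ => G (s * cis θ')) '' Icc r 1 := ⟨1, h11, by simp⟩
  have hun := IsPreconnected.union (G (cis θ')) (Or.inr h2) m2
    (IsPreconnected.union (G (cis θ)) m1 h1 a1 hS) b1
  obtain ⟨T, hT, hTd, hwT, hwT'⟩ := janiszewski (w := G (r * cis θ)) (w' := G (r * cis θ')) hAc
    h.s.E_compact ((subsingleton_singleton.anti hAE).isPreconnected)
    (by rintro (h3 | h3); exacts [(hrI r hrr).1.ne' (hinA _ (hb θ) h3), h.VE hwV h3])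
    (by rintro (h3 | h3); exacts [(hrI r hrr).2.ne (hinA _ (hb θ') h3), h.VE hwV' h3])
    ⟨_, hun, by
        rintro z ((hz | hz) | hz)
        · exact a2 z hz
        · intro hzA
          exact (hSE hz).2 (hAE ⟨hzA, (hSE hz).1⟩)
        · exact b2 z hz, Or.inl (Or.inl ⟨r, hrr, rfl⟩), Or.inr ⟨r, hrr, rfl⟩⟩
    ⟨slitV γ, h.s.V_connected.isPreconnected, fun z hz => h.VE hz, hwV, hwV'⟩
  have hTV : T ⊆ slitV γ := subset_V_of_pre h.s hT (fun z hz hzE => hTd z hz (Or.inr hzE)) hwT hwV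
  have hcc : ContinuousOn (fun z => ℓ (f z)) T := hℓc.comp_continuousOn (h.fc.mono hTV)
  obtain ⟨t, htT, ht⟩ := hT.intermediate_value hwT' hwT hcc (show (0:ℝ) ∈ _ from by
    rw [h.fG _ (hb θ), h.fG _ (hb θ')]
    exact ⟨(hrI r hrr).2.le, (hrI r hrr).1.le⟩)
  exact hTd t htT (Or.inl ⟨f t, ⟨ball_subset_closedBall (h.fm (hTV htT)), ht⟩, h.Gf t (hTV htT)⟩)

lemma side (h : SlitMap γ G f) {lo hi : ℝ} (hlt : lo < hi) (hle : hi ≤ lo + 2 * Real.pi)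
    (hF : (G (cis lo) = γ 0 ∧ G (cis hi) = γ 1) ∨ (G (cis lo) = γ 1 ∧ G (cis hi) = γ 0))
    {y : ℝ} (hy : y ∈ Ioo (0:ℝ) 1) :
    ∃ θ ∈ Ioo lo hi, G (cis θ) = γ y ∧ ∀ θ' ∈ Icc lo hi, G (cis θ') = γ y → θ' = θ := by
  have hyI : y ∈ Icc (0:ℝ) 1 := ⟨hy.1.le, hy.2.le⟩
  have h0I : (0:ℝ) ∈ Icc (0:ℝ) 1 := by simp
  have h1I : (1:ℝ) ∈ Icc (0:ℝ) 1 := by simp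
  have hy0 : γ 0 ≠ γ y := fun e => hy.1.ne (h.s.i h0I hyI e)
  have hy1 : γ 1 ≠ γ y := fun e => hy.2.ne' (h.s.i h1I hyI e)
  have hFlo : G (cis lo) ≠ γ y := by rcases hF with ⟨e, -⟩ | ⟨e, -⟩ <;> rw [e] <;> assumption
  have hFhi : G (cis hi) ≠ γ y := by rcases hF with ⟨-, e⟩ | ⟨-, e⟩ <;> rw [e] <;> assumption
  have hGc : Continuous fun θ => G (cis θ) := h.Gc.comp_continuous continuous_cis (fun θ => by
    rw [mem_closedBall_zero_iff, norm_cis])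
  have s1 : Icc 0 y ⊆ Icc (0:ℝ) 1 := Icc_subset_Icc le_rfl hy.2.le
  have s2 : Icc y 1 ⊆ Icc (0:ℝ) 1 := Icc_subset_Icc hy.1.le le_rfl
  -- the two halves
  have hEsub : slitE γ ⊆ γ '' Icc 0 y ∪ (sphere 0 1 ∪ γ '' Icc y 1) := by
    rintro z (hz | ⟨t, ht, rfl⟩)
    · exact Or.inr (Or.inl hz)
    · rcases le_total t y with h1 | h1
      · exact Or.inl ⟨t, ⟨ht.1, h1⟩, rfl⟩
      · exact Or.inr (Or.inr ⟨t, ⟨h1, ht.2⟩, rfl⟩)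
  have hdis : ∀ z ∈ γ '' Icc 0 y, z ∈ sphere (0:ℂ) 1 ∪ γ '' Icc y 1 → z = γ y := by
    rintro _ ⟨t, ht, rfl⟩ (h1 | ⟨t', ht', he⟩)
    · exact absurd (mem_sphere_zero_iff_norm.1 h1) (h.s.d t ⟨ht.1, lt_of_le_of_lt ht.2 hy.2⟩).ne
    · have := h.s.i (s2 ht') (s1 ht) he
      rw [show t = y from le_antisymm ht.2 (this ▸ ht'.1)]
  have hmem : ∀ T : Set ℂ, IsPreconnected T → T ⊆ slitE γ → γ 0 ∈ T → γ 1 ∈ T → γ y ∈ T := by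
    intro T hT hTE h0 h1
    obtain ⟨z, hzT, hz1, hz2⟩ := isPreconnected_closed_iff.1 hT _ _
      (isCompact_Icc.image_of_continuousOn (h.s.c.mono s1)).isClosed
      (isClosed_sphere.union (isCompact_Icc.image_of_continuousOn (h.s.c.mono s2)).isClosed)
      (hTE.trans hEsub) ⟨γ 0, h0, 0, ⟨le_rfl, hy.1.le⟩, rfl⟩
      ⟨γ 1, h1, Or.inr ⟨1, ⟨hy.2.le, le_rfl⟩, rfl⟩⟩
    rw [← hdis z hz1 hz2]; exact hzT
  have hex : ∃ θ ∈ Ioo lo hi, G (cis θ) = γ y := by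
    have hT : IsPreconnected ((fun θ => G (cis θ)) '' Icc lo hi) :=
      isPreconnected_Icc.image _ hGc.continuousOn
    obtain ⟨θ, hθ, he⟩ := hmem _ hT (by rintro _ ⟨θ, -, rfl⟩; exact h.GcisE θ)
      (by
        rcases hF with ⟨e, -⟩ | ⟨-, e⟩
        exacts [⟨lo, ⟨le_rfl, hlt.le⟩, e⟩, ⟨hi, ⟨hlt.le, le_rfl⟩, e⟩])
      (by
        rcases hF with ⟨-, e⟩ | ⟨e, -⟩
        exacts [⟨hi, ⟨hlt.le, le_rfl⟩, e⟩, ⟨lo, ⟨le_rfl, hlt.le⟩, e⟩])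
    refine ⟨θ, ⟨lt_of_le_of_ne hθ.1 ?_, lt_of_le_of_ne hθ.2 ?_⟩, he⟩
    · rintro rfl; exact hFlo he
    · rintro rfl; exact hFhi he
  have huniq : ∀ α ∈ Icc lo hi, ∀ β ∈ Icc lo hi, G (cis α) = γ y → G (cis β) = γ y → ¬ α < β := by
    intro α hα β hβ hGα hGβ hαβ
    have hlα : lo < α := lt_of_le_of_ne hα.1 (by rintro rfl; exact hFlo hGα)
    have hβh : β < hi := lt_of_le_of_ne hβ.2 (by rintro rfl; exact hFhi hGβ)
    obtain ⟨θ, hθ, hne⟩ := h.nonconst (h.GcisE α) hαβ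
    rw [hGα] at hne
    have hends : (∃ θ' ∈ Ioo β (α + 2 * Real.pi), G (cis θ') = γ 0) ∧
        ∃ θ' ∈ Ioo β (α + 2 * Real.pi), G (cis θ') = γ 1 := by
      have i1 : hi ∈ Ioo β (α + 2 * Real.pi) := ⟨hβh, by linarith⟩
      have i2 : lo + 2 * Real.pi ∈ Ioo β (α + 2 * Real.pi) := ⟨by linarith, by linarith⟩
      have e2 := cis_two_pi lo
      rcases hF with ⟨e, e'⟩ | ⟨e, e'⟩
      · exact ⟨⟨_, i2, by rw [e2, e]⟩, ⟨_, i1, e'⟩⟩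
      · exact ⟨⟨_, i1, e'⟩, ⟨_, i2, by rw [e2, e]⟩⟩
    obtain ⟨⟨θ0, hθ0, hG0⟩, ⟨θ1, hθ1, hG1⟩⟩ := hends
    have t1 : Ico 0 y ⊆ Icc (0:ℝ) 1 := fun t ht => ⟨ht.1, ht.2.le.trans hy.2.le⟩
    have t2 : Ioc y 1 ⊆ Icc (0:ℝ) 1 := fun t ht => ⟨hy.1.le.trans ht.1.le, ht.2⟩
    rcases hEsub (h.GcisE θ) with ⟨t, ht, he⟩ | hz
    · refine h.sep hGα hGβ hαβ (by linarith) hθ hθ0 (S := γ '' Ico 0 y)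
        (isPreconnected_Ico.image _ (h.s.c.mono t1)) ?_ ⟨t, ⟨ht.1, lt_of_le_of_ne ht.2 ?_⟩, he⟩
        (hG0 ▸ ⟨0, ⟨le_rfl, hy.1⟩, rfl⟩)
      · rintro _ ⟨s, hs, rfl⟩
        exact ⟨Or.inr ⟨s, t1 hs, rfl⟩, fun e => hs.2.ne (h.s.i (t1 hs) hyI e)⟩
      · rintro rfl; exact hne he.symm
    · refine h.sep hGα hGβ hαβ (by linarith) hθ hθ1 (S := sphere 0 1 ∪ γ '' Ioc y 1)
        (IsPreconnected.union (γ 1) (by simp [h.s.e]) ⟨1, ⟨hy.2, le_rfl⟩, rfl⟩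
          (isPreconnected_circle 1) (isPreconnected_Ioc.image _ (h.s.c.mono t2))) ?_ ?_
        (hG1 ▸ Or.inr ⟨1, ⟨hy.2, le_rfl⟩, rfl⟩)
      · rintro _ (hs | ⟨s, hs, rfl⟩)
        · refine ⟨Or.inl hs, fun e => ?_⟩
          rw [mem_singleton_iff.1 e, mem_sphere_zero_iff_norm] at hs
          exact (h.s.d y ⟨hy.1.le, hy.2⟩).ne hs
        · exact ⟨Or.inr ⟨s, t2 hs, rfl⟩, fun e => hs.1.ne' (h.s.i (t2 hs) hyI e)⟩
      · rcases hz with hz | ⟨t, ht, he⟩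
        · exact Or.inl hz
        · refine Or.inr ⟨t, ⟨lt_of_le_of_ne ht.1 ?_, ht.2⟩, he⟩
          rintro rfl; exact hne he.symm
  obtain ⟨θ, hθ, he⟩ := hex
  refine ⟨θ, hθ, he, fun θ' hθ' he' => ?_⟩
  have hθI : θ ∈ Icc lo hi := ⟨hθ.1.le, hθ.2.le⟩
  exact le_antisymm (not_lt.1 (huniq θ hθI θ' hθ' he he')) (not_lt.1 (huniq θ' hθ' θ hθI he' he))

end SlitMap
end Part8

section Part9
namespace SlitMap
variable {γ : ℝ → ℂ} {G f : ℂ → ℂ}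

lemma near_arc (hs : IsSlit γ) {y δ : ℝ} (hy : y ∈ Ioo (0:ℝ) 1) (hδ : 0 < δ) :
    ∀ᶠ q in 𝓝 (γ y), q ∈ slitE γ → ∃ y' ∈ Ioo (0:ℝ) 1, |y' - y| < δ ∧ γ y' = q := by
  have hyI : y ∈ Icc (0:ℝ) 1 := ⟨hy.1.le, hy.2.le⟩
  set O := ball y δ ∩ Ioo (0:ℝ) 1 with hO
  have hOo : IsOpen O := isOpen_ball.inter isOpen_Ioo
  have hK : IsCompact (sphere (0:ℂ) 1 ∪ γ '' (Icc 0 1 \ O)) :=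
    (isCompact_sphere _ _).union ((isCompact_Icc.diff hOo).image_of_continuousOn
      (hs.c.mono sdiff_subset))
  have hn : γ y ∉ sphere (0:ℂ) 1 ∪ γ '' (Icc 0 1 \ O) := by
    rintro (h1 | ⟨t, ⟨ht, htO⟩, he⟩)
    · exact (hs.d y ⟨hy.1.le, hy.2⟩).ne (mem_sphere_zero_iff_norm.1 h1)
    · rw [hs.i ht hyI he] at htO
      exact htO ⟨mem_ball_self hδ, hy⟩
  filter_upwards [hK.isClosed.isOpen_compl.mem_nhds hn] with q hq hqE
  rcases hqE with h1 | ⟨t, ht, rfl⟩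
  · exact absurd (Or.inl h1) hq
  · by_cases htO : t ∈ O
    · exact ⟨t, htO.2, by simpa [Real.dist_eq] using htO.1, rfl⟩
    · exact absurd (Or.inr ⟨t, ⟨ht, htO⟩, rfl⟩) hq

lemma continuous_Gcis (h : SlitMap γ G f) : Continuous fun θ => G (cis θ) :=
  h.Gc.comp_continuous continuous_cis (fun θ => by rw [mem_closedBall_zero_iff, norm_cis])

structure Half (γ : ℝ → ℂ) (G : ℂ → ℂ) (lo hi : ℝ) (k : ℝ → ℝ) : Prop where
  m : ∀ y ∈ Ioo (0:ℝ) 1, k y ∈ Ioo lo hi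
  g : ∀ y ∈ Ioo (0:ℝ) 1, G (cis (k y)) = γ y
  u : ∀ y ∈ Ioo (0:ℝ) 1, ∀ θ ∈ Icc lo hi, G (cis θ) = γ y → θ = k y

lemma half_cont (h : SlitMap γ G f) {lo hi : ℝ} {k : ℝ → ℝ} (hk : Half γ G lo hi k) :
    ContinuousOn k (Ioo 0 1) := by
  intro y hy
  refine tendsto_of_unique (isCompact_Icc (a := lo) (b := hi)) h.continuous_Gcis.continuousOn
    (q := γ y) (fun x' hx' e => hk.u y hy x' hx' e) ?_ ?_
  · filter_upwards [self_mem_nhdsWithin] with y' hy'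
    exact Ioo_subset_Icc_self (hk.m y' hy')
  · have : Filter.Tendsto γ (𝓝[Ioo 0 1] y) (𝓝 (γ y)) :=
      (h.s.c y (Ioo_subset_Icc_self hy)).mono_left (nhdsWithin_mono _ Ioo_subset_Icc_self)
    refine this.congr' ?_
    filter_upwards [self_mem_nhdsWithin] with y' hy'
    exact (hk.g y' hy').symm

def pol (x θ : ℝ) : ℂ := (Real.exp (-x) : ℝ) * cis θ

lemma norm_pol (x θ : ℝ) : ‖pol x θ‖ = Real.exp (-x) := by
  rw [pol, norm_mul, norm_cis, mul_one, Complex.norm_real, Real.norm_eq_abs, abs_of_pos (Real.exp_pos _)]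

lemma pol_zero (θ : ℝ) : pol 0 θ = cis θ := by simp [pol]

lemma pol_eq (x θ : ℝ) : pol x θ = Complex.exp (-x + θ * Complex.I) := by
  rw [pol, cis, Complex.exp_add]; push_cast; rfl

lemma pol_mem {x : ℝ} (hx : 0 ≤ x) (θ : ℝ) : pol x θ ∈ closedBall (0:ℂ) 1 := by
  rw [mem_closedBall_zero_iff, norm_pol, Real.exp_le_one_iff]; linarith

lemma pol_mem' {x : ℝ} (hx : 0 < x) (θ : ℝ) : pol x θ ∈ ball (0:ℂ) 1 := by
  rw [mem_ball_zero_iff, norm_pol, Real.exp_lt_one_iff]; linarith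

lemma pol_inj {x x' θ θ' : ℝ} (he : pol x θ = pol x' θ') : x = x' ∧ cis θ = cis θ' := by
  have h1 := congrArg norm he
  rw [norm_pol, norm_pol] at h1
  have h2 : x = x' := by have := Real.exp_injective h1; linarith
  subst h2
  refine ⟨rfl, ?_⟩
  have : ((Real.exp (-x) : ℝ) : ℂ) ≠ 0 := by exact_mod_cast (Real.exp_pos _).ne'
  exact mul_left_cancel₀ this he

lemma half_local (h : SlitMap γ G f) {lo hi : ℝ} {k : ℝ → ℝ} (hk : Half γ G lo hi k)
    {x y δ : ℝ} (hy : y ∈ Ioo (0:ℝ) 1) (hδ : 0 < δ) :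
    ∀ᶠ z in 𝓝[closedBall 0 1] (pol x (k y)), ∃ x' y', 0 ≤ x' ∧ |x' - x| < δ ∧
      y' ∈ Ioo (0:ℝ) 1 ∧ |y' - y| < δ ∧ z = pol x' (k y') := by
  set z0 := pol x (k y) with hz0
  have hz00 : z0 ≠ 0 := by rw [hz0, pol_eq]; exact Complex.exp_ne_zero _
  set L : ℂ → ℂ := fun z => Complex.log (z / z0) with hL
  have hLc : ContinuousAt L z0 := by
    refine ContinuousAt.clog (by fun_prop) ?_
    rw [div_self hz00]; exact Complex.one_mem_slitPlane
  have hL0 : L z0 = 0 := by simp [hL, div_self hz00]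
  have hre : Filter.Tendsto (fun z => x - (L z).re) (𝓝 z0) (𝓝 x) := by
    have : ContinuousAt (fun z => x - (L z).re) z0 :=
      continuousAt_const.sub (Complex.continuous_re.continuousAt.comp hLc)
    simpa [ContinuousAt, hL0] using this
  have him : Filter.Tendsto (fun z => k y + (L z).im) (𝓝 z0) (𝓝 (k y)) := by
    have : ContinuousAt (fun z => k y + (L z).im) z0 :=
      continuousAt_const.add (Complex.continuous_im.continuousAt.comp hLc)
    simpa [ContinuousAt, hL0] using this
  have hF : Filter.Tendsto (fun z => G (cis (k y + (L z).im))) (𝓝 z0) (𝓝 (γ y)) := by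
    have := (h.continuous_Gcis.tendsto (k y)).comp him
    rwa [hk.g y hy] at this
  have e1 := hF.eventually (near_arc h.s hy hδ)
  have e2 := him.eventually (isOpen_Ioo.mem_nhds (hk.m y hy))
  have e3 := hre.eventually (ball_mem_nhds x hδ)
  have e4 : ∀ᶠ z in 𝓝 z0, z ≠ 0 := isOpen_ne.mem_nhds hz00
  filter_upwards [mem_nhdsWithin_of_mem_nhds e1, mem_nhdsWithin_of_mem_nhds e2,
    mem_nhdsWithin_of_mem_nhds e3, mem_nhdsWithin_of_mem_nhds e4, self_mem_nhdsWithin]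
    with z q1 q2 q3 q4 q5
  obtain ⟨y', hy', hyy, hγ⟩ := q1 (h.GcisE _)
  have hky : k y + (L z).im = k y' := hk.u y' hy' _ (Ioo_subset_Icc_self q2) hγ.symm
  have hz : z = pol (x - (L z).re) (k y') := by
    have : z = z0 * Complex.exp (L z) := by
      simp only [hL]
      rw [Complex.exp_log (div_ne_zero q4 hz00), mul_div_cancel₀ _ hz00]
    rw [← hky]
    conv_lhs => rw [this, hz0, pol_eq, ← Complex.exp_add]
    rw [pol_eq]
    congr 1
    conv_lhs => rw [← Complex.re_add_im (L z)]
    push_cast; ring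
  refine ⟨x - (L z).re, y', ?_, by simpa [Real.dist_eq] using q3, hy', hyy, hz⟩
  have hz' : z ∈ closedBall (0:ℂ) 1 := q5
  rw [mem_closedBall_zero_iff, hz, norm_pol, Real.exp_le_one_iff] at hz'
  linarith

def strip : Set ℂ := {z | z.im ∈ Ioo (0:ℝ) 1}

lemma isOpen_strip : IsOpen strip := isOpen_Ioo.preimage Complex.continuous_im

theorem exists_chart (h : SlitMap γ G f) : ∃ e : OpenPartialHomeomorph ℂ ℂ, e.source = strip ∧
    e.target ⊆ ball 0 1 ∧
    (∀ y ∈ Ioo (0:ℝ) 1, e (y * Complex.I) = γ y) ∧ ∀ z ∈ strip, e z ∈ γ '' Icc 0 1 → z.re = 0 := by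
  have hpi := Real.pi_pos
  have hE0 : γ 0 ∈ slitE γ := Or.inr ⟨0, by simp, rfl⟩
  have hE1 : γ 1 ∈ slitE γ := Or.inr ⟨1, by simp, rfl⟩
  obtain ⟨u0, hu0, hGu0⟩ := h.surj (q := γ 0) (by rw [mem_closedBall_zero_iff]; exact h.s.le (by simp))
  obtain ⟨u1, hu1, hGu1⟩ := h.surj (q := γ 1) (by rw [mem_closedBall_zero_iff]; exact h.s.le (by simp))
  obtain ⟨θ0, -, rfl⟩ := exists_cis_Ico 0 (h.sphere_of_E hu0 (hGu0 ▸ hE0))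
  obtain ⟨θ1, hθ1, rfl⟩ := exists_cis_Ico θ0 (h.sphere_of_E hu1 (hGu1 ▸ hE1))
  have hlt : θ0 < θ1 := lt_of_le_of_ne hθ1.1 (by
    rintro rfl
    have := h.s.i (by simp) (by simp) (hGu0.symm.trans hGu1)
    norm_num at this)
  have hθe : G (cis (θ0 + 2 * Real.pi)) = γ 0 := by rw [cis_two_pi, hGu0]
  choose! k1 k1m k1G k1u using fun y (hy : y ∈ Ioo (0:ℝ) 1) =>
    h.side hlt hθ1.2.le (Or.inl ⟨hGu0, hGu1⟩) hy
  choose! k2 k2m k2G k2u using fun y (hy : y ∈ Ioo (0:ℝ) 1) =>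
    h.side hθ1.2 (by linarith) (Or.inr ⟨hGu1, hθe⟩) hy
  have H1 : Half γ G θ0 θ1 k1 := ⟨k1m, k1G, k1u⟩
  have H2 : Half γ G θ1 (θ0 + 2 * Real.pi) k2 := ⟨k2m, k2G, k2u⟩
  set Φ : ℂ → ℂ := fun z => if 0 ≤ z.re then G (pol z.re (k1 z.im)) else G (pol (-z.re) (k2 z.im))
    with hΦ
  have Φ1 : ∀ z : ℂ, 0 ≤ z.re → Φ z = G (pol z.re (k1 z.im)) := fun z hz => by
    simp only [hΦ, if_pos hz]
  have Φ2 : ∀ z ∈ strip, z.re ≤ 0 → Φ z = G (pol (-z.re) (k2 z.im)) := fun z hz hz' => by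
    by_cases h0 : z.re = 0
    · rw [Φ1 z h0.ge, h0, neg_zero, pol_zero, pol_zero, k1G _ hz, k2G _ hz]
    · simp only [hΦ, if_neg (not_le.2 (lt_of_le_of_ne hz' h0))]
  have Φ0 : ∀ z ∈ strip, z.re = 0 → Φ z = γ z.im := fun z hz hz' => by
    rw [Φ1 z hz'.ge, hz', pol_zero, k1G _ hz]
  have ΦV : ∀ z ∈ strip, z.re ≠ 0 → Φ z ∈ slitV γ := fun z hz hz' => by
    rcases lt_or_gt_of_ne hz' with h0 | h0
    · rw [Φ2 z hz h0.le]; exact h.GV (pol_mem' (by linarith) _)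
    · rw [Φ1 z h0.le]; exact h.GV (pol_mem' h0 _)
  have Φball : ∀ z ∈ strip, Φ z ∈ ball (0:ℂ) 1 := fun z hz => by
    by_cases h0 : z.re = 0
    · rw [Φ0 z hz h0, mem_ball_zero_iff]; exact h.s.d _ ⟨hz.1.le, hz.2⟩
    · exact (ΦV z hz h0).1
  have ΦE : ∀ z ∈ strip, Φ z ∈ slitE γ → z.re = 0 := fun z hz hE => by
    by_contra h0; exact h.VE (ΦV z hz h0) hE
  have k12 : ∀ y ∈ Ioo (0:ℝ) 1, ∀ y' ∈ Ioo (0:ℝ) 1, cis (k1 y) ≠ cis (k2 y') := by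
    intro y hy y' hy' he
    obtain ⟨n, hn⟩ := cis_eq_iff.1 he
    have a1 := k1m y hy
    have a2 := k2m y' hy'
    have b1 : (n:ℝ) < 0 := by
      by_contra hc
      nlinarith [a1.1, a1.2, a2.1, a2.2]
    have b2 : (-1:ℝ) < n := by
      by_contra hc
      nlinarith [a1.1, a1.2, a2.1, a2.2]
    have c1 : n < 0 := by exact_mod_cast b1
    have c2 : -1 < n := by exact_mod_cast b2
    omega
  have Φinj : InjOn Φ strip := by
    intro z hz z' hz' he
    by_cases h0 : z.re = 0
    · have h0' : z'.re = 0 := ΦE z' hz' (by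
        rw [← he, Φ0 z hz h0]; exact Or.inr ⟨_, Ioo_subset_Icc_self hz, rfl⟩)
      rw [Φ0 z hz h0, Φ0 z' hz' h0'] at he
      exact Complex.ext (h0.trans h0'.symm)
        (h.s.i (Ioo_subset_Icc_self hz) (Ioo_subset_Icc_self hz') he)
    · have h0' : z'.re ≠ 0 := fun h0' => h0 (ΦE z hz (by
        rw [he, Φ0 z' hz' h0']; exact Or.inr ⟨_, Ioo_subset_Icc_self hz', rfl⟩))
      rcases lt_or_gt_of_ne h0 with a | a <;> rcases lt_or_gt_of_ne h0' with b | b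
      · rw [Φ2 z hz a.le, Φ2 z' hz' b.le] at he
        obtain ⟨e1, e2⟩ := pol_inj (h.Gi (pol_mem' (by linarith) _) (pol_mem' (by linarith) _) he)
        have e3 := congrArg G e2
        rw [k2G _ hz, k2G _ hz'] at e3
        exact Complex.ext (by linarith)
          (h.s.i (Ioo_subset_Icc_self hz) (Ioo_subset_Icc_self hz') e3)
      · rw [Φ2 z hz a.le, Φ1 z' b.le] at he
        obtain ⟨e1, e2⟩ := pol_inj (h.Gi (pol_mem' (by linarith) _) (pol_mem' (by linarith) _) he)
        exact absurd e2.symm (k12 _ hz' _ hz)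
      · rw [Φ1 z a.le, Φ2 z' hz' b.le] at he
        obtain ⟨e1, e2⟩ := pol_inj (h.Gi (pol_mem' (by linarith) _) (pol_mem' (by linarith) _) he)
        exact absurd e2 (k12 _ hz _ hz')
      · rw [Φ1 z a.le, Φ1 z' b.le] at he
        obtain ⟨e1, e2⟩ := pol_inj (h.Gi (pol_mem' (by linarith) _) (pol_mem' (by linarith) _) he)
        have e3 := congrArg G e2
        rw [k1G _ hz, k1G _ hz'] at e3
        exact Complex.ext (by linarith)
          (h.s.i (Ioo_subset_Icc_self hz) (Ioo_subset_Icc_self hz') e3)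
  have Φc : ContinuousOn Φ strip := by
    have polc : ∀ (k : ℝ → ℝ) (hk : ContinuousOn k (Ioo 0 1)) (s : ℝ),
        ContinuousOn (fun z : ℂ => pol (s * z.re) (k z.im)) strip := by
      intro k hk s
      have hkc : ContinuousOn (fun z : ℂ => k z.im) strip :=
        hk.comp Complex.continuous_im.continuousOn (fun z hz => hz)
      have : ContinuousOn (fun z : ℂ => cis (k z.im)) strip := continuous_cis.comp_continuousOn hkc
      simp only [pol]
      refine ContinuousOn.mul (Continuous.continuousOn ?_) this
      have := Complex.continuous_re
      fun_prop
    have c1 : ContinuousOn Φ (strip ∩ {z | 0 ≤ z.re}) := by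
      have : ContinuousOn (fun z : ℂ => G (pol (1 * z.re) (k1 z.im))) (strip ∩ {z | 0 ≤ z.re}) :=
        h.Gc.comp ((polc k1 (h.half_cont H1) 1).mono inter_subset_left)
          (fun z hz => pol_mem (by rw [one_mul]; exact hz.2) _)
      refine this.congr fun z hz => ?_
      simp only [Φ1 z hz.2, one_mul]
    have c2 : ContinuousOn Φ (strip ∩ {z | z.re ≤ 0}) := by
      have : ContinuousOn (fun z : ℂ => G (pol (-1 * z.re) (k2 z.im))) (strip ∩ {z | z.re ≤ 0}) :=
        h.Gc.comp ((polc k2 (h.half_cont H2) (-1)).mono inter_subset_left)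
          (fun z hz => pol_mem (by
            have : z.re ≤ 0 := hz.2
            linarith) _)
      refine this.congr fun z hz => ?_
      simp only [Φ2 z hz.1 hz.2, neg_one_mul]
    intro z hz
    have hu : strip = (strip ∩ {z | 0 ≤ z.re}) ∪ (strip ∩ {z | z.re ≤ 0}) := by
      rw [← inter_union_distrib_left, eq_comm, inter_eq_left]
      intro w _
      exact le_total (0:ℝ) w.re
    have hcl : ∀ (A : Set ℂ), IsClosed A → ContinuousOn Φ (strip ∩ A) →
        ContinuousWithinAt Φ (strip ∩ A) z := by
      intro A hA hc
      by_cases hzA : z ∈ A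
      · exact hc z ⟨hz, hzA⟩
      · refine continuousWithinAt_of_notMem_closure ?_
        intro hcl
        exact hzA (hA.closure_subset (closure_mono inter_subset_right hcl))
    rw [hu]
    exact (hcl _ (isClosed_le continuous_const Complex.continuous_re) c1).union
      (hcl _ (isClosed_le Complex.continuous_re continuous_const) c2)
  have Φo : ∀ z ∈ strip, ∀ N ∈ 𝓝 z, Φ '' (N ∩ strip) ∈ 𝓝 (Φ z) := by
    intro z hz N hN
    obtain ⟨δ, hδ, hδN⟩ : ∃ δ > 0, ∀ z' : ℂ, |z'.re - z.re| < δ → |z'.im - z.im| < δ → z' ∈ N := by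
      obtain ⟨ε, hε, hb⟩ := Metric.mem_nhds_iff.1 hN
      refine ⟨ε / 2, half_pos hε, fun z' h1 h2 => hb ?_⟩
      rw [mem_ball, dist_eq_norm]
      refine lt_of_le_of_lt (Complex.norm_le_abs_re_add_abs_im _) ?_
      rw [Complex.sub_re, Complex.sub_im]; linarith
    have key : ∀ᶠ w' in 𝓝 (Φ z), ∀ u ∈ closedBall (0:ℂ) 1, G u = w' → G u ∈ Φ '' (N ∩ strip) := by
      refine tube (isCompact_closedBall (0:ℂ) 1) h.Gc (P := fun u => G u ∈ Φ '' (N ∩ strip)) ?_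
      have p1 : 0 ≤ z.re → ∀ᶠ u in 𝓝[closedBall 0 1] (pol z.re (k1 z.im)),
          G u ∈ Φ '' (N ∩ strip) := by
        intro hx
        filter_upwards [h.half_local H1 (x := z.re) hz hδ] with u ⟨x', y', a, b, c, d, e⟩
        exact ⟨⟨x', y'⟩, ⟨hδN _ b d, c⟩, by rw [Φ1 _ a, e]⟩
      have p2 : z.re ≤ 0 → ∀ᶠ u in 𝓝[closedBall 0 1] (pol (-z.re) (k2 z.im)),
          G u ∈ Φ '' (N ∩ strip) := by
        intro hx
        filter_upwards [h.half_local H2 (x := -z.re) hz hδ] with u ⟨x', y', a, b, c, d, e⟩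
        refine ⟨⟨-x', y'⟩, ⟨hδN _ ?_ d, c⟩, by rw [Φ2 _ c (by simpa using a), e]; simp⟩
        rw [← abs_neg]
        convert b using 2
        simp; ring
      intro u hu hGu
      rcases lt_trichotomy z.re 0 with h0 | h0 | h0
      · have hu' : u = pol (-z.re) (k2 z.im) := by
          have hub : u ∈ ball (0:ℂ) 1 := by
            rcases (mem_closedBall_zero_iff.1 hu).lt_or_eq with h1 | h1
            · exact mem_ball_zero_iff.2 h1
            · exact absurd (hGu ▸ h.GE (mem_sphere_zero_iff_norm.2 h1)) (h.VE (ΦV z hz h0.ne))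
          rw [Φ2 z hz h0.le] at hGu
          exact h.Gi hub (pol_mem' (by linarith) _) hGu
        rw [hu']; exact p2 h0.le
      · rw [Φ0 z hz h0] at hGu
        have hu1 := h.sphere_of_E hu (hGu ▸ Or.inr ⟨_, Ioo_subset_Icc_self hz, rfl⟩)
        obtain ⟨θ, hθ, rfl⟩ := exists_cis_Ico θ0 hu1
        rcases le_total θ θ1 with hle | hle
        · have := k1u _ hz θ ⟨hθ.1, hle⟩ hGu
          have q := p1 h0.ge
          rwa [h0, pol_zero, ← this] at q
        · have := k2u _ hz θ ⟨hle, hθ.2.le⟩ hGu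
          have q := p2 h0.le
          rwa [h0, neg_zero, pol_zero, ← this] at q
      · have hu' : u = pol (z.re) (k1 z.im) := by
          have hub : u ∈ ball (0:ℂ) 1 := by
            rcases (mem_closedBall_zero_iff.1 hu).lt_or_eq with h1 | h1
            · exact mem_ball_zero_iff.2 h1
            · exact absurd (hGu ▸ h.GE (mem_sphere_zero_iff_norm.2 h1)) (h.VE (ΦV z hz h0.ne'))
          rw [Φ1 z h0.le] at hGu
          exact h.Gi hub (pol_mem' (by linarith) _) hGu
        rw [hu']; exact p1 h0.le
    filter_upwards [key, isOpen_ball.mem_nhds (Φball z hz)] with w' h1 h2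
    obtain ⟨u, hu, rfl⟩ := h.surj (ball_subset_closedBall h2)
    exact h1 u hu rfl
  set pe : PartialEquiv ℂ ℂ := InjOn.toPartialEquiv Φ strip Φinj with hpe
  have hsrc : pe.source = strip := rfl
  have hcoe : (pe : ℂ → ℂ) = Φ := rfl
  refine ⟨OpenPartialHomeomorph.ofContinuousOpenRestrict pe Φc ?_ isOpen_strip, rfl, ?_, ?_, ?_⟩
  · rw [isOpenMap_iff_nhds_le]
    rintro ⟨z, hz⟩ S hS
    rw [Filter.mem_map] at hS
    obtain ⟨N, hN, hNS⟩ := mem_nhds_subtype _ _ _ |>.1 hS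
    refine Filter.mem_of_superset (Φo z hz N hN) ?_
    rintro _ ⟨z', ⟨h1, h2⟩, rfl⟩
    exact hNS (show (⟨z', h2⟩ : strip) ∈ _ from h1)
  · show Φ '' strip ⊆ _
    rintro _ ⟨z, hz, rfl⟩
    exact Φball z hz
  · intro y hy
    show Φ _ = _
    rw [Φ0 _ (by simpa [strip] using hy) (by simp)]
    simp
  · intro z hz he
    exact ΦE z hz (Or.inr he)

end SlitMap
end Part9

section Part10
lemma first_hit {X : Type*} [TopologicalSpace X] {c : ℝ → X} {a b : ℝ} (hab : a ≤ b)
    (hc : ContinuousOn c (Icc a b)) {C : Set X} (hC : IsClosed C) (hb : c b ∈ C) :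
    ∃ T ∈ Icc a b, c T ∈ C ∧ ∀ t ∈ Ico a T, c t ∉ C := by
  have h1 : IsCompact (Icc a b ∩ c ⁻¹' C) :=
    isCompact_Icc.of_isClosed_subset (hc.preimage_isClosed_of_isClosed isClosed_Icc hC) inter_subset_left
  obtain ⟨T, hT, hmin⟩ := h1.exists_isLeast ⟨b, ⟨hab, le_rfl⟩, hb⟩
  refine ⟨T, hT.1, hT.2, fun t ht htC => ?_⟩
  exact absurd (hmin ⟨⟨ht.1, ht.2.le.trans hT.1.2⟩, htC⟩) (not_le.2 ht.2)

lemma last_hit {X : Type*} [TopologicalSpace X] {c : ℝ → X} {a b : ℝ} (hab : a ≤ b)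
    (hc : ContinuousOn c (Icc a b)) {C : Set X} (hC : IsClosed C) (ha : c a ∈ C) :
    ∃ T ∈ Icc a b, c T ∈ C ∧ ∀ t ∈ Ioc T b, c t ∉ C := by
  have h1 : IsCompact (Icc a b ∩ c ⁻¹' C) :=
    isCompact_Icc.of_isClosed_subset (hc.preimage_isClosed_of_isClosed isClosed_Icc hC) inter_subset_left
  obtain ⟨T, hT, hmax⟩ := h1.exists_isGreatest ⟨a, ⟨le_rfl, hab⟩, ha⟩
  refine ⟨T, hT.1, hT.2, fun t ht htC => ?_⟩
  exact absurd (hmax ⟨⟨hT.1.1.trans ht.1.le, ht.2⟩, htC⟩) (not_le.2 ht.1)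

theorem planar_flat {γ : ℝ → ℂ} {a b t₀ : ℝ} (hc : ContinuousOn γ (Icc a b))
    (hi : InjOn γ (Icc a b)) (ht : t₀ ∈ Ioo a b) :
    ∃ e : OpenPartialHomeomorph ℂ ℂ, γ t₀ ∈ e.source ∧ e (γ t₀) = 0 ∧
      ∀ z ∈ e.source, z ∈ γ '' Icc a b ↔ (e z).re = 0 := by
  have htI : t₀ ∈ Icc a b := Ioo_subset_Icc_self ht
  have hbI : b ∈ Icc a b := ⟨(ht.1.trans ht.2).le, le_rfl⟩
  set p := γ t₀ with hp
  have hd : 0 < dist (γ b) p := dist_pos.2 fun h => ht.2.ne' (hi hbI htI h)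
  set R := dist (γ b) p / 2 with hR
  have hR0 : 0 < R := half_pos hd
  have hdc : ContinuousOn (fun t => dist (γ t) p) (Icc a b) := by fun_prop
  have s1 : Icc t₀ b ⊆ Icc a b := Icc_subset_Icc ht.1.le le_rfl
  obtain ⟨T, hT, hTC, hTmin⟩ := first_hit ht.2.le (hdc.mono s1) (isClosed_Ici (a := R))
    (show dist (γ b) p ∈ Ici R by rw [mem_Ici]; linarith)
  have htT : t₀ < T := by
    refine lt_of_le_of_ne hT.1 ?_
    rintro rfl
    simp only [mem_Ici, hp, dist_self] at hTC
    linarith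
  have hTR : dist (γ T) p = R := by
    refine le_antisymm ?_ hTC
    have hcl : T ∈ closure (Ico t₀ T) := by
      rw [closure_Ico htT.ne]; exact ⟨htT.le, le_rfl⟩
    have s2 : Ico t₀ T ⊆ Icc a b := fun t h => ⟨ht.1.le.trans h.1, h.2.le.trans hT.2⟩
    have h1 : ContinuousWithinAt (fun t => dist (γ t) p) (Ico t₀ T) T := (hdc T (s1 hT)).mono s2
    have := h1.mem_closure hcl (t := Iic R) (fun t ht => by
      have := hTmin t ht
      simp only [mem_Ici, not_le] at this
      exact this.le)
    rwa [closure_Iic] at this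
  obtain ⟨s, hs, hst⟩ : ∃ s ∈ Ioo a t₀, ∀ t ∈ Icc s t₀, dist (γ t) p < R := by
    have h1 : ContinuousAt (fun t => dist (γ t) p) t₀ := hdc.continuousAt (Icc_mem_nhds ht.1 ht.2)
    have h2 : ∀ᶠ t in 𝓝 t₀, dist (γ t) p < R :=
      h1.eventually_lt continuousAt_const (by simpa [hp] using hR0)
    obtain ⟨ε, hε, hb⟩ := Metric.eventually_nhds_iff.1 h2
    refine ⟨max (t₀ - ε / 2) ((a + t₀) / 2), ⟨?_, max_lt (by linarith) (by linarith [ht.1])⟩, ?_⟩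
    · exact lt_of_lt_of_le (by linarith [ht.1]) (le_max_right _ _)
    · intro t htt
      apply hb
      have := (le_max_left (t₀ - ε / 2) ((a + t₀) / 2)).trans htt.1
      rw [Real.dist_eq, abs_lt]
      constructor <;> linarith [htt.2]
  have hsT : 0 < T - s := by linarith [hs.2]
  set δ : ℝ → ℂ := fun t => (γ (s + t * (T - s)) - p) / R with hδ
  have hm : MapsTo (fun t : ℝ => s + t * (T - s)) (Icc 0 1) (Icc a b) := by
    intro t h
    constructor
    · nlinarith [h.1, hs.1]
    · nlinarith [h.2, hT.2]
  have hRC : (R:ℂ) ≠ 0 := by exact_mod_cast hR0.ne'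
  have hnorm : ∀ t, ‖δ t‖ = dist (γ (s + t * (T - s))) p / R := by
    intro t
    simp only [hδ]
    rw [norm_div, Complex.norm_real, Real.norm_eq_abs, abs_of_pos hR0, dist_eq_norm]
  have hslit : IsSlit δ := by
    refine ⟨?_, ?_, ?_, ?_⟩
    · have : ContinuousOn (fun t : ℝ => γ (s + t * (T - s))) (Icc 0 1) := hc.comp (by fun_prop) hm
      exact (this.sub continuousOn_const).div_const _
    · intro t h t' h' he
      simp only [hδ] at he
      rw [div_left_inj' hRC, sub_left_inj] at he
      have := hi (hm h) (hm h') he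
      have h3 : t * (T - s) = t' * (T - s) := by linarith
      exact mul_right_cancel₀ hsT.ne' h3
    · intro t h
      rw [hnorm, div_lt_one hR0]
      have u1 : s ≤ s + t * (T - s) := by nlinarith [h.1]
      have u2 : s + t * (T - s) < T := by nlinarith [h.2]
      rcases le_total (s + t * (T - s)) t₀ with h3 | h3
      · exact hst _ ⟨u1, h3⟩
      · exact not_le.1 (hTmin _ ⟨h3, u2⟩)
    · rw [hnorm, show s + 1 * (T - s) = T by ring, hTR, div_self hR0.ne']
  obtain ⟨G, f, hGf⟩ := exists_slitMap hslit
  obtain ⟨e0, he1, -, he3, he4⟩ := hGf.exists_chart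
  set y₀ := (t₀ - s) / (T - s) with hy₀
  have hy0I : y₀ ∈ Ioo (0:ℝ) 1 := by
    constructor
    · exact div_pos (by linarith [hs.2]) hsT
    · rw [div_lt_one hsT]; linarith
  have hyt : s + y₀ * (T - s) = t₀ := by rw [hy₀, div_mul_cancel₀ _ hsT.ne']; ring
  set A : ℂ ≃ₜ ℂ := (Homeomorph.subRight p).trans (Homeomorph.mulRight₀ ((R:ℂ)⁻¹) (inv_ne_zero hRC))
    with hA
  have hAz : ∀ z, A z = (z - p) / R := fun z => by simp [hA, div_eq_mul_inv]
  set O := (γ '' (Icc a s ∪ Icc T b))ᶜ with hO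
  have hsub : Icc a s ∪ Icc T b ⊆ Icc a b := by
    rintro t (h | h)
    · exact ⟨h.1, h.2.trans (hs.2.le.trans ht.2.le)⟩
    · exact ⟨ht.1.le.trans (htT.le.trans h.1), h.2⟩
  have hOo : IsOpen O := ((isCompact_Icc.union isCompact_Icc).image_of_continuousOn
    (hc.mono hsub)).isClosed.isOpen_compl
  set e := ((A.toOpenPartialHomeomorph.trans e0.symm).trans
    (Homeomorph.subRight ((y₀:ℂ) * Complex.I)).toOpenPartialHomeomorph).restrOpen O hOo with he
  have hsrc : ∀ z, z ∈ e.source ↔ (z - p) / R ∈ e0.target ∧ z ∈ O := by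
    intro z
    simp [he, hAz]
  have hez : ∀ z, e z = e0.symm ((z - p) / R) - y₀ * Complex.I := by
    intro z
    simp [he, hAz]
  have hymem : ∀ y ∈ Ioo (0:ℝ) 1, (y:ℂ) * Complex.I ∈ e0.source := by
    intro y hy
    rw [he1]; simpa [SlitMap.strip] using hy
  have hpδ : (p - p) / R = δ y₀ := by
    simp only [hδ]; rw [hyt]
  refine ⟨e, ?_, ?_, ?_⟩
  · rw [hsrc]
    constructor
    · rw [hpδ, ← he3 y₀ hy0I]; exact e0.map_source (hymem _ hy0I)
    · rintro ⟨t, h, h'⟩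
      have := hi (hsub h) htI h'
      subst this
      rcases h with h | h
      · exact absurd h.2 (not_le.2 hs.2)
      · exact absurd h.1 (not_le.2 htT)
  · rw [hez, hpδ, ← he3 y₀ hy0I, e0.left_inv (hymem _ hy0I), sub_self]
  · intro z hz
    obtain ⟨h1, h2⟩ := (hsrc z).1 hz
    have hre : (e z).re = (e0.symm ((z - p) / R)).re := by
      rw [hez]; simp
    have hst : e0.symm ((z - p) / R) ∈ SlitMap.strip := by
      rw [← he1]; exact e0.map_target h1
    rw [hre]
    constructor
    · rintro ⟨t, h, rfl⟩
      refine he4 _ hst ?_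
      rw [e0.right_inv h1]
      have htt : t ∈ Ioo s T := by
        by_contra hcon
        refine h2 ⟨t, ?_, rfl⟩
        rcases le_or_gt t s with h5 | h5
        · exact Or.inl ⟨h.1, h5⟩
        · rcases le_or_gt T t with h6 | h6
          · exact Or.inr ⟨h6, h.2⟩
          · exact absurd ⟨h5, h6⟩ hcon
      refine ⟨(t - s) / (T - s), ⟨div_nonneg (by linarith [htt.1]) hsT.le, ?_⟩, ?_⟩
      · rw [div_le_one hsT]; linarith [htt.2]
      · simp only [hδ]
        rw [div_mul_cancel₀ _ hsT.ne']; congr 3; ring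
    · intro h0
      have h5 : e0.symm ((z - p) / R) = ((e0.symm ((z - p) / R)).im : ℝ) * Complex.I := by
        conv_lhs => rw [← Complex.re_add_im (e0.symm ((z - p) / R)), h0]
        simp
      have h6 := he3 _ hst
      rw [← h5, e0.right_inv h1] at h6
      simp only [hδ] at h6
      rw [div_left_inj' hRC, sub_left_inj] at h6
      exact ⟨_, hm (Ioo_subset_Icc_self hst), h6.symm⟩

/-! ### surfaces -/

variable {F : Type*} [TopologicalSpace F]

def LocE (F : Type*) [TopologicalSpace F] : Prop :=
  ∀ x : F, ∃ e : OpenPartialHomeomorph F ℂ, x ∈ e.source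

lemma normalize (e : OpenPartialHomeomorph F ℂ) {x : F} (hx : x ∈ e.source) (h0 : e x = 0)
    {N : Set F} (hN : N ∈ 𝓝 x) : ∃ e' : OpenPartialHomeomorph F ℂ, x ∈ e'.source ∧ e' x = 0 ∧
      e'.source ⊆ N ∧ e'.source ⊆ e.source ∧ e'.target = ball 0 1 ∧
      ∃ r : ℝ, 0 < r ∧ ∀ z, e' z = e z * r := by
  have h1 : e.target ∩ e.symm ⁻¹' (interior N) ∈ 𝓝 (0:ℂ) := by
    have ho : IsOpen (e.target ∩ e.symm ⁻¹' (interior N)) :=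
      e.isOpen_inter_preimage_symm isOpen_interior
    refine ho.mem_nhds ⟨h0 ▸ e.map_source hx, ?_⟩
    rw [mem_preimage, ← h0, e.left_inv hx]; exact mem_interior_iff_mem_nhds.2 hN
  obtain ⟨r, hr, hball⟩ := Metric.mem_nhds_iff.1 h1
  have hrC : (r:ℂ) ≠ 0 := by exact_mod_cast hr.ne'
  have hO : IsOpen (e.source ∩ e ⁻¹' ball 0 r) := e.isOpen_inter_preimage isOpen_ball
  set e' := (e.restrOpen _ hO).trans
    (Homeomorph.mulRight₀ ((r:ℂ)⁻¹) (inv_ne_zero hrC)).toOpenPartialHomeomorph with he'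
  have hsrc : e'.source = e.source ∩ e ⁻¹' ball 0 r := by
    ext z; simp [he']
  have hez : ∀ z, e' z = e z * (r:ℂ)⁻¹ := fun z => by simp [he']
  refine ⟨e', ?_, ?_, ?_, ?_, ?_, ?_⟩
  · rw [hsrc]; exact ⟨hx, by simp [h0, hr]⟩
  · rw [hez, h0, zero_mul]
  · rw [hsrc]
    rintro z ⟨hz, hz'⟩
    have := (hball hz').2
    rw [mem_preimage, e.left_inv hz] at this
    exact interior_subset this
  · rw [hsrc]; exact inter_subset_left
  · rw [← e'.image_source_eq_target, hsrc]
    ext w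
    simp only [mem_image, hez]
    constructor
    · rintro ⟨z, ⟨hz, hz'⟩, rfl⟩
      rw [mem_preimage, mem_ball_zero_iff] at hz'
      rw [mem_ball_zero_iff, norm_mul, norm_inv, Complex.norm_real, Real.norm_eq_abs,
        abs_of_pos hr, ← div_eq_mul_inv, div_lt_one hr]
      exact hz'
    · intro hw
      have hw' : w * r ∈ ball (0:ℂ) r := by
        rw [mem_ball_zero_iff] at hw ⊢
        rw [norm_mul, Complex.norm_real, Real.norm_eq_abs, abs_of_pos hr]
        nlinarith
      have ht := (hball hw').1
      refine ⟨e.symm (w * r), ⟨e.map_target ht, ?_⟩, ?_⟩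
      · rw [mem_preimage, e.right_inv ht]; exact hw'
      · rw [e.right_inv ht, mul_assoc, mul_inv_cancel₀ hrC, mul_one]
  · exact ⟨r⁻¹, inv_pos.2 hr, fun z => by rw [hez, ← Complex.ofReal_inv]⟩

def FlatAt (A : Set F) (x : F) : Prop := ∀ N ∈ 𝓝 x, ∃ e : OpenPartialHomeomorph F ℂ,
  x ∈ e.source ∧ e x = 0 ∧ e.source ⊆ N ∧ e.target = ball 0 1 ∧
  ∀ z ∈ e.source, z ∈ A ↔ (e z).re = 0

lemma FlatAt.congr {A A' : Set F} {x : F} (h : FlatAt A x) (hA : ∀ᶠ z in 𝓝 x, z ∈ A ↔ z ∈ A') :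
    FlatAt A' x := by
  intro N hN
  obtain ⟨e, h1, h2, h3, h4, h5⟩ := h (N ∩ {z | z ∈ A ↔ z ∈ A'}) (Filter.inter_mem hN hA)
  refine ⟨e, h1, h2, fun z hz => (h3 hz).1, h4, fun z hz => ?_⟩
  have q : z ∈ A ↔ z ∈ A' := (h3 hz).2
  rw [← q]; exact h5 z hz

theorem surface_flat [T2Space F] (hF : LocE F) {c : ℝ → F} {a b t₀ : ℝ}
    (hc : ContinuousOn c (Icc a b)) (hi : InjOn c (Icc a b)) (ht : t₀ ∈ Ioo a b) :
    FlatAt (c '' Icc a b) (c t₀) := by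
  obtain ⟨e, he⟩ := hF (c t₀)
  have htI : t₀ ∈ Icc a b := Ioo_subset_Icc_self ht
  have hca : ContinuousAt c t₀ := hc.continuousAt (Icc_mem_nhds ht.1 ht.2)
  obtain ⟨ε, hε, hb⟩ := Metric.eventually_nhds_iff.1
    (hca.eventually (e.open_source.mem_nhds he))
  set a' := max (t₀ - ε / 2) ((a + t₀) / 2) with ha'
  set b' := min (t₀ + ε / 2) ((t₀ + b) / 2) with hb'
  have l1 : a < a' := lt_of_lt_of_le (by linarith [ht.1]) (le_max_right _ _)
  have l2 : a' < t₀ := max_lt (by linarith) (by linarith [ht.1])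
  have l3 : t₀ < b' := lt_min (by linarith) (by linarith [ht.2])
  have l4 : b' < b := lt_of_le_of_lt (min_le_right _ _) (by linarith [ht.2])
  have hsub : Icc a' b' ⊆ Icc a b := Icc_subset_Icc l1.le l4.le
  have hsrc : ∀ t ∈ Icc a' b', c t ∈ e.source := by
    intro t h
    apply hb
    have u1 := (le_max_left (t₀ - ε / 2) ((a + t₀) / 2)).trans h.1
    have u2 := h.2.trans (min_le_left (t₀ + ε / 2) ((t₀ + b) / 2))
    rw [Real.dist_eq, abs_lt]
    constructor <;> linarith
  obtain ⟨e1, k1, k2, k3⟩ := planar_flat (γ := fun t => e (c t)) (a := a') (b := b') (t₀ := t₀)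
    (e.continuousOn.comp (hc.mono hsub) hsrc)
    (fun t h t' h' hh => hi (hsub h) (hsub h') (e.injOn (hsrc t h) (hsrc t' h') hh)) ⟨l2, l3⟩
  have hflat : FlatAt (c '' Icc a' b') (c t₀) := by
    intro N hN
    obtain ⟨e2, m1, m2, m3, m4, m5, r, hr, m6⟩ := normalize (e.trans e1) (x := c t₀) (by simp [he, k1])
      (by simp [k2]) hN
    refine ⟨e2, m1, m2, m3, m5, fun z hz => ?_⟩
    have hz' := m4 hz
    simp only [OpenPartialHomeomorph.trans_source, mem_inter_iff, mem_preimage] at hz'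
    have m7 : (e2 z).re = 0 ↔ ((e.trans e1) z).re = 0 := by
      rw [m6, Complex.re_mul_ofReal, mul_eq_zero]
      simp [hr.ne']
    rw [m7, OpenPartialHomeomorph.coe_trans, Function.comp_apply, ← k3 _ hz'.2]
    constructor
    · rintro ⟨t, h, rfl⟩; exact ⟨t, h, rfl⟩
    · rintro ⟨t, h, hh⟩
      exact ⟨t, h, e.injOn (hsrc t h) hz'.1 hh⟩
  refine hflat.congr ?_
  have hsub2 : Icc a a' ∪ Icc b' b ⊆ Icc a b := by
    rintro t (h | h)
    · exact ⟨h.1, h.2.trans (l2.le.trans (l3.le.trans l4.le))⟩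
    · exact ⟨(l1.le.trans (l2.le.trans l3.le)).trans h.1, h.2⟩
  have hK : IsCompact (c '' (Icc a a' ∪ Icc b' b)) :=
    (isCompact_Icc.union isCompact_Icc).image_of_continuousOn (hc.mono hsub2)
  have hn : c t₀ ∉ c '' (Icc a a' ∪ Icc b' b) := by
    rintro ⟨t, h, hh⟩
    have := hi (hsub2 h) htI hh
    subst this
    rcases h with h | h
    · exact absurd h.2 (not_le.2 l2)
    · exact absurd h.1 (not_le.2 l3)
  filter_upwards [hK.isClosed.isOpen_compl.mem_nhds hn] with z hz
  constructor
  · rintro ⟨t, h, rfl⟩; exact ⟨t, hsub h, rfl⟩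
  · rintro ⟨t, h, rfl⟩
    refine ⟨t, ?_, rfl⟩
    by_contra hcon
    refine hz ⟨t, ?_, rfl⟩
    rcases le_or_gt t a' with h5 | h5
    · exact Or.inl ⟨h.1, h5⟩
    · rcases le_or_gt b' t with h6 | h6
      · exact Or.inr ⟨h6, h.2⟩
      · exact absurd ⟨h5.le, h6.le⟩ hcon
end Part10

section Part11
section arcs
variable {F : Type*} [TopologicalSpace F]

lemma exists_normal_chart (hF : LocE F) (x : F) {N : Set F} (hN : N ∈ 𝓝 x) :
    ∃ e : OpenPartialHomeomorph F ℂ, x ∈ e.source ∧ e x = 0 ∧ e.source ⊆ N ∧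
      e.target = ball 0 1 := by
  obtain ⟨e, he⟩ := hF x
  obtain ⟨e', h1, h2, h3, -, h5, -⟩ := normalize
    (e.trans (Homeomorph.addRight (-(e x))).toOpenPartialHomeomorph) (x := x)
    (by simp [he]) (by simp) hN
  exact ⟨e', h1, h2, h3, h5⟩

/-- (possibly degenerate) arcs -/
def Arc (A : Set F) (x y : F) : Prop := ∃ c : ℝ → F, ∃ T : ℝ, 0 ≤ T ∧ ContinuousOn c (Icc 0 T) ∧
  InjOn c (Icc 0 T) ∧ c '' Icc 0 T = A ∧ c 0 = x ∧ c T = y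

lemma Arc.sub {c : ℝ → F} {a b s t : ℝ} (hc : ContinuousOn c (Icc a b)) (hi : InjOn c (Icc a b))
    (has : a ≤ s) (hst : s ≤ t) (htb : t ≤ b) : Arc (c '' Icc s t) (c s) (c t) := by
  have hm : ∀ u ∈ Icc 0 (t - s), u + s ∈ Icc a b := fun u hu =>
    ⟨by linarith [hu.1], by linarith [hu.2]⟩
  refine ⟨fun u => c (u + s), t - s, by linarith, ?_, ?_, ?_, by simp, by simp⟩
  · exact hc.comp (by fun_prop) hm
  · intro u hu v hv h
    have := hi (hm u hu) (hm v hv) h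
    linarith
  · ext z
    constructor
    · rintro ⟨u, hu, rfl⟩; exact ⟨u + s, ⟨by linarith [hu.1], by linarith [hu.2]⟩, rfl⟩
    · rintro ⟨u, hu, rfl⟩
      exact ⟨u - s, ⟨by linarith [hu.1], by linarith [hu.2]⟩, by simp⟩

lemma Arc.symm {A : Set F} {x y : F} (h : Arc A x y) : Arc A y x := by
  obtain ⟨c, T, hT, hc, hi, hA, hx, hy⟩ := h
  have hm : ∀ u ∈ Icc 0 T, T - u ∈ Icc 0 T := fun u hu => ⟨by linarith [hu.2], by linarith [hu.1]⟩
  refine ⟨fun u => c (T - u), T, hT, ?_, ?_, ?_, by simpa using hy, by simpa using hx⟩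
  · exact hc.comp (by fun_prop) hm
  · intro u hu v hv h
    have := hi (hm u hu) (hm v hv) h
    linarith
  · rw [← hA]
    ext z
    constructor
    · rintro ⟨u, hu, rfl⟩; exact ⟨_, hm u hu, rfl⟩
    · rintro ⟨u, hu, rfl⟩; exact ⟨_, hm u hu, by simp⟩

lemma Arc.trans {A B : Set F} {x y z : F} (h : Arc A x y) (h' : Arc B y z)
    (hAB : A ∩ B ⊆ {y}) : Arc (A ∪ B) x z := by
  obtain ⟨c, T, hT, hc, hi, hA, hx, hy⟩ := h
  obtain ⟨d, S, hS, hd, hj, hB, hy', hz⟩ := h'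
  have hm : ∀ u ∈ Icc T (T + S), u - T ∈ Icc 0 S := fun u hu =>
    ⟨by linarith [hu.1], by linarith [hu.2]⟩
  set f : ℝ → F := fun t => if t ≤ T then c t else d (t - T) with hf
  have f1 : ∀ t ∈ Icc 0 T, f t = c t := fun t ht => by simp [hf, ht.2]
  have f2 : ∀ t ∈ Icc T (T + S), f t = d (t - T) := fun t ht => by
    rcases ht.1.eq_or_lt with h | h
    · subst h; simp [hf, hy, hy']
    · simp [hf, not_le.2 h]
  have hU : Icc 0 (T + S) = Icc 0 T ∪ Icc T (T + S) := (Icc_union_Icc_eq_Icc hT (by linarith)).symm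
  have hkey : ∀ u ∈ Icc 0 T, ∀ v ∈ Icc T (T + S), f u = f v → u = v := by
    intro u hu v hv h
    rw [f1 u hu, f2 v hv] at h
    have h1 : c u ∈ A ∩ B := ⟨hA ▸ ⟨u, hu, rfl⟩, hB ▸ ⟨_, hm v hv, h.symm⟩⟩
    have h2 : c u = y := hAB h1
    have h3 : u = T := hi hu ⟨hT, le_rfl⟩ (h2.trans hy.symm)
    have h4 : v - T = 0 := hj (hm v hv) ⟨le_rfl, hS⟩ (by rw [← h, h2, hy'])
    linarith
  refine ⟨f, T + S, by linarith, ?_, ?_, ?_, ?_, ?_⟩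
  · rw [hU]
    refine ContinuousOn.union_of_isClosed (hc.congr f1) ?_ isClosed_Icc isClosed_Icc
    exact (hd.comp (f := fun t => t - T) (by fun_prop) hm).congr f2
  · rw [hU]
    rintro u (hu | hu) v (hv | hv) h
    · rw [f1 u hu, f1 v hv] at h; exact hi hu hv h
    · exact hkey u hu v hv h
    · exact (hkey v hv u hu h.symm).symm
    · rw [f2 u hu, f2 v hv] at h
      have := hj (hm u hu) (hm v hv) h
      linarith
  · rw [hU, image_union, ← hA, ← hB]
    congr 1
    · exact image_congr f1
    · rw [image_congr f2]
      ext w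
      constructor
      · rintro ⟨u, hu, rfl⟩; exact ⟨_, hm u hu, rfl⟩
      · rintro ⟨u, hu, rfl⟩
        exact ⟨u + T, ⟨by linarith [hu.1], by linarith [hu.2]⟩, by simp⟩
  · rw [f1 0 ⟨le_rfl, hT⟩, hx]
  · rw [f2 _ ⟨by linarith, le_rfl⟩]; simpa using hz

lemma Arc.seg (e : OpenPartialHomeomorph F ℂ) (he : e.target = ball 0 1) {z w : ℂ}
    (hz : z ∈ ball (0:ℂ) 1) (hw : w ∈ ball (0:ℂ) 1) :
    Arc (e.symm '' segment ℝ z w) (e.symm z) (e.symm w) := by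
  have hsub : segment ℝ z w ⊆ ball 0 1 := (convex_ball (0:ℂ) 1).segment_subset hz hw
  by_cases h : z = w
  · subst h
    exact ⟨fun _ => e.symm z, 0, le_rfl, continuousOn_const, by simp, by simp, rfl, rfl⟩
  · have hcont : Continuous (fun t : ℝ => z + t • (w - z)) := by fun_prop
    have hI : (fun t : ℝ => z + t • (w - z)) '' Icc 0 1 = segment ℝ z w :=
      (segment_eq_image' ℝ z w).symm
    have hm : MapsTo (fun t : ℝ => z + t • (w - z)) (Icc 0 1) e.target := by
      rw [he]; intro t ht; exact hsub (hI ▸ ⟨t, ht, rfl⟩)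
    refine ⟨fun t => e.symm (z + t • (w - z)), 1, zero_le_one, ?_, ?_, ?_, by simp, by simp⟩
    · exact e.symm.continuousOn.comp hcont.continuousOn hm
    · intro s hs t ht hh
      have h1 := e.symm.injOn (hm hs) (hm ht) hh
      have h2 : (s - t) • (w - z) = 0 := by
        rw [sub_smul, sub_eq_zero]; exact add_left_cancel h1
      rcases smul_eq_zero.1 h2 with h3 | h3
      · linarith
      · exact absurd (sub_eq_zero.1 h3).symm h
    · rw [← hI, image_image]

lemma Arc.isCompact {A : Set F} {x y : F} (h : Arc A x y) : IsCompact A := by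
  obtain ⟨c, T, hT, hc, hi, hA, hx, hy⟩ := h
  exact hA ▸ isCompact_Icc.image_of_continuousOn hc

theorem exists_arc [T2Space F] (hF : LocE F) {Ω : Set F} (hΩ : IsOpen Ω) (hcon : IsPreconnected Ω)
    {x y : F} (hx : x ∈ Ω) (hy : y ∈ Ω) : ∃ A ⊆ Ω, Arc A x y := by
  set R : Set F := {y | ∃ A ⊆ Ω, Arc A x y} with hR
  have hxR : x ∈ R := ⟨{x}, by simpa using hx, fun _ => x, 0, le_rfl, continuousOn_const,
    by simp, by simp, rfl, rfl⟩
  have key : ∀ e : OpenPartialHomeomorph F ℂ, e.source ⊆ Ω → e.target = ball 0 1 →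
      ∀ z₁ ∈ e.source, ∀ z₂ ∈ e.source, z₁ ∈ R → z₂ ∈ R := by
    rintro e hs ht z₁ h1 z₂ h2 ⟨A, hA, c, T, hT, hc, hi, rfl, hcx, hcy⟩
    have m1 : e z₁ ∈ ball (0:ℂ) 1 := ht ▸ e.map_source h1
    have m2 : e z₂ ∈ ball (0:ℂ) 1 := ht ▸ e.map_source h2
    rw [mem_ball_zero_iff] at m1 m2
    set r := max ‖e z₁‖ ‖e z₂‖ with hr
    have hr1 : r < 1 := max_lt m1 m2
    have hKt : closedBall (0:ℂ) r ⊆ e.target := by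
      rw [ht]; exact closedBall_subset_ball hr1
    have hK : IsCompact (e.symm '' closedBall (0:ℂ) r) :=
      (isCompact_closedBall _ _).image_of_continuousOn (e.symm.continuousOn.mono hKt)
    have hin : ∀ z ∈ e.source, ‖e z‖ ≤ r → z ∈ e.symm '' closedBall (0:ℂ) r := fun z hz h =>
      ⟨e z, by simpa using h, e.left_inv hz⟩
    obtain ⟨t, ht1, ht2, ht3⟩ := first_hit hT hc hK.isClosed
      (hcy ▸ hin z₁ h1 (le_max_left _ _))
    obtain ⟨q, hq, hqe⟩ := ht2
    have hq' := hKt hq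
    rw [ht] at hq'
    have a1 := Arc.sub hc hi le_rfl ht1.1 ht1.2
    have a2 := Arc.seg e ht hq' (mem_ball_zero_iff.2 m2)
    have hseg : segment ℝ q (e z₂) ⊆ closedBall 0 r :=
      (convex_closedBall (0:ℂ) r).segment_subset hq (by simp [hr])
    rw [hqe, e.left_inv h2] at a2
    rw [hcx] at a1
    refine ⟨_, ?_, a1.trans a2 ?_⟩
    · refine union_subset ((image_mono (Icc_subset_Icc_right ht1.2)).trans hA) ?_
      rintro _ ⟨w, hw, rfl⟩
      exact hs (e.map_target (hKt (hseg hw)))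
    · rintro _ ⟨⟨s, hs1, rfl⟩, w, hw, hws⟩
      rcases hs1.2.eq_or_lt with h | h
      · rw [h]; rfl
      · exact absurd ⟨w, hseg hw, hws⟩ (ht3 s ⟨hs1.1, h⟩)
  have hRΩ : R ⊆ Ω := by
    rintro z ⟨A, hA, c, T, hT, hc, hi, rfl, hcx, hcy⟩
    exact hA ⟨T, ⟨hT, le_rfl⟩, hcy⟩
  have o1 : IsOpen R := by
    rw [isOpen_iff_mem_nhds]
    intro z hz
    obtain ⟨e, h1, h2, h3, h4⟩ := exists_normal_chart hF z (hΩ.mem_nhds (hRΩ hz))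
    exact Filter.mem_of_superset (e.open_source.mem_nhds h1) fun w hw => key e h3 h4 z h1 w hw hz
  have o2 : IsOpen (Ω \ R) := by
    rw [isOpen_iff_mem_nhds]
    intro z hz
    obtain ⟨e, h1, h2, h3, h4⟩ := exists_normal_chart hF z (hΩ.mem_nhds hz.1)
    exact Filter.mem_of_superset (e.open_source.mem_nhds h1) fun w hw =>
      ⟨h3 hw, fun h => hz.2 (key e h3 h4 w hw z h1 h)⟩
  by_contra hcontra
  obtain ⟨z, -, hz1, hz2⟩ := hcon R (Ω \ R) o1 o2 (fun z hz => by by_cases h : z ∈ R <;> simp [h, hz])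
    ⟨x, hx, hxR⟩ ⟨y, hy, hy, hcontra⟩
  exact hz2.2 hz1
end arcs
end Part11

section Part12
section trunc
variable {F : Type*} [TopologicalSpace F]

/-- shear on the right half plane -/
def shear (m : ℝ) : ℂ ≃ₜ ℂ where
  toFun z := ⟨z.re, z.im - m * max z.re 0⟩
  invFun z := ⟨z.re, z.im + m * max z.re 0⟩
  left_inv z := by apply Complex.ext <;> simp
  right_inv z := by apply Complex.ext <;> simp
  continuous_toFun := by
    have : (fun z : ℂ => (⟨z.re, z.im - m * max z.re 0⟩ : ℂ)) =
      fun z : ℂ => ((z.re : ℂ) + ((z.im - m * max z.re 0 : ℝ) : ℂ) * Complex.I) := by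
      ext z; exact Complex.mk_eq_add_mul_I _ _
    rw [this]; fun_prop
  continuous_invFun := by
    have : (fun z : ℂ => (⟨z.re, z.im + m * max z.re 0⟩ : ℂ)) =
      fun z : ℂ => ((z.re : ℂ) + ((z.im + m * max z.re 0 : ℝ) : ℂ) * Complex.I) := by
      ext z; exact Complex.mk_eq_add_mul_I _ _
    rw [this]; fun_prop

lemma shear_apply (m : ℝ) (z : ℂ) : shear m z = ⟨z.re, z.im - m * max z.re 0⟩ := rfl

/-- `f` is a chart at `p` adapted to `e` in which `B` is the nonnegative real axis -/
def Adapted (e f : OpenPartialHomeomorph F ℂ) (B : Set F) (p : F) : Prop :=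
  p ∈ f.source ∧ f p = 0 ∧ f.source ⊆ e.source ∧ f.target = ball 0 1 ∧
  (∃ r : ℝ, 0 < r ∧ (∀ z, (f z).re = (e z).re * r) ∧ (∀ z, (e z).re ≤ 0 → f z = e z * r)) ∧
  ∀ z ∈ f.source, z ∈ B ↔ 0 ≤ (f z).re ∧ (f z).im = 0

lemma straighten (e : OpenPartialHomeomorph F ℂ) {p : F} (hp : p ∈ e.source) (h0 : e p = 0)
    {B : Set F} {m : ℝ} (hB : ∀ᶠ z in 𝓝 p, z ∈ B ↔ 0 ≤ (e z).re ∧ (e z).im = m * (e z).re) :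
    ∃ f, Adapted e f B p := by
  obtain ⟨f, h1, h2, h3, h4, h5, r, hr, h6⟩ := normalize
    (e.trans (shear m).toOpenPartialHomeomorph) (x := p) (by simp [hp])
    (by simp [h0, shear_apply, Complex.ext_iff]) hB
  have h6' : ∀ z, f z = shear m (e z) * r := fun z => by rw [h6]; simp
  have hre : ∀ z, (f z).re = (e z).re * r := fun z => by
    rw [h6', Complex.re_mul_ofReal, shear_apply]
  refine ⟨f, h1, h2, ?_, h5, ⟨r, hr, hre, ?_⟩, ?_⟩
  · intro z hz; simpa using h4 hz
  · intro z hz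
    rw [h6', shear_apply, max_eq_right hz]
    congr 1
    apply Complex.ext <;> simp
  · intro z hz
    have : z ∈ B ↔ 0 ≤ (e z).re ∧ (e z).im = m * (e z).re := h3 hz
    rw [this, hre, h6', Complex.im_mul_ofReal, shear_apply]
    rw [mul_nonneg_iff_of_pos_right hr, mul_eq_zero_iff_right hr.ne']
    apply and_congr_right
    intro h
    rw [max_eq_left h, sub_eq_zero]

lemma seg_germ (e : OpenPartialHomeomorph F ℂ) {p : F} (hp : p ∈ e.source) (h0 : e p = 0)
    {q : ℂ} (hq : 0 < q.re) (hseg : segment ℝ 0 q ⊆ e.target) :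
    ∀ᶠ z in 𝓝 p, z ∈ e.symm '' segment ℝ 0 q ↔ 0 ≤ (e z).re ∧ (e z).im = (q.im / q.re) * (e z).re := by
  have hc : ContinuousAt e p := e.continuousAt hp
  have h1 : ∀ᶠ z in 𝓝 p, (e z).re < q.re := by
    have : ContinuousAt (fun z => (e z).re) p := Complex.continuous_re.continuousAt.comp hc
    exact this.eventually_lt continuousAt_const (by simpa [h0] using hq)
  filter_upwards [h1, e.open_source.mem_nhds hp] with z hz hzs
  constructor
  · rintro ⟨w, hw, rfl⟩
    rw [e.right_inv (hseg hw)]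
    rw [segment_eq_image'] at hw
    obtain ⟨t, ht, rfl⟩ := hw
    simp only [sub_zero, zero_add, Complex.smul_re, Complex.smul_im, smul_eq_mul]
    refine ⟨mul_nonneg ht.1 hq.le, ?_⟩
    field_simp
  · rintro ⟨h2, h3⟩
    refine ⟨e z, ?_, e.left_inv hzs⟩
    rw [segment_eq_image']
    refine ⟨(e z).re / q.re, ⟨by positivity, (div_le_one hq).2 hz.le⟩, ?_⟩
    apply Complex.ext
    · simp; field_simp
    · simp [h3]; field_simp

theorem truncArc [T2Space F] (hF : LocE F) {Ω : Set F} (hΩ : IsOpen Ω) (hcon : IsPreconnected Ω)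
    {p p' : F} {e e' : OpenPartialHomeomorph F ℂ} (hp : p ∈ e.source) (hp' : p' ∈ e'.source)
    (h0 : e p = 0) (h0' : e' p' = 0) (ht : e.target = ball 0 1) (ht' : e'.target = ball 0 1)
    {ρ : ℝ} (hρ : 0 < ρ) (hρ1 : ρ < 1)
    (hs : ∀ z, ‖z‖ ≤ ρ → 0 < z.re → e.symm z ∈ Ω) (hs' : ∀ z, ‖z‖ ≤ ρ → 0 < z.re → e'.symm z ∈ Ω)
    (hn : ∀ z, ‖z‖ ≤ ρ → z.re = 0 → e.symm z ∉ Ω) (hn' : ∀ z, ‖z‖ ≤ ρ → z.re = 0 → e'.symm z ∉ Ω)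
    (hd : Disjoint e.source e'.source) :
    ∃ B, Arc B p p' ∧ B \ {p, p'} ⊆ Ω ∧ ∃ f f', Adapted e f B p ∧ Adapted e' f' B p' := by
  set H : Set ℂ := closedBall 0 ρ ∩ {z | 0 ≤ z.re} with hH
  have hHc : IsCompact H := (isCompact_closedBall _ _).inter_right
    (isClosed_le continuous_const Complex.continuous_re)
  have hHconv : Convex ℝ H := (convex_closedBall _ _).inter (convex_halfSpace_re_ge 0)
  have hHb : H ⊆ ball 0 1 := inter_subset_left.trans (closedBall_subset_ball hρ1)
  have zH : (0:ℂ) ∈ H := ⟨by simp [hρ.le], by simp⟩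
  have kk : ∀ (e : OpenPartialHomeomorph F ℂ), e.target = ball 0 1 → IsClosed (e.symm '' H) :=
    fun e ht => (hHc.image_of_continuousOn (e.symm.continuousOn.mono (by rw [e.symm_source, ht]; exact hHb))).isClosed
  have hρn : ‖((ρ/2 : ℝ):ℂ)‖ ≤ ρ := by
    rw [Complex.norm_real, Real.norm_eq_abs, abs_of_pos (by linarith)]; linarith
  have hρr : 0 < ((ρ/2 : ℝ):ℂ).re := by rw [Complex.ofReal_re]; linarith
  have hρH : ((ρ/2 : ℝ):ℂ) ∈ H := ⟨by simpa using hρn, hρr.le⟩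
  obtain ⟨A, hA, c, T, hT, hc, hi, rfl, hcx, hcy⟩ := exists_arc hF hΩ hcon
    (hs _ hρn hρr) (hs' _ hρn hρr)
  obtain ⟨t1, ht1, hq1, hl1⟩ := last_hit hT hc (kk e ht) (hcx ▸ ⟨_, hρH, rfl⟩)
  obtain ⟨t2, ht2, hq2, hl2⟩ := first_hit ht1.2 (hc.mono (Icc_subset_Icc_left ht1.1)) (kk e' ht')
    (hcy ▸ ⟨_, hρH, rfl⟩)
  obtain ⟨q, hqH, hqe⟩ := hq1
  obtain ⟨q', hqH', hqe'⟩ := hq2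
  have hqr : 0 < q.re := by
    refine lt_of_le_of_ne hqH.2 fun h => hn q (by simpa using hqH.1) h.symm ?_
    rw [hqe]; exact hA ⟨t1, ht1, rfl⟩
  have hqr' : 0 < q'.re := by
    refine lt_of_le_of_ne hqH'.2 fun h => hn' q' (by simpa using hqH'.1) h.symm ?_
    rw [hqe']; exact hA ⟨t2, ⟨ht1.1.trans ht2.1, ht2.2⟩, rfl⟩
  have sH : segment ℝ 0 q ⊆ H := hHconv.segment_subset zH hqH
  have sH' : segment ℝ 0 q' ⊆ H := hHconv.segment_subset zH hqH'
  have e0 : e.symm 0 = p := by rw [← h0, e.left_inv hp]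
  have e0' : e'.symm 0 = p' := by rw [← h0', e'.left_inv hp']
  have a1 := Arc.seg e ht (hHb zH) (hHb hqH)
  have a2 := Arc.sub hc hi ht1.1 ht2.1 ht2.2
  have a3 := (Arc.seg e' ht' (hHb zH) (hHb hqH')).symm
  rw [hqe, e0] at a1
  rw [hqe', e0'] at a3
  set S := e.symm '' segment ℝ 0 q with hS
  set S' := e'.symm '' segment ℝ 0 q' with hS'
  set M := c '' Icc t1 t2 with hM
  have SH : S ⊆ e.symm '' H := image_mono sH
  have SH' : S' ⊆ e'.symm '' H := image_mono sH'
  have Ssrc : S ⊆ e.source := by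
    rintro _ ⟨w, hw, rfl⟩; exact e.map_target (ht ▸ hHb (sH hw))
  have Ssrc' : S' ⊆ e'.source := by
    rintro _ ⟨w, hw, rfl⟩; exact e'.map_target (ht' ▸ hHb (sH' hw))
  have MΩ : M ⊆ Ω := (image_mono (Icc_subset_Icc ht1.1 ht2.2)).trans hA
  have pΩ : p ∉ Ω := by rw [← e0]; exact hn 0 (by simp [hρ.le]) (by simp)
  have pΩ' : p' ∉ Ω := by rw [← e0']; exact hn' 0 (by simp [hρ.le]) (by simp)
  have i1 : S ∩ M ⊆ {c t1} := by
    rintro _ ⟨hz, s, hs1, rfl⟩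
    rcases hs1.1.eq_or_lt with h | h
    · rw [h]; rfl
    · exact absurd (SH hz) (hl1 s ⟨h, hs1.2.trans ht2.2⟩)
  have i2 : (S ∪ M) ∩ S' ⊆ {c t2} := by
    rintro z ⟨hz | ⟨s, hs1, rfl⟩, hz'⟩
    · exact absurd rfl (hd.ne_of_mem (Ssrc hz) (Ssrc' hz'))
    · rcases hs1.2.eq_or_lt with h | h
      · rw [h]; rfl
      · exact absurd (SH' hz') (hl2 s ⟨hs1.1, h⟩)
  refine ⟨S ∪ M ∪ S', (a1.trans a2 i1).trans a3 i2, ?_, ?_⟩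
  · rintro z ⟨(⟨w, hw, rfl⟩ | hz) | ⟨w, hw, rfl⟩, hne⟩
    · refine hs w (by simpa using (sH hw).1) (lt_of_le_of_ne (sH hw).2 fun h => hne ?_)
      rw [segment_eq_image'] at hw
      obtain ⟨t, ht, rfl⟩ := hw
      simp only [sub_zero, zero_add, Complex.smul_re, smul_eq_mul] at h
      rcases mul_eq_zero.1 h.symm with h | h
      · left; simp [h, e0]
      · exact absurd h hqr.ne'
    · exact MΩ hz
    · refine hs' w (by simpa using (sH' hw).1) (lt_of_le_of_ne (sH' hw).2 fun h => hne ?_)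
      rw [segment_eq_image'] at hw
      obtain ⟨t, ht, rfl⟩ := hw
      simp only [sub_zero, zero_add, Complex.smul_re, smul_eq_mul] at h
      rcases mul_eq_zero.1 h.symm with h | h
      · right; simp [h, e0']
      · exact absurd h hqr'.ne'
  · have g1 := seg_germ e hp h0 hqr (ht ▸ sH.trans hHb)
    have g2 := seg_germ e' hp' h0' hqr' (ht' ▸ sH'.trans hHb)
    have MO : ∀ x, x ∉ Ω → ∀ᶠ z in 𝓝 x, z ∉ M := fun x hx =>
      a2.isCompact.isClosed.isOpen_compl.mem_nhds fun h => hx (MΩ h)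
    have k1 : ∀ᶠ z in 𝓝 p, z ∈ S ∪ M ∪ S' ↔ z ∈ S := by
      filter_upwards [MO p pΩ, e.open_source.mem_nhds hp] with z h1 h2
      have : z ∉ S' := fun h => hd.ne_of_mem h2 (Ssrc' h) rfl
      simp [h1, this]
    have k2 : ∀ᶠ z in 𝓝 p', z ∈ S ∪ M ∪ S' ↔ z ∈ S' := by
      filter_upwards [MO p' pΩ', e'.open_source.mem_nhds hp'] with z h1 h2
      have : z ∉ S := fun h => hd.ne_of_mem (Ssrc h) h2 rfl
      simp [h1, this]
    obtain ⟨f, hf⟩ := straighten e hp h0 (B := S ∪ M ∪ S') (m := q.im / q.re) (by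
      filter_upwards [k1, g1] with z h1 h2; rw [h1, h2])
    obtain ⟨f', hf'⟩ := straighten e' hp' h0' (B := S ∪ M ∪ S') (m := q'.im / q'.re) (by
      filter_upwards [k2, g2] with z h1 h2; rw [h1, h2])
    exact ⟨f, f', hf, hf'⟩
end trunc
end Part12

section Part13
section conn
variable {F : Type*} [TopologicalSpace F]

lemma Arc.interior [T2Space F] (hF : LocE F) {B : Set F} {p p' : F} (h : Arc B p p') :
    p ∈ B ∧ p' ∈ B ∧ IsPreconnected (B \ {p, p'}) ∧ ∀ x ∈ B \ {p, p'}, FlatAt B x := by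
  obtain ⟨c, T, hT, hc, hi, rfl, rfl, rfl⟩ := h
  have h0 : (0:ℝ) ∈ Icc 0 T := ⟨le_rfl, hT⟩
  have h1 : T ∈ Icc 0 T := ⟨hT, le_rfl⟩
  have hI : c '' Icc 0 T \ {c 0, c T} = c '' Ioo 0 T := by
    ext z
    constructor
    · rintro ⟨⟨t, ht, rfl⟩, hn⟩
      refine ⟨t, ⟨lt_of_le_of_ne ht.1 ?_, lt_of_le_of_ne ht.2 ?_⟩, rfl⟩
      · rintro rfl; exact hn (by simp)
      · rintro rfl; exact hn (by simp)
    · rintro ⟨t, ht, rfl⟩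
      refine ⟨⟨t, Ioo_subset_Icc_self ht, rfl⟩, ?_⟩
      rintro (h | h)
      · exact ht.1.ne' (hi (Ioo_subset_Icc_self ht) h0 h)
      · exact ht.2.ne (hi (Ioo_subset_Icc_self ht) h1 h)
  refine ⟨⟨0, h0, rfl⟩, ⟨T, h1, rfl⟩, ?_, ?_⟩
  · rw [hI]
    exact isPreconnected_Ioo.image _ (hc.mono Ioo_subset_Icc_self)
  · rw [hI]
    rintro _ ⟨t, ht, rfl⟩
    exact surface_flat hF hc hi ht

lemma propagate {A O O' : Set F} (hA : IsPreconnected A) (hO : IsOpen O) (hO' : IsOpen O')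
    (hd : Disjoint O O') (hAO : Disjoint A O)
    (hch : ∀ x ∈ A, ∃ e : OpenPartialHomeomorph F ℂ, x ∈ e.source ∧ e.target = ball 0 1 ∧
      (∀ z ∈ e.source, z ∈ A ↔ (e z).re = 0) ∧ e.source \ A ⊆ O ∪ O')
    (hne : (A ∩ closure O).Nonempty) : A ⊆ closure O := by
  by_contra hcon
  obtain ⟨y, hyA, hy⟩ := not_subset.1 hcon
  set u : Set F := {x | ∃ V, IsOpen V ∧ x ∈ V ∧ V ∩ A ⊆ closure O} with hu
  have huo : IsOpen u := by
    rw [isOpen_iff_mem_nhds]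
    rintro x ⟨V, hV, hx, hVA⟩
    exact Filter.mem_of_superset (hV.mem_nhds hx) fun z hz => ⟨V, hV, hz, hVA⟩
  have hclu : A ∩ closure O ⊆ u := by
    rintro x ⟨hxA, hxO⟩
    obtain ⟨e, h1, h2, h3, h4⟩ := hch x hxA
    refine ⟨e.source, e.open_source, h1, ?_⟩
    obtain ⟨z, hz, hzO⟩ := mem_closure_iff.1 hxO e.source e.open_source h1
    have hzA : z ∉ A := fun h => hd.ne_of_mem (a := z) hzO (by
      exact absurd rfl (hAO.ne_of_mem h hzO)) rfl
    have hre : (e z).re ≠ 0 := fun h => hzA ((h3 z hz).2 h)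
    have gen : ∀ H : Set ℂ, Convex ℝ H → e z ∈ H → (∀ w ∈ H, w.re ≠ 0) →
        (∀ w : ℂ, w ∈ ball (0:ℂ) 1 → w.re = 0 → w ∈ closure (ball 0 1 ∩ H)) →
        e.source ∩ A ⊆ closure O := by
      intro H hH hzH hnz hcl
      have c1 : IsPreconnected (e.symm '' (ball 0 1 ∩ H)) := by
        refine ((convex_ball (0:ℂ) 1).inter hH).isPreconnected.image _ (e.symm.continuousOn.mono ?_)
        rw [e.symm_source, h2]; exact inter_subset_left
      have c2 : e.symm '' (ball 0 1 ∩ H) ⊆ O ∪ O' := by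
        rintro _ ⟨w, hw, rfl⟩
        have hwt : w ∈ e.target := h2 ▸ hw.1
        refine h4 ⟨e.map_target hwt, fun h => hnz w hw.2 ?_⟩
        rw [h3 _ (e.map_target hwt), e.right_inv hwt] at h
        exact h
      have c3 : e.symm '' (ball 0 1 ∩ H) ⊆ O :=
        c1.subset_left_of_subset_union hO hO' hd c2
          ⟨z, ⟨e z, ⟨h2 ▸ e.map_source hz, hzH⟩, e.left_inv hz⟩, hzO⟩
      rintro x' ⟨hx', hxA'⟩
      have hx0 := (h3 x' hx').1 hxA'
      have hxt : e x' ∈ e.target := e.map_source hx'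
      have := ((e.symm.continuousAt hxt).continuousWithinAt
        (s := ball 0 1 ∩ H)).mem_closure_image (hcl _ (h2 ▸ hxt) hx0)
      rw [e.left_inv hx'] at this
      exact closure_mono c3 this
    have seq : ∀ (s : ℝ) (w : ℂ), s ≠ 0 → w ∈ ball (0:ℂ) 1 → w.re = 0 →
        w ∈ closure (ball 0 1 ∩ {z : ℂ | 0 < s * z.re}) := by
      intro s w hs hw hwr
      have hc : Continuous (fun t : ℝ => w + ((s * t : ℝ) : ℂ)) := by fun_prop
      have hcl : (0:ℝ) ∈ closure (Ioi (0:ℝ)) := by rw [closure_Ioi]; exact self_mem_Ici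
      rw [_root_.mem_closure_iff]
      intro V hV hwV
      have h5 : (fun t : ℝ => w + ((s * t : ℝ) : ℂ)) ⁻¹' (V ∩ ball 0 1) ∈ 𝓝 (0:ℝ) :=
        ((hV.inter isOpen_ball).preimage hc).mem_nhds (by simpa using ⟨hwV, by simpa using hw⟩)
      obtain ⟨t, ht, ht0⟩ := mem_closure_iff_nhds.1 hcl _ h5
      refine ⟨_, ht.1, ht.2, ?_⟩
      simp only [mem_ofPred_eq, Complex.add_re, hwr, Complex.ofReal_re, zero_add]
      have : 0 < s * s := mul_self_pos.2 hs
      have ht0' : 0 < t := ht0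
      nlinarith [mul_pos this ht0']
    rcases lt_or_gt_of_ne hre with hlt | hlt
    · refine gen {z | 0 < (-1) * z.re} ?_ ?_ ?_ (fun w hw hw' => seq (-1) w (by norm_num) hw hw')
      · have := convex_halfSpace_re_lt 0
        simpa using this
      · simpa using hlt
      · intro w hw hh; simp [hh] at hw
    · refine gen {z | 0 < 1 * z.re} ?_ ?_ ?_ (fun w hw hw' => seq 1 w (by norm_num) hw hw')
      · have := convex_halfSpace_re_gt 0
        simpa using this
      · simpa using hlt
      · intro w hw hh; simp [hh] at hw
  obtain ⟨x, hx⟩ := hne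
  obtain ⟨w, hwA, ⟨V, hV, hwV, hVA⟩, hw⟩ := hA u (closure O)ᶜ huo isClosed_closure.isOpen_compl
    (fun z hz => by
      by_cases h : z ∈ closure O
      · exact Or.inl (hclu ⟨hz, h⟩)
      · exact Or.inr h) ⟨x, hx.1, hclu hx⟩ ⟨y, hyA, hy⟩
  exact hw (hVA ⟨hwV, hwA⟩)

theorem conn_compl [T2Space F] (hF : LocE F) {a a' B : Set F} {p p' : F} (ha : IsClosed a)
    (ha' : IsClosed a') (hdis : Disjoint a a') (hW : IsPreconnected (a ∪ a')ᶜ)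
    (hp : p ∈ a) (hp' : p' ∈ a') (hflat : ∀ x ∈ a, FlatAt a x) (hap : IsPreconnected (a \ {p}))
    (hB : Arc B p p') (hBW : B \ {p, p'} ⊆ (a ∪ a')ᶜ) (f : OpenPartialHomeomorph F ℂ)
    (hfa' : Disjoint f.source a') (hft : f.target = ball 0 1)
    (hfa : ∀ z ∈ f.source, z ∈ a ↔ (f z).re = 0)
    (hfB : ∀ z ∈ f.source, z ∈ B ↔ 0 ≤ (f z).re ∧ (f z).im = 0) :
    IsPreconnected ((a ∪ a')ᶜ \ B) := by
  obtain ⟨hpB, hpB', hBpre, hBflat⟩ := hB.interior hF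
  have hBc : IsClosed B := hB.isCompact.isClosed
  set W := (a ∪ a')ᶜ with hWdef
  have hWo : IsOpen W := (ha.union ha').isOpen_compl
  have haW : ∀ z ∈ a, z ∉ W := fun z hz h => h (Or.inl hz)
  have haW' : ∀ z ∈ a', z ∉ W := fun z hz h => h (Or.inr hz)
  have inW : ∀ w ∈ ball (0:ℂ) 1, w.re ≠ 0 → (w.re < 0 ∨ w.im ≠ 0) → f.symm w ∈ W \ B := by
    intro w hw h1 h2
    have hwt : w ∈ f.target := hft ▸ hw
    have hs := f.map_target hwt
    refine ⟨?_, ?_⟩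
    · rintro (h | h)
      · rw [hfa _ hs, f.right_inv hwt] at h; exact h1 h
      · exact hfa'.ne_of_mem hs h rfl
    · rw [hfB _ hs, f.right_inv hwt]
      rintro ⟨h3, h4⟩
      rcases h2 with h2 | h2
      · linarith
      · exact h2 h4
  have cl1 : ∀ (S : Set ℂ) (w : ℂ), w ∈ ball (0:ℂ) 1 → w ∈ closure S →
      f.symm w ∈ closure (f.symm '' S) := fun S w hw hcl =>
    ((f.symm.continuousAt (x := w) (by rw [f.symm_source, hft]; exact hw)).continuousWithinAt
      (s := S)).mem_closure_image hcl
  have cl2 : ∀ (O : Set F) (V : Set ℂ) (w : ℂ), w ∈ ball (0:ℂ) 1 → IsOpen V → w ∈ V →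
      f.symm w ∈ closure O → ∃ z ∈ V ∩ ball 0 1, f.symm z ∈ O := by
    intro O V w hw hV hwV hcl
    have ho : IsOpen (f.symm '' (V ∩ ball 0 1)) :=
      f.isOpen_image_symm_of_subset_target (hV.inter isOpen_ball) (by rw [hft]; exact inter_subset_right)
    obtain ⟨x, ⟨z, hz, rfl⟩, hx⟩ := mem_closure_iff.1 hcl _ ho ⟨w, ⟨hwV, hw⟩, rfl⟩
    exact ⟨z, hz, hx⟩
  have pre : ∀ S : Set ℂ, Convex ℝ S → S ⊆ ball 0 1 → IsPreconnected (f.symm '' S) := by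
    intro S hS hSb
    exact hS.isPreconnected.image _ (f.symm.continuousOn.mono (by rw [f.symm_source, hft]; exact hSb))
  set Q : ℝ → Set ℂ := fun s => ball 0 1 ∩ ({z | 0 < z.re} ∩ {z | 0 < s * z.im}) with hQ
  set L : Set ℂ := ball 0 1 ∩ {z | z.re < 0} with hL
  have Qconv : ∀ s, Convex ℝ (Q s) := fun s => by
    refine (convex_ball _ _).inter ((convex_halfSpace_re_gt 0).inter ?_)
    exact convex_halfSpace_gt (f := fun z : ℂ => s * z.im)
      ⟨fun x y => by simp [mul_add], fun c x => by simp; ring⟩ 0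
  have Lconv : Convex ℝ L := (convex_ball _ _).inter (convex_halfSpace_re_lt 0)
  have QW : ∀ s, f.symm '' Q s ⊆ W \ B := by
    rintro s _ ⟨w, ⟨hw, hw1, hw2⟩, rfl⟩
    refine inW w hw (ne_of_gt hw1) (Or.inr fun h => ?_)
    simp [h] at hw2
  have LW : f.symm '' L ⊆ W \ B := by
    rintro _ ⟨w, ⟨hw, hw1⟩, rfl⟩
    exact inW w hw (ne_of_lt hw1) (Or.inl hw1)
  -- points of the axis
  have axis : ∀ s : ℝ, s = 1 ∨ s = -1 → ∃ w ∈ ball (0:ℂ) 1, w ∈ closure (Q s) ∧ 0 < s * w.im ∧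
      w.re = 0 := by
    intro s hs
    have hss : s * s = 1 := by rcases hs with rfl | rfl <;> norm_num
    have hsa : |s| = 1 := by rcases hs with rfl | rfl <;> norm_num
    have hb : ‖((s / 2 : ℝ) : ℂ) * Complex.I‖ = 1 / 2 := by
      rw [norm_mul, Complex.norm_I, mul_one, Complex.norm_real, Real.norm_eq_abs, abs_div, hsa]
      norm_num
    refine ⟨((s / 2 : ℝ) : ℂ) * Complex.I, ?_, ?_, ?_, by simp⟩
    · rw [mem_ball_zero_iff, hb]; norm_num
    · rw [Metric.mem_closure_iff]
      intro ε hε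
      set δ := min (ε / 2) (1 / 4) with hδ
      have hδ0 : 0 < δ := by positivity
      have hδ1 : δ ≤ 1 / 4 := min_le_right _ _
      have hδ2 : δ ≤ ε / 2 := min_le_left _ _
      have hnδ : ‖(δ:ℂ)‖ = δ := by rw [Complex.norm_real, Real.norm_eq_abs, abs_of_pos hδ0]
      refine ⟨(δ:ℂ) + ((s / 2 : ℝ) : ℂ) * Complex.I, ⟨?_, ?_, ?_⟩, ?_⟩
      · rw [mem_ball_zero_iff]
        refine (norm_add_le _ _).trans_lt ?_
        rw [hb, hnδ]; linarith
      · simpa using hδ0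
      · simp only [mem_ofPred_eq]
        have : ((δ:ℂ) + ((s / 2 : ℝ) : ℂ) * Complex.I).im = s / 2 := by simp
        rw [this]; nlinarith
      · rw [dist_comm, dist_eq_norm, add_sub_cancel_right, hnδ]; linarith
    · have : (((s / 2 : ℝ) : ℂ) * Complex.I).im = s / 2 := by simp
      rw [this]; nlinarith
  have chA : ∀ O O' : Set F, O ∪ O' = W \ B → ∀ x ∈ a \ {p}, ∃ e : OpenPartialHomeomorph F ℂ,
      x ∈ e.source ∧ e.target = ball 0 1 ∧
      (∀ z ∈ e.source, z ∈ a \ {p} ↔ (e z).re = 0) ∧ e.source \ (a \ {p}) ⊆ O ∪ O' := by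
    intro O O' hOO x hx
    have hxB : x ∉ B := by
      intro h
      by_cases h2 : x = p'
      · exact hdis.ne_of_mem hx.1 hp' h2
      · exact haW x hx.1 (hBW ⟨h, by
          rintro (h3 | h3)
          · exact hx.2 h3
          · exact h2 h3⟩)
    have hxa' : x ∉ a' := fun h => hdis.ne_of_mem hx.1 h rfl
    obtain ⟨e, h1, h2, h3, h4, h5⟩ := hflat x hx.1 (a' ∪ B)ᶜ
      ((ha'.union hBc).isOpen_compl.mem_nhds (by simp [hxB, hxa']))
    have hzp : ∀ z ∈ e.source, z ≠ p := by
      rintro z hz rfl; exact h3 hz (Or.inr hpB)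
    refine ⟨e, h1, h4, fun z hz => ?_, ?_⟩
    · rw [← h5 z hz]; simp [hzp z hz]
    · rintro z ⟨hz, hza⟩
      rw [hOO]
      have hza2 : z ∉ a := fun h => hza ⟨h, hzp z hz⟩
      have := h3 hz
      simp only [mem_compl_iff, mem_union, not_or] at this
      exact ⟨by simp [hWdef, hza2, this.1], this.2⟩
  have chB : ∀ O O' : Set F, O ∪ O' = W \ B → ∀ x ∈ B \ {p, p'}, ∃ e : OpenPartialHomeomorph F ℂ,
      x ∈ e.source ∧ e.target = ball 0 1 ∧
      (∀ z ∈ e.source, z ∈ B \ {p, p'} ↔ (e z).re = 0) ∧ e.source \ (B \ {p, p'}) ⊆ O ∪ O' := by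
    intro O O' hOO x hx
    obtain ⟨e, h1, h2, h3, h4, h5⟩ := hBflat x hx W (hWo.mem_nhds (hBW hx))
    have hzp : ∀ z ∈ e.source, z ∉ ({p, p'} : Set F) := by
      rintro z hz (h | h)
      · exact haW z (h ▸ hp) (h3 hz)
      · exact haW' z (h ▸ hp') (h3 hz)
    refine ⟨e, h1, h4, fun z hz => ?_, ?_⟩
    · rw [← h5 z hz, mem_sdiff]
      exact and_iff_left (hzp z hz)
    · rintro z ⟨hz, hzB⟩
      rw [hOO]
      exact ⟨h3 hz, fun h => hzB ⟨h, hzp z hz⟩⟩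
  have fsa : ∀ w ∈ ball (0:ℂ) 1, w.re = 0 → w ≠ 0 → f.symm w ∈ a \ {p} := by
    intro w hw h h0
    have hwt : w ∈ f.target := hft ▸ hw
    refine ⟨(hfa _ (f.map_target hwt)).2 (by rw [f.right_inv hwt]; exact h), fun hh => ?_⟩
    have hpe : f.symm w ∈ B := by rw [show f.symm w = p from hh]; exact hpB
    rw [hfB _ (f.map_target hwt), f.right_inv hwt] at hpe
    exact h0 (Complex.ext h hpe.2)
  -- sectors on different sides
  have half : ∀ O O' : Set F, IsOpen O → IsOpen O' → Disjoint O O' → O ∪ O' = W \ B →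
      ∀ s : ℝ, s = 1 ∨ s = -1 → f.symm '' Q s ⊆ O → f.symm '' Q (-s) ⊆ O' →
      ∃ z ∈ L, f.symm z ∈ O := by
    intro O O' hO hO' hd hOO s hs h1 h2
    obtain ⟨w, hw, hwc, hwi, hwr⟩ := axis s hs
    obtain ⟨w', hw', hwc', hwi', hwr'⟩ := axis (-s) (by rcases hs with rfl | rfl <;> simp)
    have hw0 : w ≠ 0 := by rintro rfl; simp at hwi
    have hw0' : w' ≠ 0 := by rintro rfl; simp at hwi'
    have k1 : f.symm w ∈ closure O := closure_mono h1 (cl1 _ _ hw hwc)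
    have hOW : O ⊆ W \ B := hOO ▸ subset_union_left
    have k2 := propagate hap hO hO' hd
      (disjoint_left.2 fun z hz hzO => haW z hz.1 (hOW hzO).1) (chA O O' hOO)
      ⟨_, fsa w hw hwr hw0, k1⟩
    have k3 := k2 (fsa w' hw' hwr' hw0')
    obtain ⟨z, ⟨hz, hzb⟩, hzO⟩ := cl2 O {z | 0 < (-s) * z.im} w' hw'
      (isOpen_lt continuous_const (continuous_const.mul Complex.continuous_im)) hwi' k3
    rcases lt_trichotomy z.re 0 with h | h | h
    · exact ⟨z, ⟨hzb, h⟩, hzO⟩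
    · refine absurd (hOW hzO).1 (haW _ (fsa z hzb h ?_).1)
      rintro rfl; simp at hz
    · exact absurd rfl (hd.ne_of_mem hzO (h2 ⟨z, ⟨hzb, h, hz⟩, rfl⟩))
  have last : ∀ O O' : Set F, IsOpen O → IsOpen O' → Disjoint O O' → O ∪ O' = W \ B →
      f.symm '' Q 1 ⊆ O → f.symm '' Q (-1) ⊆ O → O.Nonempty → O'.Nonempty → False := by
    intro O O' hO hO' hd hOO h1 h2 hOn hOn'
    have hOW : O ⊆ W \ B := hOO ▸ subset_union_left
    have hOW' : O' ⊆ W \ B := hOO ▸ subset_union_right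
    have hempty : ∀ x ∈ B \ {p, p'}, x ∉ closure O' := by
      intro x hx hxO
      have k2 := propagate hBpre hO' hO hd.symm
        (disjoint_left.2 fun z hz hzO => (hOW' hzO).2 hz.1) (chB O' O (by rw [union_comm, hOO]))
        ⟨x, hx, hxO⟩
      have hhb : ((1 / 2 : ℝ) : ℂ) ∈ ball (0:ℂ) 1 := by
        rw [mem_ball_zero_iff, Complex.norm_real]; norm_num
      have hht : ((1 / 2 : ℝ) : ℂ) ∈ f.target := hft ▸ hhb
      have hhs := f.map_target hht
      have hyB : f.symm ((1 / 2 : ℝ) : ℂ) ∈ B \ {p, p'} := by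
        refine ⟨?_, ?_⟩
        · rw [hfB _ hhs, f.right_inv hht]; simp
        · rintro (h | h)
          · have h3 : f.symm ((1 / 2 : ℝ) : ℂ) ∈ a := by rw [h]; exact hp
            rw [hfa _ hhs, f.right_inv hht, Complex.ofReal_re] at h3
            norm_num at h3
          · have h3 : f.symm ((1 / 2 : ℝ) : ℂ) ∈ a' := by rw [show _ = p' from h]; exact hp'
            exact hfa'.ne_of_mem hhs h3 rfl
      obtain ⟨z, ⟨hz, hzb⟩, hzO⟩ := cl2 O' {z | 0 < z.re} _ hhb
        (isOpen_lt continuous_const Complex.continuous_re) (by simp) (k2 hyB)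
      have hzt : z ∈ f.target := hft ▸ hzb
      rcases lt_trichotomy z.im 0 with h | h | h
      · exact hd.ne_of_mem (h2 ⟨z, ⟨hzb, hz, by simpa using h⟩, rfl⟩) hzO rfl
      · refine (hOW' hzO).2 ((hfB _ (f.map_target hzt)).2 ?_)
        rw [f.right_inv hzt]; exact ⟨le_of_lt hz, h⟩
      · exact hd.ne_of_mem (h1 ⟨z, ⟨hzb, hz, by simpa using h⟩, rfl⟩) hzO rfl
    have hOcl : ∀ x ∈ O, x ∉ closure O' := fun x hx h => by
      obtain ⟨z, hz, hz'⟩ := mem_closure_iff.1 h O hO hx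
      exact hd.ne_of_mem hz hz' rfl
    obtain ⟨x, hx⟩ := hOn
    obtain ⟨y, hy⟩ := hOn'
    obtain ⟨z, -, hz1, hz2⟩ := hW O' (closure O')ᶜ hO' isClosed_closure.isOpen_compl (fun z hz => by
      by_cases h : z ∈ closure O'
      · left
        by_cases hzB : z ∈ B
        · refine absurd h (hempty z ⟨hzB, ?_⟩)
          rintro (h | h)
          · exact haW z (h ▸ hp) hz
          · exact haW' z (h ▸ hp') hz
        · have : z ∈ O ∪ O' := hOO ▸ ⟨hz, hzB⟩
          rcases this with h3 | h3
          · exact absurd h (hOcl z h3)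
          · exact h3
      · exact Or.inr h) ⟨y, (hOW' hy).1, hy⟩ ⟨x, (hOW hx).1, hOcl x hx⟩
    exact hz2 (subset_closure hz1)
  intro u v hu hv huv hun hvn
  by_contra hcon
  have hWB : IsOpen (W \ B) := hWo.sdiff hBc
  set O := (W \ B) ∩ u with hO
  set O' := (W \ B) ∩ v with hO'
  have oO : IsOpen O := hWB.inter hu
  have oO' : IsOpen O' := hWB.inter hv
  have hd : Disjoint O O' := disjoint_left.2 fun z hz hz' => hcon ⟨z, hz.1, hz.2, hz'.2⟩
  have hOO : O ∪ O' = W \ B := by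
    rw [hO, hO', ← inter_union_distrib_left]; exact inter_eq_left.2 huv
  have hOO' : O' ∪ O = W \ B := by rw [union_comm, hOO]
  have dich : ∀ S : Set F, IsPreconnected S → S ⊆ W \ B → S ⊆ O ∨ S ⊆ O' := by
    intro S hS hSW
    rcases S.eq_empty_or_nonempty with rfl | ⟨x, hx⟩
    · left; exact empty_subset _
    have hSO : S ⊆ O ∪ O' := hOO ▸ hSW
    rcases hSO hx with h | h
    · exact Or.inl (hS.subset_left_of_subset_union oO oO' hd hSO ⟨x, hx, h⟩)
    · exact Or.inr (hS.subset_right_of_subset_union oO oO' hd hSO ⟨x, hx, h⟩)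
  have mixed : ∀ O O' : Set F, IsOpen O → IsOpen O' → Disjoint O O' → O ∪ O' = W \ B →
      f.symm '' Q 1 ⊆ O → f.symm '' Q (-1) ⊆ O' → False := by
    intro O O' hO hO' hd hOO h1 h2
    obtain ⟨z, hz, hzO⟩ := half O O' hO hO' hd hOO 1 (Or.inl rfl) h1 h2
    obtain ⟨z', hz', hzO'⟩ := half O' O hO' hO hd.symm (by rw [union_comm, hOO]) (-1) (Or.inr rfl) h2
      (by rw [neg_neg]; exact h1)
    have := (pre L Lconv inter_subset_left).subset_left_of_subset_union hO hO' hd (by rw [hOO]; exact LW)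
      ⟨f.symm z, mem_image_of_mem _ hz, hzO⟩
    exact hd.ne_of_mem (this ⟨z', hz', rfl⟩) hzO' rfl
  have d1 := dich _ (pre (Q 1) (Qconv 1) inter_subset_left) (QW 1)
  have d2 := dich _ (pre (Q (-1)) (Qconv (-1)) inter_subset_left) (QW (-1))
  rcases d1 with d1 | d1 <;> rcases d2 with d2 | d2
  · exact last O O' oO oO' hd hOO d1 d2 hun hvn
  · exact mixed O O' oO oO' hd hOO d1 d2
  · exact mixed O' O oO' oO hd.symm hOO' d1 d2
  · exact last O' O oO' oO hd.symm hOO' d1 d2 hvn hun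
end conn
end Part13

section Part14
section main
variable {F : Type*} [TopologicalSpace F]

lemma scc_props [T2Space F] (hF : LocE F) {a : Set F} (h : Nonempty (↥a ≃ₜ ↥(sphere (0:ℂ) 1))) :
    IsClosed a ∧ a.Nonempty ∧ (∀ x ∈ a, FlatAt a x) ∧ ∀ p ∈ a, IsPreconnected (a \ {p}) := by
  obtain ⟨h⟩ := h
  have hmem : ∀ t : ℝ, cis t ∈ sphere (0:ℂ) 1 := fun t => by simp [norm_cis]
  set c : ℝ → F := fun t => (h.symm ⟨cis t, hmem t⟩ : F) with hc
  have hcc : Continuous c :=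
    continuous_subtype_val.comp (h.symm.continuous.comp (continuous_cis.subtype_mk hmem))
  have hinj : ∀ s t, c s = c t ↔ cis s = cis t := by
    intro s t
    rw [hc]
    constructor
    · intro hh
      have := h.symm.injective (Subtype.val_injective hh)
      simpa using this
    · intro hh; simp [hh]
  have hca : ∀ t, c t ∈ a := fun t => Subtype.coe_prop _
  have hsurj : ∀ θ₀, ∀ x ∈ a, ∃ t ∈ Ico θ₀ (θ₀ + 2 * Real.pi), c t = x := by
    intro θ₀ x hx
    have hn : ‖((h ⟨x, hx⟩ : sphere (0:ℂ) 1) : ℂ)‖ = 1 := by simp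
    obtain ⟨t, ht, hte⟩ := exists_cis_Ico θ₀ hn
    refine ⟨t, ht, ?_⟩
    have : (⟨cis t, hmem t⟩ : sphere (0:ℂ) 1) = h ⟨x, hx⟩ := Subtype.ext hte
    simp [hc, this]
  have hinj2 : ∀ s t, |s - t| < 2 * Real.pi → c s = c t → s = t := by
    intro s t hst hh
    rw [hinj, cis_eq_iff] at hh
    obtain ⟨n, hn⟩ := hh
    have hpi := Real.pi_pos
    have h1 : |(n:ℝ)| < 1 := by
      have : s - t = n * (2 * Real.pi) := by linarith
      rw [this, abs_mul, abs_of_pos (by linarith : 0 < 2 * Real.pi)] at hst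
      by_contra hcon
      push Not at hcon
      nlinarith
    have h2 : n = 0 := by
      have : |n| < 1 := by exact_mod_cast h1
      exact Int.abs_lt_one_iff.1 this
    simp [h2] at hn
    exact hn
  have hper : ∀ t, c (t + 2 * Real.pi) = c t := fun t => by rw [hinj, cis_two_pi]
  have hpi := Real.pi_gt_three
  have hcomp : IsCompact a := by
    have : CompactSpace a := h.symm.compactSpace
    exact isCompact_iff_compactSpace.2 this
  refine ⟨hcomp.isClosed, ⟨_, hca 0⟩, ?_, ?_⟩
  · intro x hx
    obtain ⟨θ, -, rfl⟩ := hsurj 0 x hx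
    have hi : InjOn c (Icc (θ - 1) (θ + 1)) := by
      intro s hs t ht hh
      refine hinj2 s t ?_ hh
      rw [abs_lt]; constructor <;> linarith [hs.1, hs.2, ht.1, ht.2]
    have hf := surface_flat hF (t₀ := θ) hcc.continuousOn hi ⟨by linarith, by linarith⟩
    refine hf.congr ?_
    have hK : IsCompact (c '' Icc (θ + 1) (θ - 1 + 2 * Real.pi)) :=
      isCompact_Icc.image hcc
    have hn : c θ ∉ c '' Icc (θ + 1) (θ - 1 + 2 * Real.pi) := by
      rintro ⟨t, ht, hh⟩
      have := hinj2 t θ (by rw [abs_lt]; constructor <;> linarith [ht.1, ht.2]) hh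
      linarith [ht.1]
    filter_upwards [hK.isClosed.isOpen_compl.mem_nhds hn] with z hz
    constructor
    · rintro ⟨t, -, rfl⟩; exact hca t
    · intro hza
      obtain ⟨t, ht, rfl⟩ := hsurj (θ - 1) z hza
      refine ⟨t, ⟨ht.1, ?_⟩, rfl⟩
      by_contra hcon
      exact hz ⟨t, ⟨(not_le.1 hcon).le, ht.2.le⟩, rfl⟩
  · intro x hx
    obtain ⟨θ, -, rfl⟩ := hsurj 0 x hx
    have : a \ {c θ} = c '' Ioo θ (θ + 2 * Real.pi) := by
      ext z
      constructor
      · rintro ⟨hz, hne⟩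
        obtain ⟨t, ht, rfl⟩ := hsurj θ z hz
        exact ⟨t, ⟨lt_of_le_of_ne ht.1 (fun h => hne (by rw [h]; rfl)), ht.2⟩, rfl⟩
      · rintro ⟨t, ht, rfl⟩
        refine ⟨hca t, fun hh => ?_⟩
        have := hinj2 t θ (by rw [abs_lt]; constructor <;> linarith [ht.1, ht.2]) hh
        linarith [ht.1]
    rw [this]
    exact isPreconnected_Ioo.image _ hcc.continuousOn

lemma two_arcs_circle [T2Space F] {B B' : Set F} {p p' : F} (h : Arc B p p') (h' : Arc B' p p')
    (hne : p ≠ p') (hBB : B ∩ B' ⊆ {p, p'}) : Nonempty (↥(B ∪ B') ≃ₜ ↥(sphere (0:ℂ) 1)) := by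
  obtain ⟨c, T, hT, hc, hi, rfl, hc0, hc1⟩ := h
  obtain ⟨d, S, hS, hd, hj, rfl, hd0, hd1⟩ := h'
  have hT0 : 0 < T := lt_of_le_of_ne hT (by rintro rfl; exact hne (hc0.symm.trans hc1))
  have hS0 : 0 < S := lt_of_le_of_ne hS (by rintro rfl; exact hne (hd0.symm.trans hd1))
  have hre : ∀ u ∈ sphere (0:ℂ) 1, u.re ^ 2 + u.im ^ 2 = 1 := by
    intro u hu
    rw [mem_sphere_zero_iff_norm] at hu
    have := Complex.sq_norm u
    rw [hu, Complex.normSq_apply] at this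
    nlinarith
  have hre1 : ∀ u ∈ sphere (0:ℂ) 1, -1 ≤ u.re ∧ u.re ≤ 1 := by
    intro u hu
    have := hre u hu
    constructor <;> nlinarith [sq_nonneg u.im]
  have hpar : ∀ R, 0 < R → ∀ u ∈ sphere (0:ℂ) 1, R * ((1 - u.re) / 2) ∈ Icc 0 R := by
    intro R hR u hu
    have := hre1 u hu
    constructor <;> nlinarith
  set G : ℂ → F := fun u => if 0 ≤ u.im then c (T * ((1 - u.re) / 2)) else d (S * ((1 - u.re) / 2))
    with hG
  have g1 : ∀ u ∈ sphere (0:ℂ) 1 ∩ {u | 0 ≤ u.im}, G u = c (T * ((1 - u.re) / 2)) := by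
    rintro u ⟨-, hu⟩; have : 0 ≤ u.im := hu; simp [hG, this]
  have g2 : ∀ u ∈ sphere (0:ℂ) 1 ∩ {u | u.im ≤ 0}, G u = d (S * ((1 - u.re) / 2)) := by
    rintro u ⟨hu1, hu⟩
    rcases (show u.im ≤ 0 from hu).eq_or_lt with h | h
    · have h1 := hre u hu1
      have h2 : (u.re - 1) * (u.re + 1) = 0 := by rw [h] at h1; nlinarith
      have h3 : G u = c (T * ((1 - u.re) / 2)) := g1 u ⟨hu1, h.ge⟩
      rw [h3]
      rcases mul_eq_zero.1 h2 with h4 | h4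
      · rw [show u.re = 1 by linarith]; simp [hc0, hd0]
      · rw [show u.re = -1 by linarith]; norm_num [hc1, hd1]
    · simp [hG, not_le.2 h]
  have hU : sphere (0:ℂ) 1 = (sphere (0:ℂ) 1 ∩ {u | 0 ≤ u.im}) ∪ (sphere (0:ℂ) 1 ∩ {u | u.im ≤ 0}) := by
    rw [← inter_union_distrib_left, eq_comm, inter_eq_left]
    intro u _; exact le_total 0 u.im
  have hGc : ContinuousOn G (sphere (0:ℂ) 1) := by
    rw [hU]
    refine ContinuousOn.union_of_isClosed ?_ ?_
      (isClosed_sphere.inter (isClosed_le continuous_const Complex.continuous_im))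
      (isClosed_sphere.inter (isClosed_le Complex.continuous_im continuous_const))
    · refine ContinuousOn.congr ?_ g1
      exact hc.comp (f := fun u : ℂ => T * ((1 - u.re) / 2)) (by fun_prop) fun u hu => hpar T hT0 u hu.1
    · refine ContinuousOn.congr ?_ g2
      exact hd.comp (f := fun u : ℂ => S * ((1 - u.re) / 2)) (by fun_prop) fun u hu => hpar S hS0 u hu.1
  have i1 : ∀ R, 0 < R → ∀ u v : ℂ, R * ((1 - u.re) / 2) = R * ((1 - v.re) / 2) → u.re = v.re := by
    intro R hR u v h
    have := mul_left_cancel₀ hR.ne' h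
    linarith
  have cross : ∀ u ∈ sphere (0:ℂ) 1 ∩ {u | 0 ≤ u.im}, ∀ v ∈ sphere (0:ℂ) 1 ∩ {u | u.im ≤ 0},
      G u = G v → u = v := by
    intro u hu v hv h
    rw [g1 u hu, g2 v hv] at h
    have h1 := hBB ⟨⟨_, hpar T hT0 u hu.1, rfl⟩, ⟨_, hpar S hS0 v hv.1, h.symm⟩⟩
    have hu2 := hre u hu.1
    have hv2 := hre v hv.1
    rcases h1 with h1 | h1
    · have k1 := hi (hpar T hT0 u hu.1) ⟨le_rfl, hT⟩ (h1.trans hc0.symm)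
      have k2 := hj (hpar S hS0 v hv.1) ⟨le_rfl, hS⟩ (h.symm.trans (h1.trans hd0.symm))
      have r1 : u.re = 1 := by
        rcases mul_eq_zero.1 k1 with h | h <;> linarith
      have r2 : v.re = 1 := by
        rcases mul_eq_zero.1 k2 with h | h <;> linarith
      apply Complex.ext (by rw [r1, r2])
      rw [r1] at hu2
      rw [r2] at hv2
      have q1 : u.im = 0 := by nlinarith
      have q2 : v.im = 0 := by nlinarith
      rw [q1, q2]
    · have k1 := hi (hpar T hT0 u hu.1) ⟨hT, le_rfl⟩ (h1.trans hc1.symm)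
      have k2 := hj (hpar S hS0 v hv.1) ⟨hS, le_rfl⟩ (h.symm.trans (h1.trans hd1.symm))
      have r1 : u.re = -1 := by
        have := mul_left_cancel₀ hT0.ne' (k1.trans (mul_one T).symm)
        linarith
      have r2 : v.re = -1 := by
        have := mul_left_cancel₀ hS0.ne' (k2.trans (mul_one S).symm)
        linarith
      apply Complex.ext (by rw [r1, r2])
      rw [r1] at hu2
      rw [r2] at hv2
      have q1 : u.im = 0 := by nlinarith
      have q2 : v.im = 0 := by nlinarith
      rw [q1, q2]
  have hGi : InjOn G (sphere (0:ℂ) 1) := by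
    intro u hu v hv h
    have hu2 := hre u hu
    have hv2 := hre v hv
    rcases le_total 0 u.im with a1 | a1 <;> rcases le_total 0 v.im with a2 | a2
    · rw [g1 u ⟨hu, a1⟩, g1 v ⟨hv, a2⟩] at h
      have k := i1 T hT0 u v (hi (hpar T hT0 u hu) (hpar T hT0 v hv) h)
      apply Complex.ext k
      rw [k] at hu2
      exact (sq_eq_sq₀ a1 a2).1 (by linarith)
    · exact cross u ⟨hu, a1⟩ v ⟨hv, a2⟩ h
    · exact (cross v ⟨hv, a2⟩ u ⟨hu, a1⟩ h.symm).symm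
    · rw [g2 u ⟨hu, a1⟩, g2 v ⟨hv, a2⟩] at h
      have k := i1 S hS0 u v (hj (hpar S hS0 u hu) (hpar S hS0 v hv) h)
      apply Complex.ext k
      rw [k] at hu2
      have := (sq_eq_sq₀ (neg_nonneg.2 a1) (neg_nonneg.2 a2)).1 (by rw [neg_sq, neg_sq]; linarith)
      linarith
  have pt : ∀ x : ℝ, x ∈ Icc (0:ℝ) 1 → ∀ s : ℝ, s = 1 ∨ s = -1 →
      (⟨1 - 2 * x, s * Real.sqrt (1 - (1 - 2 * x) ^ 2)⟩ : ℂ) ∈ sphere (0:ℂ) 1 := by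
    intro x hx s hs
    rw [mem_sphere_zero_iff_norm, ← sq_eq_sq₀ (norm_nonneg _) zero_le_one, Complex.sq_norm,
      Complex.normSq_apply]
    have h1 : 0 ≤ 1 - (1 - 2 * x) ^ 2 := by nlinarith [hx.1, hx.2]
    have h2 := Real.mul_self_sqrt h1
    have hss : s * s = 1 := by rcases hs with rfl | rfl <;> norm_num
    simp only
    nlinarith
  have hGimg : G '' sphere (0:ℂ) 1 = c '' Icc 0 T ∪ d '' Icc 0 S := by
    apply subset_antisymm
    · rintro _ ⟨u, hu, rfl⟩
      rcases le_total 0 u.im with a1 | a1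
      · rw [g1 u ⟨hu, a1⟩]; exact Or.inl ⟨_, hpar T hT0 u hu, rfl⟩
      · rw [g2 u ⟨hu, a1⟩]; exact Or.inr ⟨_, hpar S hS0 u hu, rfl⟩
    · rintro _ (⟨t, ht, rfl⟩ | ⟨t, ht, rfl⟩)
      · have hx : t / T ∈ Icc (0:ℝ) 1 := ⟨div_nonneg ht.1 hT, (div_le_one hT0).2 ht.2⟩
        have hm := pt _ hx 1 (Or.inl rfl)
        refine ⟨_, hm, ?_⟩
        rw [g1 _ ⟨hm, by simp [Real.sqrt_nonneg]⟩]
        congr 1; field_simp; ring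
      · have hx : t / S ∈ Icc (0:ℝ) 1 := ⟨div_nonneg ht.1 hS, (div_le_one hS0).2 ht.2⟩
        have hm := pt _ hx (-1) (Or.inr rfl)
        refine ⟨_, hm, ?_⟩
        rw [g2 _ ⟨hm, by simp [Real.sqrt_nonneg]⟩]
        congr 1; field_simp; ring
  have hemb : IsEmbedding ((sphere (0:ℂ) 1).domRestrict G) := by
    have hcont : Continuous ((sphere (0:ℂ) 1).domRestrict G) := continuousOn_iff_continuous_domRestrict.1 hGc
    exact (hcont.isClosedEmbedding (injOn_iff_injective.1 hGi)).isEmbedding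
  have hrange : range ((sphere (0:ℂ) 1).domRestrict G) = c '' Icc 0 T ∪ d '' Icc 0 S := by
    rw [range_domRestrict, hGimg]
  exact ⟨(hemb.toHomeomorph.trans (Homeomorph.setCongr hrange)).symm⟩

/-- crossing charts -/
def Cross (C C' : Set F) : Prop := ∃ p, C ∩ C' = {p} ∧ ∃ f : OpenPartialHomeomorph F ℂ,
  p ∈ f.source ∧ f p = 0 ∧ (∀ z ∈ f.source, z ∈ C ↔ (f z).im = 0) ∧
  ∀ z ∈ f.source, z ∈ C' ↔ (f z).re = 0

theorem main_surface [T2Space F] (hF : LocE F) {a a' : Set F}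
    (ha : Nonempty (↥a ≃ₜ ↥(sphere (0:ℂ) 1))) (ha' : Nonempty (↥a' ≃ₜ ↥(sphere (0:ℂ) 1)))
    (hdis : Disjoint a a') (hW : IsPreconnected (a ∪ a')ᶜ) :
    ∃ b : Set F, Nonempty (↥b ≃ₜ ↥(sphere (0:ℂ) 1)) ∧ Cross b a ∧ Cross b a' := by
  obtain ⟨hac, ⟨p, hp⟩, hflat, hpun⟩ := scc_props hF ha
  obtain ⟨hac', ⟨p', hp'⟩, hflat', -⟩ := scc_props hF ha'
  have hpp : p ≠ p' := hdis.ne_of_mem hp hp'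
  have hpa' : p ∉ a' := fun h => hdis.ne_of_mem hp h rfl
  have hpa : p' ∉ a := fun h => hdis.ne_of_mem h hp' rfl
  obtain ⟨U, V, hU, hV, hpU, hpV, hUV⟩ := t2_separation hpp
  obtain ⟨e, e1, e2, e3, e4, e5⟩ := hflat p hp (a'ᶜ ∩ U)
    ((hac'.isOpen_compl.inter hU).mem_nhds ⟨hpa', hpU⟩)
  obtain ⟨e', e1', e2', e3', e4', e5'⟩ := hflat' p' hp' (aᶜ ∩ V)
    ((hac.isOpen_compl.inter hV).mem_nhds ⟨hpa, hpV⟩)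
  have hdd : Disjoint e.source e'.source :=
    hUV.mono (fun z hz => (e3 hz).2) (fun z hz => (e3' hz).2)
  have hWo : IsOpen (a ∪ a')ᶜ := (hac.union hac').isOpen_compl
  have tgt : ∀ (e : OpenPartialHomeomorph F ℂ), e.target = ball 0 1 → ∀ z : ℂ, ‖z‖ ≤ 1 / 2 →
      z ∈ e.target := fun e he z hz => by
    rw [he, mem_ball_zero_iff]; linarith
  obtain ⟨B, hB, hBW, f, f', hf, hf'⟩ := truncArc hF hWo hW e1 e1' e2 e2' e4 e4'
    (ρ := 1 / 2) (by norm_num) (by norm_num)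
    (fun z hz hzr => by
      have hzt := tgt e e4 z hz
      have hs := e.map_target hzt
      rintro (h | h)
      · rw [e5 _ hs, e.right_inv hzt] at h; exact hzr.ne' h
      · exact (e3 hs).1 h)
    (fun z hz hzr => by
      have hzt := tgt e' e4' z hz
      have hs := e'.map_target hzt
      rintro (h | h)
      · exact (e3' hs).1 h
      · rw [e5' _ hs, e'.right_inv hzt] at h; exact hzr.ne' h)
    (fun z hz hzr h => h (Or.inl (by
      have hzt := tgt e e4 z hz
      rw [e5 _ (e.map_target hzt), e.right_inv hzt]; exact hzr)))
    (fun z hz hzr h => h (Or.inr (by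
      have hzt := tgt e' e4' z hz
      rw [e5' _ (e'.map_target hzt), e'.right_inv hzt]; exact hzr)))
    hdd
  obtain ⟨f1, f2, f3, f4, ⟨r, hr, f5, f6⟩, f7⟩ := hf
  obtain ⟨f1', f2', f3', f4', ⟨r', hr', f5', f6'⟩, f7'⟩ := hf'
  have fa : ∀ z ∈ f.source, z ∈ a ↔ (f z).re = 0 := fun z hz => by
    rw [e5 z (f3 hz), f5, mul_eq_zero_iff_right hr.ne']
  have fa' : ∀ z ∈ f'.source, z ∈ a' ↔ (f' z).re = 0 := fun z hz => by
    rw [e5' z (f3' hz), f5', mul_eq_zero_iff_right hr'.ne']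
  have fd : Disjoint f.source a' := disjoint_left.2 fun z hz h => (e3 (f3 hz)).1 h
  have fd' : Disjoint f'.source a := disjoint_left.2 fun z hz h => (e3' (f3' hz)).1 h
  have hW2 := conn_compl hF hac hac' hdis hW hp hp' hflat (hpun p hp) hB hBW f fd f4 fa f7
  have hBc : IsClosed B := hB.isCompact.isClosed
  set n := (Homeomorph.neg ℂ).toOpenPartialHomeomorph with hn
  have ntgt : ∀ f : OpenPartialHomeomorph F ℂ, f.target = ball 0 1 → (f.trans n).target = ball 0 1 := by
    intro f hf
    ext z
    simp [hn, hf]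
  obtain ⟨B2, hB2, hBW2, k, k', hk, hk'⟩ := truncArc hF (hWo.sdiff hBc) hW2
    (e := f.trans n) (e' := f'.trans n) (p := p) (p' := p')
    (by simp [f1, hn]) (by simp [f1', hn]) (by simp [f2, hn]) (by simp [f2', hn])
    (ntgt f f4) (ntgt f' f4')
    (ρ := 1 / 2) (by norm_num) (by norm_num)
    (fun z hz hzr => by
      have hzt : -z ∈ f.target := tgt f f4 (-z) (by simpa using hz)
      have hs := f.map_target hzt
      have he : (f.trans n).symm z = f.symm (-z) := by simp [hn]
      rw [he]
      refine ⟨?_, fun h => ?_⟩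
      · rintro (h | h)
        · rw [fa _ hs, f.right_inv hzt] at h; simp at h; exact hzr.ne' h
        · exact fd.ne_of_mem hs h rfl
      · rw [f7 _ hs, f.right_inv hzt] at h
        have := h.1
        simp at this; linarith)
    (fun z hz hzr => by
      have hzt : -z ∈ f'.target := tgt f' f4' (-z) (by simpa using hz)
      have hs := f'.map_target hzt
      have he : (f'.trans n).symm z = f'.symm (-z) := by simp [hn]
      rw [he]
      refine ⟨?_, fun h => ?_⟩
      · rintro (h | h)
        · exact fd'.ne_of_mem hs h rfl
        · rw [fa' _ hs, f'.right_inv hzt] at h; simp at h; exact hzr.ne' h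
      · rw [f7' _ hs, f'.right_inv hzt] at h
        have := h.1
        simp at this; linarith)
    (fun z hz hzr h => h.1 (Or.inl (by
      have hzt : -z ∈ f.target := tgt f f4 (-z) (by simpa using hz)
      have he : (f.trans n).symm z = f.symm (-z) := by simp [hn]
      rw [he, fa _ (f.map_target hzt), f.right_inv hzt]; simpa using hzr)))
    (fun z hz hzr h => h.1 (Or.inr (by
      have hzt : -z ∈ f'.target := tgt f' f4' (-z) (by simpa using hz)
      have he : (f'.trans n).symm z = f'.symm (-z) := by simp [hn]
      rw [he, fa' _ (f'.map_target hzt), f'.right_inv hzt]; simpa using hzr)))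
    (by simpa [hn] using hdd.mono f3 f3')
  have fin : ∀ (f k : OpenPartialHomeomorph F ℂ) (a : Set F) (p : F),
      (∀ z ∈ f.source, z ∈ a ↔ (f z).re = 0) →
      (∀ z ∈ f.source, z ∈ B ↔ 0 ≤ (f z).re ∧ (f z).im = 0) →
      Adapted (f.trans n) k B2 p → ∃ f : OpenPartialHomeomorph F ℂ,
        p ∈ f.source ∧ f p = 0 ∧ (∀ z ∈ f.source, z ∈ B ∪ B2 ↔ (f z).im = 0) ∧
        ∀ z ∈ f.source, z ∈ a ↔ (f z).re = 0 := by
    rintro f k a p fa fB ⟨k1, k2, k3, k4, ⟨s, hs, k5, k6⟩, k7⟩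
    have hfn : ∀ z, (f.trans n) z = - f z := fun z => by simp [hn]
    simp only [hfn, Complex.neg_re] at k5 k6
    have ks : k.source ⊆ f.source := fun z hz => by simpa [hn] using k3 hz
    refine ⟨k, k1, k2, fun z hz => ?_, fun z hz => ?_⟩
    · rw [mem_union, fB z (ks hz), k7 z hz]
      rcases le_or_gt 0 (f z).re with h | h
      · have h1 : (k z).im = -(f z).im * s := by
          rw [k6 z (by linarith), Complex.im_mul_ofReal, Complex.neg_im]
        have h2 : (k z).im = 0 ↔ (f z).im = 0 := by
          rw [h1, mul_eq_zero_iff_right hs.ne', neg_eq_zero]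
        rw [h2]; tauto
      · have h1 : 0 ≤ (k z).re := by rw [k5]; exact mul_nonneg (by linarith) hs.le
        have h2 := not_le.2 h
        tauto
    · rw [fa z (ks hz), k5, mul_eq_zero_iff_right hs.ne', neg_eq_zero]
  obtain ⟨hpB, hpB', -, -⟩ := hB.interior hF
  obtain ⟨hpB2, hpB2', -, -⟩ := hB2.interior hF
  have hall : ∀ z ∈ B ∪ B2, z ∉ (a ∪ a')ᶜ → z = p ∨ z = p' := by
    rintro z (hz | hz) hzW
    · by_contra hcon; exact hzW (hBW ⟨hz, hcon⟩)
    · by_contra hcon; exact hzW (hBW2 ⟨hz, hcon⟩).1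
  refine ⟨B ∪ B2, two_arcs_circle hB hB2 hpp ?_, ⟨p, ?_, fin f k a p fa f7 hk⟩,
    ⟨p', ?_, fin f' k' a' p' fa' f7' hk'⟩⟩
  · rintro z ⟨hz, hz2⟩
    by_contra hcon
    exact (hBW2 ⟨hz2, hcon⟩).2 hz
  · ext z
    constructor
    · rintro ⟨hz, hza⟩
      rcases hall z hz (fun h => h (Or.inl hza)) with h | h
      · exact h
      · exact absurd (h ▸ hza) hpa
    · rintro rfl; exact ⟨Or.inl hpB, hp⟩
  · ext z
    constructor
    · rintro ⟨hz, hza⟩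
      rcases hall z hz (fun h => h (Or.inr hza)) with h | h
      · exact absurd (h ▸ hza) hpa'
      · exact h
    · rintro rfl; exact ⟨Or.inl hpB', hp'⟩
end main
end Part14

section Part15
section model

lemma chart_of {X : Type*} [TopologicalSpace X] {S O : Set X} {V : Set ℂ} {φ : X → ℂ} {γ : ℂ → X}
    (hO : IsOpen O) (hV : IsOpen V) (hφ : ContinuousOn φ (S ∩ O)) (hγ : ContinuousOn γ V)
    (m1 : ∀ x ∈ S ∩ O, φ x ∈ V) (m2 : ∀ w ∈ V, γ w ∈ S ∩ O) (l : ∀ x ∈ S ∩ O, γ (φ x) = x)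
    (r : ∀ w ∈ V, φ (γ w) = w) (q : S) (hq : (q : X) ∈ O) :
    ∃ e : OpenPartialHomeomorph S ℂ, q ∈ e.source := by
  classical
  set inv : ℂ → S := fun w => if h : γ w ∈ S then ⟨γ w, h⟩ else q with hinv
  have hinv1 : ∀ w ∈ V, (inv w : X) = γ w := fun w hw => by simp [hinv, (m2 w hw).1]
  refine ⟨{ toFun := fun x => φ x, invFun := inv, source := Subtype.val ⁻¹' O, target := V,
            map_source' := fun x hx => m1 x ⟨x.2, hx⟩
            map_target' := fun w hw => by rw [mem_preimage, hinv1 w hw]; exact (m2 w hw).2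
            left_inv' := fun x hx => Subtype.ext (by
              rw [hinv1 _ (m1 x ⟨x.2, hx⟩)]; exact l x ⟨x.2, hx⟩)
            right_inv' := fun w hw => by rw [hinv1 w hw]; exact r w hw
            open_source := hO.preimage continuous_subtype_val
            open_target := hV
            continuousOn_toFun := hφ.comp continuous_subtype_val.continuousOn fun x hx => ⟨x.2, hx⟩
            continuousOn_invFun := by
              rw [IsInducing.subtypeVal.continuousOn_iff]
              exact hγ.congr hinv1 }, hq⟩

/-- half-plane charts for planar domains -/
lemma edge_chart {P : Set ℂ} {z₀ c : ℂ} {R σ : ℝ} (hR : 0 < R) (hz : ‖z₀ - c‖ = R) (hσ : σ = 1 ∨ σ = -1)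
    (hP : ∀ᶠ z in 𝓝 z₀, z ∈ P ↔ 0 ≤ σ * Real.log (‖z - c‖ / R)) :
    ∃ ψ : OpenPartialHomeomorph ℂ ℂ, z₀ ∈ ψ.source ∧ ∀ z ∈ ψ.source, z ∈ P ↔ 0 ≤ (ψ z).re := by
  have hσ0 : (σ:ℂ) ≠ 0 := by rcases hσ with rfl | rfl <;> simp
  have hzc : z₀ - c ≠ 0 := by rw [← norm_pos_iff, hz]; exact hR
  obtain ⟨N, hN, hNo, hN0⟩ := _root_.eventually_nhds_iff.1 hP
  set ψ := ((((Homeomorph.addRight (-c)).trans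
    (Homeomorph.mulRight₀ ((z₀ - c)⁻¹) (inv_ne_zero hzc))).toOpenPartialHomeomorph.trans
    Complex.expOpenPartialHomeomorph.symm).trans
    (Homeomorph.mulRight₀ (σ:ℂ) hσ0).toOpenPartialHomeomorph).restrOpen N hNo with hψ
  have hv : ∀ z, ψ z = Complex.log ((z - c) * (z₀ - c)⁻¹) * σ := by
    intro z
    have : ∀ w, Complex.expOpenPartialHomeomorph.symm w = Complex.log w := fun w => rfl
    simp [hψ, this, sub_eq_add_neg]
  have hs : ψ.source ⊆ N := by intro z hz; simp [hψ] at hz; exact hz.2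
  refine ⟨ψ, ?_, fun z hzs => ?_⟩
  · have : Complex.expOpenPartialHomeomorph.target = Complex.slitPlane := rfl
    simp [hψ, hN0, this, ← sub_eq_add_neg, hzc]
  · rw [hN z (hs hzs), hv, Complex.re_mul_ofReal, Complex.log_re, norm_mul, norm_inv, hz, mul_comm,
      div_eq_mul_inv]

lemma planar_edge (g : ℕ) {P : Set ℂ}
    (hP : P = closedBall (0:ℂ) (g + 1) \ ⋃ i ∈ Finset.range g, ball (i : ℂ) (1/4)) {z₀ : ℂ}
    (h1 : z₀ ∈ P) (h2 : z₀ ∉ interior P) :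
    ∃ ψ : OpenPartialHomeomorph ℂ ℂ, z₀ ∈ ψ.source ∧ ∀ z ∈ ψ.source, z ∈ P ↔ 0 ≤ (ψ z).re := by
  have mem : ∀ z, z ∈ P ↔ ‖z‖ ≤ g + 1 ∧ ∀ i < g, 1 / 4 ≤ ‖z - (i:ℂ)‖ := by
    intro z
    rw [hP]
    simp [dist_eq_norm]
  obtain ⟨k1, k2⟩ := (mem z₀).1 h1
  have nc : ∀ c : ℂ, Continuous fun z : ℂ => ‖z - c‖ := fun c => by fun_prop
  have evlt : ∀ (i : ℕ), 1 / 4 < ‖z₀ - i‖ → ∀ᶠ z in 𝓝 z₀, 1 / 4 ≤ ‖z - (i:ℂ)‖ := fun i hi =>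
    ((continuousAt_const.eventually_lt (nc i).continuousAt hi).mono fun z hz => le_of_lt hz)
  have evall : ∀ s : Set ℕ, (∀ i ∈ s, i < g → 1 / 4 < ‖z₀ - i‖) →
      ∀ᶠ z in 𝓝 z₀, ∀ i ∈ s, i < g → 1 / 4 ≤ ‖z - (i:ℂ)‖ := by
    intro s hs
    have : ∀ᶠ z in 𝓝 z₀, ∀ i ∈ Finset.range g, i ∈ s → 1 / 4 ≤ ‖z - (i:ℂ)‖ := by
      rw [Filter.eventually_all_finset]
      intro i hi
      by_cases his : i ∈ s
      · exact (evlt i (hs i his (Finset.mem_range.1 hi))).mono fun z hz _ => hz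
      · exact Filter.Eventually.of_forall fun z h => absurd h his
    exact this.mono fun z hz i hi hig => hz i (Finset.mem_range.2 hig) hi
  have evR : ‖z₀‖ < g + 1 → ∀ᶠ z in 𝓝 z₀, ‖z‖ ≤ g + 1 := fun h =>
    (continuous_norm.continuousAt.eventually_lt continuousAt_const h).mono fun z hz => le_of_lt hz
  by_cases hex : ∃ i < g, ‖z₀ - i‖ = 1 / 4
  · obtain ⟨i, hi, hzi⟩ := hex
    have hig : (i:ℝ) + 1 ≤ g := by exact_mod_cast hi
    have hR : ‖z₀‖ < g + 1 := by
      have : ‖z₀‖ ≤ ‖z₀ - i‖ + ‖(i:ℂ)‖ := by simpa using norm_add_le (z₀ - i) (i:ℂ)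
      rw [hzi, Complex.norm_natCast] at this
      linarith
    refine edge_chart (P := P) (c := i) (R := 1 / 4) (σ := 1) (by norm_num) hzi (Or.inl rfl) ?_
    have hne : ∀ᶠ z in 𝓝 z₀, 0 < ‖z - (i:ℂ)‖ :=
      continuousAt_const.eventually_lt (nc i).continuousAt (by rw [hzi]; norm_num)
    filter_upwards [evR hR, hne, evall {j | j ≠ i} (by
      intro j hj hjg
      have h3 : ‖(j:ℂ) - i‖ ≤ ‖z₀ - i‖ + ‖z₀ - j‖ := by
        have := norm_sub_le (z₀ - i) (z₀ - j)
        rwa [show z₀ - i - (z₀ - j) = (j:ℂ) - i by ring] at this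
      have h4 : (1:ℝ) ≤ ‖(j:ℂ) - i‖ := by
        rw [show (j:ℂ) - i = (((j:ℤ) - (i:ℤ) : ℤ) : ℂ) by push_cast; ring, Complex.norm_intCast]
        have : (1:ℤ) ≤ |(j:ℤ) - i| := by
          apply Int.one_le_abs
          have hj' : j ≠ i := hj
          omega
        exact_mod_cast this
      linarith)] with z z1 z2 z3
    rw [mem, one_mul, Real.log_nonneg_iff (by positivity), le_div_iff₀ (by norm_num), one_mul]
    constructor
    · rintro ⟨-, h⟩; exact h i hi
    · intro h
      refine ⟨z1, fun j hj => ?_⟩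
      by_cases hji : j = i
      · rw [hji]; exact h
      · exact z3 j hji hj
  · push Not at hex
    have hall : ∀ᶠ z in 𝓝 z₀, ∀ i ∈ (univ : Set ℕ), i < g → 1 / 4 ≤ ‖z - (i:ℂ)‖ :=
      evall univ fun i _ hi => lt_of_le_of_ne (k2 i hi) (hex i hi).symm
    have hR : ‖z₀‖ = g + 1 := by
      by_contra hcon
      apply h2
      rw [mem_interior_iff_mem_nhds]
      filter_upwards [evR (lt_of_le_of_ne k1 hcon), hall] with z z1 z2
      exact (mem z).2 ⟨z1, fun i hi => z2 i (mem_univ _) hi⟩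
    have hg0 : (0:ℝ) < g + 1 := by positivity
    refine edge_chart (P := P) (c := 0) (R := g + 1) (σ := -1) hg0 (by simpa using hR) (Or.inr rfl) ?_
    have hne : ∀ᶠ z in 𝓝 z₀, 0 < ‖z‖ :=
      continuousAt_const.eventually_lt continuous_norm.continuousAt (by rw [hR]; exact hg0)
    filter_upwards [hall, hne] with z z1 z2
    rw [mem, sub_zero, neg_one_mul, neg_nonneg, Real.log_nonpos_iff (by positivity), div_le_one hg0]
    exact and_iff_left fun i hi => z1 i (mem_univ _) hi

lemma edge_interior {P : Set ℂ} {ψ : OpenPartialHomeomorph ℂ ℂ}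
    (h : ∀ z ∈ ψ.source, z ∈ P ↔ 0 ≤ (ψ z).re) {z : ℂ} (hz : z ∈ ψ.source) :
    z ∈ interior P ↔ 0 < (ψ z).re := by
  constructor
  · intro hi
    refine lt_of_le_of_ne ((h z hz).1 (interior_subset hi)) fun h0 => ?_
    have ho : IsOpen (ψ.target ∩ ψ.symm ⁻¹' interior P) := ψ.isOpen_inter_preimage_symm isOpen_interior
    have hm : ψ z ∈ ψ.target ∩ ψ.symm ⁻¹' interior P :=
      ⟨ψ.map_source hz, by rw [mem_preimage, ψ.left_inv hz]; exact hi⟩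
    obtain ⟨ε, hε, hb⟩ := Metric.isOpen_iff.1 ho _ hm
    have hw : ψ z - ((ε / 2 : ℝ) : ℂ) ∈ ball (ψ z) ε := by
      rw [mem_ball, dist_eq_norm, sub_sub_cancel_left, norm_neg, Complex.norm_real, Real.norm_eq_abs,
        abs_of_pos (by linarith)]
      linarith
    obtain ⟨w1, w2⟩ := hb hw
    have := (h _ (ψ.map_target w1)).1 (interior_subset w2)
    rw [ψ.right_inv w1, Complex.sub_re, ← h0, Complex.ofReal_re] at this
    linarith
  · intro hi
    have ho : IsOpen (ψ.source ∩ ψ ⁻¹' {w | 0 < w.re}) :=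
      ψ.isOpen_inter_preimage (isOpen_lt continuous_const Complex.continuous_re)
    refine mem_interior.2 ⟨_, ?_, ho, hz, hi⟩
    rintro w ⟨w1, w2⟩
    exact (h w w1).2 (le_of_lt w2)

theorem locE_model (g : ℕ) : LocE ↥(frontier ((closedBall (0:ℂ) (g + 1) \
    ⋃ i ∈ Finset.range g, ball (i : ℂ) (1/4)) ×ˢ Icc (0:ℝ) 1)) := by
  set P : Set ℂ := closedBall (0:ℂ) (g + 1) \ ⋃ i ∈ Finset.range g, ball (i : ℂ) (1/4) with hP
  have hPc : IsClosed P := by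
    have : IsOpen (⋃ i ∈ Finset.range g, ball (i : ℂ) (1/4)) :=
      isOpen_biUnion fun i _ => isOpen_ball
    rw [hP, sdiff_eq]
    exact isClosed_closedBall.inter this.isClosed_compl
  have mem : ∀ x : ℂ × ℝ, x ∈ frontier (P ×ˢ Icc (0:ℝ) 1) ↔
      x.1 ∈ P ∧ 0 ≤ x.2 ∧ x.2 ≤ 1 ∧ (x.1 ∉ interior P ∨ x.2 = 0 ∨ x.2 = 1) := by
    intro x
    rw [frontier_prod_eq, hPc.closure_eq, hPc.frontier_eq, closure_Icc, frontier_Icc zero_le_one]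
    simp only [mem_union, mem_prod, mem_insert_iff, mem_singleton_iff, mem_sdiff, mem_Icc]
    constructor
    · rintro (⟨h1, h2⟩ | ⟨⟨h1, h2⟩, h3, h4⟩)
      · refine ⟨h1, ?_, ?_, Or.inr h2⟩ <;> rcases h2 with h2 | h2 <;> rw [h2] <;> norm_num
      · exact ⟨h1, h3, h4, Or.inl h2⟩
    · rintro ⟨h1, h2, h3, h4 | h4⟩
      · exact Or.inr ⟨⟨h1, h4⟩, h2, h3⟩
      · exact Or.inl ⟨h1, h4⟩
  intro q
  obtain ⟨q1, q2, q3, q4⟩ := (mem q).1 q.2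
  by_cases hq : (q : ℂ × ℝ).1 ∈ interior P
  · have q5 : (q : ℂ × ℝ).2 = 0 ∨ (q : ℂ × ℝ).2 = 1 := by tauto
    set t₀ := (q : ℂ × ℝ).2 with ht₀
    have ht : ∀ t : ℝ, (t = 0 ∨ t = 1) → |t - t₀| < 1 / 2 → t = t₀ := by
      intro t ht hh
      rw [abs_lt] at hh
      rcases ht with rfl | rfl <;> rcases q5 with q5 | q5 <;> rw [q5] at hh ⊢ <;> norm_num at hh
    refine chart_of (O := interior P ×ˢ {t | |t - t₀| < 1 / 2}) (V := interior P)
      (φ := Prod.fst) (γ := fun w => (w, t₀)) ?_ isOpen_interior continuous_fst.continuousOn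
      (by fun_prop) ?_ ?_ ?_ ?_ q ⟨hq, by simp [← ht₀]⟩
    · exact isOpen_interior.prod (isOpen_lt (by fun_prop) continuous_const)
    · rintro x ⟨-, hx⟩; exact hx.1
    · intro w hw
      exact ⟨(mem _).2 ⟨interior_subset hw, q2, q3, Or.inr q5⟩, hw, by simp⟩
    · rintro x ⟨hx, hx1, hx2⟩
      have := (mem x).1 hx
      have h5 := ht x.2 (by tauto) hx2
      exact Prod.ext rfl h5.symm
    · intro w hw; rfl
  · obtain ⟨ψ, ψ0, ψP⟩ := planar_edge g hP q1 hq
    obtain ⟨τ, τc, τi, τI, τe, τq⟩ : ∃ τ : ℝ → ℝ, Continuous τ ∧ (∀ t, τ (τ t) = t) ∧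
        (∀ t, (0 ≤ τ t ∧ τ t ≤ 1) ↔ (0 ≤ t ∧ t ≤ 1)) ∧
        (∀ t, (τ t = 0 ∨ τ t = 1) ↔ (t = 0 ∨ t = 1)) ∧ τ (q : ℂ × ℝ).2 < 1 := by
      by_cases h : (q : ℂ × ℝ).2 < 1
      · exact ⟨id, continuous_id, fun _ => rfl, fun _ => Iff.rfl, fun _ => Iff.rfl, h⟩
      · refine ⟨fun t => 1 - t, by fun_prop, fun t => by ring, fun t => ?_, fun t => ?_, by
          dsimp only; linarith⟩
        · constructor <;> rintro ⟨h1, h2⟩ <;> constructor <;> linarith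
        · constructor <;> rintro (h1 | h1)
          · right; linarith
          · left; linarith
          · right; linarith
          · left; linarith
    have mem2 : ∀ x : ℂ × ℝ, x.1 ∈ ψ.source → τ x.2 < 1 → (x ∈ frontier (P ×ˢ Icc (0:ℝ) 1) ↔
        0 ≤ (ψ x.1).re ∧ 0 ≤ τ x.2 ∧ ((ψ x.1).re = 0 ∨ τ x.2 = 0)) := by
      intro x hx hx1
      rw [mem, ← and_assoc (a := 0 ≤ x.2), ← τI, ← τe, edge_interior ψP hx, ψP _ hx]
      constructor
      · rintro ⟨h1, ⟨h2, h3⟩, h4⟩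
        refine ⟨h1, h2, ?_⟩
        rcases h4 with h4 | h4 | h4
        · left; linarith
        · exact Or.inr h4
        · linarith
      · rintro ⟨h1, h2, h3⟩
        refine ⟨h1, ⟨h2, hx1.le⟩, ?_⟩
        rcases h3 with h3 | h3
        · left; rw [h3]; exact lt_irrefl _
        · exact Or.inr (Or.inl h3)
    set κ : ℂ → ℂ := fun w => ((max (-w.re) 0 : ℝ) : ℂ) + (w.im : ℂ) * Complex.I with hκ
    have κc : Continuous κ := by rw [hκ]; fun_prop
    have κr : ∀ w, (κ w).re = max (-w.re) 0 := fun w => by simp [hκ]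
    have κi : ∀ w, (κ w).im = w.im := fun w => by simp [hκ]
    set φ : ℂ × ℝ → ℂ := fun x =>
      ((τ x.2 - (ψ x.1).re : ℝ) : ℂ) + ((ψ x.1).im : ℂ) * Complex.I with hφ
    have φr : ∀ x, (φ x).re = τ x.2 - (ψ x.1).re := fun x => by simp [hφ]
    have φi : ∀ x, (φ x).im = (ψ x.1).im := fun x => by simp [hφ]
    set γ : ℂ → ℂ × ℝ := fun w => (ψ.symm (κ w), τ (max w.re 0)) with hγ
    have hkey : ∀ x : ℂ × ℝ, 0 ≤ (ψ x.1).re → 0 ≤ τ x.2 → ((ψ x.1).re = 0 ∨ τ x.2 = 0) →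
        κ (φ x) = ψ x.1 ∧ max (φ x).re 0 = τ x.2 := by
      intro x h1 h2 h3
      constructor
      · apply Complex.ext
        · rw [κr, φr]
          rcases h3 with h3 | h3
          · rw [h3, max_eq_right (by linarith)]
          · rw [h3, max_eq_left (by linarith)]; ring
        · rw [κi, φi]
      · rw [φr]
        rcases h3 with h3 | h3
        · rw [h3, max_eq_left (by linarith)]; ring
        · rw [h3, max_eq_right (by linarith)]
    refine chart_of (O := ψ.source ×ˢ {t | τ t < 1}) (V := κ ⁻¹' ψ.target ∩ {w | w.re < 1})
      (φ := φ) (γ := γ) ?_ ?_ ?_ ?_ ?_ ?_ ?_ ?_ q ⟨ψ0, τq⟩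
    · exact ψ.open_source.prod (isOpen_lt τc continuous_const)
    · exact (ψ.open_target.preimage κc).inter (isOpen_lt Complex.continuous_re continuous_const)
    · have hc : ContinuousOn (fun x : ℂ × ℝ => ψ x.1)
          (frontier (P ×ˢ Icc (0:ℝ) 1) ∩ ψ.source ×ˢ {t | τ t < 1}) :=
        ψ.continuousOn.comp continuous_fst.continuousOn fun x hx => hx.2.1
      have hr := Complex.continuous_re.comp_continuousOn hc
      have hi := Complex.continuous_im.comp_continuousOn hc
      have ht : Continuous fun x : ℂ × ℝ => τ x.2 := τc.comp continuous_snd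
      exact (Complex.continuous_ofReal.comp_continuousOn (ht.continuousOn.sub hr)).add
        ((Complex.continuous_ofReal.comp_continuousOn hi).mul continuousOn_const)
    · refine ContinuousOn.prodMk ?_ ?_
      · exact ψ.symm.continuousOn.comp κc.continuousOn fun w hw => hw.1
      · exact (τc.comp (by fun_prop : Continuous fun w : ℂ => max w.re 0)).continuousOn
    · rintro x ⟨hx, hx1, hx2⟩
      have h3 := (mem2 x hx1 hx2).1 hx
      have hk := hkey x h3.1 h3.2.1 h3.2.2
      refine ⟨?_, ?_⟩
      · rw [mem_preimage, hk.1]; exact ψ.map_source hx1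
      · have : τ x.2 < 1 := hx2
        simp only [mem_ofPred_eq, φr]; linarith [h3.1]
    · rintro w ⟨hw1, hw2⟩
      have hs : (γ w).1 ∈ ψ.source := ψ.map_target hw1
      have ht : τ (γ w).2 = max w.re 0 := τi _
      have hv : ψ (γ w).1 = κ w := ψ.right_inv hw1
      have hlt : τ (γ w).2 < 1 := by rw [ht]; exact max_lt hw2 one_pos
      refine ⟨(mem2 _ hs hlt).2 ?_, hs, hlt⟩
      rw [ht, hv, κr]
      refine ⟨le_max_right _ _, le_max_right _ _, ?_⟩
      rcases le_total 0 w.re with h | h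
      · left; exact max_eq_right (by linarith)
      · right; exact max_eq_right h
    · rintro x ⟨hx, hx1, hx2⟩
      have h3 := (mem2 x hx1 hx2).1 hx
      have hk := hkey x h3.1 h3.2.1 h3.2.2
      rw [hγ]
      dsimp only
      rw [hk.1, hk.2, ψ.left_inv hx1, τi]
    · rintro w ⟨hw1, hw2⟩
      have ht : τ (γ w).2 = max w.re 0 := τi _
      have hv : ψ (γ w).1 = κ w := ψ.right_inv hw1
      apply Complex.ext
      · rw [φr, ht, hv, κr]
        rcases le_total 0 w.re with h | h
        · rw [max_eq_left h, max_eq_right (by linarith)]; ring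
        · rw [max_eq_right h, max_eq_left (by linarith)]; ring
      · rw [φi, hv, κi]

lemma LocE.of_homeo {F G : Type*} [TopologicalSpace F] [TopologicalSpace G] (h : F ≃ₜ G)
    (hG : LocE G) : LocE F := by
  intro x
  obtain ⟨e, he⟩ := hG (h x)
  exact ⟨h.toOpenPartialHomeomorph.trans e, by simp [he]⟩

end model
end Part15

end SC

/-- Let `F` be a closed orientable surface of genus `> 1`, and let `a`, `a'` be disjoint
non-separating simple closed curves in `F` whose union is non-separating in `F`.  Then
there is a simple closed curve `b` in `F` intersecting each of `a` and `a'` transversely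
in exactly one point. -/
theorem exists_curve_meeting_both_once (F : Type*) [TopologicalSpace F] (g : ℕ)
    (hg : 1 < g) (hF : Nonempty (F ≃ₜ ↥(surfaceModel g)))
    (a a' : Set F)
    (ha : IsSimpleClosedCurveIn a (univ : Set F))
    (ha' : IsSimpleClosedCurveIn a' (univ : Set F))
    (hdisj : Disjoint a a')
    (hnonsep_a : IsConnected aᶜ)
    (hnonsep_a' : IsConnected a'ᶜ)
    (hnonsep_union : IsConnected (a ∪ a')ᶜ) :
    ∃ b : Set F, IsSimpleClosedCurveIn b (univ : Set F) ∧
      MeetTransversallyOnceIn b a (univ : Set F) ∧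
      MeetTransversallyOnceIn b a' (univ : Set F) := by
  obtain ⟨h⟩ := hF
  have hT2 : T2Space F := h.symm.t2Space
  have hL : SC.LocE F := SC.LocE.of_homeo h (SC.locE_model g)
  obtain ⟨b, hb, hba, hba'⟩ := SC.main_surface hL ha.2 ha'.2 hdisj hnonsep_union.isPreconnected
  have key : ∀ C : Set F, SC.Cross b C → MeetTransversallyOnceIn b C univ := by
    rintro C ⟨p, hp, f, f1, f2, f3, f4⟩
    refine ⟨p, hp, f.source, subset_univ _, f.open_source.preimage continuous_subtype_val, f1,
      f.source.domRestrict f, f.isOpenEmbedding_restrict, f2, fun x => f3 x x.2, fun x => f4 x x.2⟩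
  exact ⟨b, ⟨subset_univ _, hb⟩, key a hba, key a' hba'⟩


end
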